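/- Let y = exp(log x/log₂ x) and z₁ = exp((log x)^{1/log₃ x}). There exists a positive constant A such that for all sufficiently large x the following holds: there is a set E of primes with |E| ≤ 2·log₂ x, each element of E exceeding log₂ x, such that for every prime p with z₁ < p and p ∉ E, every real t with p^{log₂ x} < t ≤ y, and every residue class a ∈ {1, …, p-1}, one has π(t; p, a) = (π(t)/(p-1))·(1 + O(1/(log t)^A)), with the implied constant uniform in p, t and a. -/

import Mathlib

open Real Filter

/-- `log₂ x = max(1, log log x)`. -/
noncomputable def llog (x : ℝ) : ℝ := max 1 (Real.log (Real.log x))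

/-- `log₃ x = max(1, log log log x)`. -/
noncomputable def lllog (x : ℝ) : ℝ := max 1 (Real.log (Real.log (Real.log x)))

/-- `π(t)`: the number of primes `≤ t`. -/
noncomputable def primePi (t : ℝ) : ℕ := {q : ℕ | q.Prime ∧ (q : ℝ) ≤ t}.ncard

/-- `π(t; p, a)`: the number of primes `q ≤ t` with `q ≡ a (mod p)`. -/
noncomputable def primePiAP (t : ℝ) (p a : ℕ) : ℕ :=
  {q : ℕ | q.Prime ∧ (q : ℝ) ≤ t ∧ q % p = a}.ncard


/-! Part 1 -/

namespace PAP
open Complex Metric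

/-- Blaschke factor product attached to `ρ`, radius `7/5`. -/
noncomputable def bl {n : ℕ} (ρ : Fin n → ℂ) (z : ℂ) : ℂ :=
  ∏ i, (((49/25 : ℝ) : ℂ) - (starRingEnd ℂ) (ρ i) * z) / ((7/5 : ℝ) : ℂ)

lemma bl_differentiable {n : ℕ} (ρ : Fin n → ℂ) : Differentiable ℂ (bl ρ) := by
  unfold bl
  fun_prop

lemma norm_bl_sphere {n : ℕ} (ρ : Fin n → ℂ) (z : ℂ) (hz : ‖z‖ = 7/5) :
    ‖bl ρ z‖ = ‖∏ i, (z - ρ i)‖ := by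
  unfold bl
  rw [norm_prod, norm_prod]
  refine Finset.prod_congr rfl fun i _ => ?_
  have h1 : ((49/25 : ℝ) : ℂ) = (starRingEnd ℂ) z * z := by
    rw [← Complex.normSq_eq_conj_mul_self, Complex.normSq_eq_norm_sq, hz]; norm_num
  rw [h1, ← sub_mul, norm_div, norm_mul, ← map_sub, RCLike.norm_conj, hz]
  simp

lemma blaschke_bound {f g : ℂ → ℂ} {n : ℕ} {ρ : Fin n → ℂ} {M : ℝ}
    (hg : Differentiable ℂ g) (hfg : ∀ z, f z = (∏ i, (z - ρ i)) * g z)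
    (hM : ∀ z, ‖z‖ ≤ 7/5 → ‖f z‖ ≤ M) (z : ℂ) (hz : ‖z‖ ≤ 7/5) :
    ‖g z * bl ρ z‖ ≤ M := by
  have hd : DiffContOnCl ℂ (fun z => g z * bl ρ z) (ball 0 (7/5)) :=
    (hg.mul (bl_differentiable ρ)).diffContOnCl
  refine Complex.norm_le_of_forall_mem_frontier_norm_le (U := ball 0 (7/5)) isBounded_ball hd
    (fun w hw => ?_) (z := z) ?_
  · rw [frontier_ball _ (by norm_num)] at hw
    have hw' : ‖w‖ = 7/5 := by simpa using hw
    rw [norm_mul, norm_bl_sphere ρ w hw', mul_comm, ← norm_mul, ← hfg]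
    exact hM w hw'.le
  · rw [closure_ball _ (by norm_num)]
    simpa using hz

lemma jensen_count {f g : ℂ → ℂ} {n : ℕ} {ρ : Fin n → ℂ} {M B : ℝ}
    (hg : Differentiable ℂ g) (hfg : ∀ z, f z = (∏ i, (z - ρ i)) * g z)
    (hρ : ∀ i, ‖ρ i‖ ≤ 13/10)
    (hM : ∀ z, ‖z‖ ≤ 7/5 → ‖f z‖ ≤ M) (h0 : f 0 ≠ 0) (hB : M ≤ ‖f 0‖ * Real.exp B) :
    (n : ℝ) ≤ 14 * B ∧ ‖f 0‖ ≤ ‖g 0 * bl ρ 0‖ := by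
  have h1 := blaschke_bound hg hfg hM 0 (by norm_num)
  have hb : ‖bl ρ 0‖ = (7/5)^n := by
    have : ∀ i : Fin n, ‖(((49/25 : ℝ) : ℂ) - (starRingEnd ℂ) (ρ i) * 0) / ((7/5 : ℝ) : ℂ)‖ = 7/5 := by
      intro i
      rw [mul_zero, sub_zero, norm_div, Complex.norm_real, Complex.norm_real]; norm_num
    rw [bl, norm_prod, Finset.prod_congr rfl (fun i _ => this i)]; simp [div_pow]
  have hf0 : ‖f 0‖ = (∏ i, ‖ρ i‖) * ‖g 0‖ := by
    rw [hfg, norm_mul, norm_prod]; simp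
  have hp : (∏ i, ‖ρ i‖) ≤ (13/10 : ℝ)^n := by
    calc (∏ i, ‖ρ i‖) ≤ ∏ i : Fin n, (13/10 : ℝ) :=
          Finset.prod_le_prod (fun i _ => norm_nonneg _) (fun i _ => hρ i)
      _ = _ := by rw [Finset.prod_const]; simp
  have hf0pos : 0 < ‖f 0‖ := norm_pos_iff.mpr h0
  have h2 : ‖f 0‖ * (14/13 : ℝ)^n ≤ ‖g 0 * bl ρ 0‖ := by
    rw [norm_mul, hb, hf0]
    calc (∏ i, ‖ρ i‖) * ‖g 0‖ * (14/13 : ℝ)^n ≤ (13/10 : ℝ)^n * ‖g 0‖ * (14/13 : ℝ)^n := by gcongr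
      _ = ‖g 0‖ * ((13/10) * (14/13))^n := by rw [mul_pow]; ring
      _ = _ := by norm_num
  constructor
  · have h3 : ‖f 0‖ * (14/13 : ℝ)^n ≤ ‖f 0‖ * Real.exp B := h2.trans (h1.trans hB)
    have h4 : (14/13 : ℝ)^n ≤ Real.exp B := le_of_mul_le_mul_left h3 hf0pos
    have h5 : n * Real.log (14/13) ≤ B := by
      have := Real.log_le_log (by positivity) h4
      rwa [Real.log_pow, Real.log_exp] at this
    have h6 : (1/14 : ℝ) ≤ Real.log (14/13) := by
      have := Real.one_sub_inv_le_log_of_pos (show (0:ℝ) < 14/13 by norm_num)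
      norm_num at this ⊢
      linarith
    have : (n:ℝ) * (1/14) ≤ n * Real.log (14/13) := by gcongr
    linarith
  · refine le_trans ?_ h2
    have : (1:ℝ) ≤ (14/13 : ℝ)^n := one_le_pow₀ (by norm_num)
    nlinarith

lemma exists_factor {f : ℂ → ℂ} {M B : ℝ} (hf : Differentiable ℂ f)
    (hM : ∀ z, ‖z‖ ≤ 7/5 → ‖f z‖ ≤ M) (h0 : f 0 ≠ 0) (hB : M ≤ ‖f 0‖ * Real.exp B) :
    ∃ (n : ℕ) (ρ : Fin n → ℂ) (g : ℂ → ℂ), (∀ i, ‖ρ i‖ ≤ 13/10 ∧ f (ρ i) = 0) ∧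
      Differentiable ℂ g ∧ (∀ z, f z = (∏ i, (z - ρ i)) * g z) ∧
      ∀ z, ‖z‖ ≤ 13/10 → g z ≠ 0 := by
  classical
  let P : ℕ → Prop := fun n => ∃ (ρ : Fin n → ℂ) (g : ℂ → ℂ), (∀ i, ‖ρ i‖ ≤ 13/10 ∧ f (ρ i) = 0) ∧
      Differentiable ℂ g ∧ (∀ z, f z = (∏ i, (z - ρ i)) * g z)
  have hP0 : P 0 := ⟨fun i => i.elim0, f, fun i => i.elim0, hf, by simp⟩
  have hbd : ∀ n, P n → n ≤ ⌊14 * B⌋₊ := by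
    rintro n ⟨ρ, g, h1, h2, h3⟩
    exact Nat.le_floor (jensen_count h2 h3 (fun i => (h1 i).1) hM h0 hB).1
  set n := Nat.findGreatest P ⌊14 * B⌋₊ with hn
  have hPn : P n := Nat.findGreatest_spec (m := 0) (Nat.zero_le _) hP0
  obtain ⟨ρ, g, h1, h2, h3⟩ := hPn
  refine ⟨n, ρ, g, h1, h2, h3, fun w hw hgw => ?_⟩
  have hPs : P (n+1) := by
    refine ⟨Fin.snoc ρ w, dslope g w, ?_, ?_, ?_⟩
    · intro i
      refine Fin.lastCases ?_ (fun j => ?_) i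
      · simp [hw, h3 w, hgw]
      · simpa using h1 j
    · have := (Complex.differentiableOn_dslope (f := g) (c := w) (s := Set.univ) Filter.univ_mem).2
        h2.differentiableOn
      exact differentiableOn_univ.mp this
    · intro z
      rw [Fin.prod_univ_castSucc]
      simp only [Fin.snoc_castSucc, Fin.snoc_last]
      rw [h3 z, mul_assoc]
      congr 1
      have := sub_smul_dslope g w z
      rw [hgw, sub_zero, smul_eq_mul] at this
      exact this.symm
  have hle := Nat.le_findGreatest (hbd _ hPs) hPs
  omega

/-- Local partial fraction expansion of the logarithmic derivative. -/
theorem partial_fractions_zero {f : ℂ → ℂ} {M B : ℝ} (hf : Differentiable ℂ f)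
    (hM : ∀ z, ‖z‖ ≤ 7/5 → ‖f z‖ ≤ M) (h0 : f 0 ≠ 0) (hB : M ≤ ‖f 0‖ * Real.exp B) (hB0 : 0 < B) :
    ∃ (n : ℕ) (ρ : Fin n → ℂ) (g : ℂ → ℂ), (∀ i, ‖ρ i‖ ≤ 13/10 ∧ f (ρ i) = 0) ∧
      (n : ℝ) ≤ 14 * B ∧ DifferentiableOn ℂ g (ball 0 (6/5)) ∧
      (∀ z ∈ ball (0:ℂ) (6/5), ‖g z‖ ≤ 1100 * B) ∧
      (∀ z ∈ ball (0:ℂ) (6/5), f z ≠ 0 → deriv f z / f z = ∑ i, 1 / (z - ρ i) + g z) ∧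
      ∀ z, ‖z‖ ≤ 13/10 → f z = 0 → ∃ i, ρ i = z := by
  obtain ⟨n, ρ, g, h1, h2, h3, h4⟩ := exists_factor hf hM h0 hB
  obtain ⟨hn, hG0⟩ := jensen_count h2 h3 (fun i => (h1 i).1) hM h0 hB
  set G : ℂ → ℂ := fun z => g z * bl ρ z with hG
  have hGd : Differentiable ℂ G := h2.mul (bl_differentiable ρ)
  have hfac : ∀ i z, ‖z‖ ≤ 13/10 → ((49/25 : ℝ) : ℂ) - (starRingEnd ℂ) (ρ i) * z ≠ 0 := by
    intro i z hz h
    have h5 : ((49/25 : ℝ) : ℂ) = (starRingEnd ℂ) (ρ i) * z := by linear_combination h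
    have h6 := congrArg norm h5
    rw [norm_mul, RCLike.norm_conj, Complex.norm_real] at h6
    have h7 : ‖ρ i‖ * ‖z‖ ≤ (13/10) * (13/10) := by
      gcongr; exact (h1 i).1
    norm_num at h6
    linarith
  have hbl : ∀ z, ‖z‖ ≤ 13/10 → bl ρ z ≠ 0 := by
    intro z hz
    unfold bl
    refine Finset.prod_ne_zero_iff.mpr fun i _ => div_ne_zero (hfac i z hz) (by norm_num)
  have hGne : ∀ z, ‖z‖ ≤ 13/10 → G z ≠ 0 := fun z hz => mul_ne_zero (h4 z hz) (hbl z hz)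
  -- logarithm
  have hex : DifferentiableOn ℂ (fun z => deriv G z / G z) (ball 0 (13/10)) := by
    intro z hz
    have hz' : ‖z‖ ≤ 13/10 := by simpa using (mem_ball.mp hz).le
    exact ((hGd.deriv z).div (hGd z) (hGne z hz')).differentiableWithinAt
  obtain ⟨h, hh0, hh⟩ := hex.isExactOn_ball.with_val_at 0 0
  have hconst : ∀ z ∈ ball (0:ℂ) (13/10), G z * Complex.exp (-h z) = G 0 := by
    intro z hz
    have key : ∀ w ∈ ball (0:ℂ) (13/10), HasDerivAt (fun w => G w * Complex.exp (-h w)) 0 w := by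
      intro w hw
      have hw' : ‖w‖ ≤ 13/10 := by simpa using (mem_ball.mp hw).le
      have := (hGd w).hasDerivAt.mul ((hh w hw).neg.cexp)
      have hne := hGne w hw'
      refine this.congr_deriv ?_
      have e : deriv G w = G w * (deriv G w / G w) := by rw [mul_div_cancel₀ _ hne]
      linear_combination (Complex.exp (-h w)) * e
    have := (isOpen_ball (x := (0:ℂ)) (ε := 13/10)).is_const_of_deriv_eq_zero
      (convex_ball _ _).isPreconnected
      (fun w hw => (key w hw).differentiableAt.differentiableWithinAt)
      (fun w hw => (key w hw).deriv) hz (mem_ball_self (by norm_num))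
    simpa [hh0] using this
  have hre : ∀ z ∈ ball (0:ℂ) (13/10), (h z).re ≤ B := by
    intro z hz
    have hz' : ‖z‖ < 13/10 := by simpa using hz
    have e1 := hconst z hz
    have e2 : G z = G 0 * Complex.exp (h z) := by
      rw [← e1, mul_assoc, ← Complex.exp_add]; simp
    have e3 : ‖G z‖ ≤ M := blaschke_bound h2 h3 hM z (by linarith)
    rw [e2, norm_mul, Complex.norm_exp] at e3
    have e4 : ‖G 0‖ * Real.exp (h z).re ≤ ‖G 0‖ * Real.exp B :=
      e3.trans (hB.trans (by gcongr))
    have := le_of_mul_le_mul_left e4 (norm_pos_iff.mpr (hGne 0 (by norm_num)))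
    exact Real.exp_le_exp.mp this
  have hbc : ∀ z, ‖z‖ ≤ 5/4 → ‖h z‖ ≤ 50 * B := by
    intro z hz
    have := Complex.borelCaratheodory_zero (f := h) (M := B) (R := 13/10) (z := z) hB0
      (fun w hw => (hh w hw).differentiableAt.differentiableWithinAt)
      (fun w hw => hre w hw) (by norm_num) (by simp; linarith) hh0
    refine this.trans ?_
    rw [div_le_iff₀ (by linarith)]
    nlinarith
  have hder : ∀ z, ‖z‖ < 6/5 → ‖deriv G z / G z‖ ≤ 1000 * B := by
    intro z hz
    have hzb : z ∈ ball (0:ℂ) (13/10) := by simp; linarith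
    rw [← (hh z hzb).deriv]
    have := Complex.norm_deriv_le_of_forall_mem_sphere_norm_le (f := h) (c := z) (R := 1/20)
      (C := 50 * B) (by norm_num) ?_ ?_
    · refine this.trans (le_of_eq ?_); ring
    · apply DifferentiableOn.diffContOnCl
      intro w hw
      have hw2 : w ∈ closedBall z (1/20) := closure_ball_subset_closedBall hw
      have hw3 : ‖w - z‖ ≤ 1/20 := by simpa [dist_eq_norm] using hw2
      have hw4 : ‖w‖ ≤ ‖w - z‖ + ‖z‖ := by simpa using norm_add_le (w - z) z
      exact (hh w (by simp; linarith)).differentiableAt.differentiableWithinAt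
    · intro w hw
      have hw3 : ‖w - z‖ = 1/20 := by simpa [dist_eq_norm] using hw
      have hw4 : ‖w‖ ≤ ‖w - z‖ + ‖z‖ := by simpa using norm_add_le (w - z) z
      exact hbc w (by linarith)
  refine ⟨n, ρ, fun z => deriv G z / G z + ∑ i, (starRingEnd ℂ) (ρ i) /
    (((49/25 : ℝ) : ℂ) - (starRingEnd ℂ) (ρ i) * z), h1, hn, ?_, ?_, ?_, ?_⟩
  · apply DifferentiableOn.add
    · exact hex.mono (ball_subset_ball (by norm_num))
    · apply DifferentiableOn.fun_sum
      intro i _ z hz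
      have hz' : ‖z‖ < 6/5 := by simpa using hz
      have := hfac i z (by linarith)
      apply DifferentiableAt.differentiableWithinAt
      exact DifferentiableAt.fun_div (by fun_prop) (by fun_prop) this
  · intro z hz
    have hz' : ‖z‖ < 6/5 := by simpa using hz
    refine (norm_add_le _ _).trans ?_
    have e1 : ‖∑ i, (starRingEnd ℂ) (ρ i) / (((49/25 : ℝ) : ℂ) - (starRingEnd ℂ) (ρ i) * z)‖
        ≤ ∑ i : Fin n, (13/4 : ℝ) := by
      refine norm_sum_le_of_le _ fun i _ => ?_
      rw [norm_div, RCLike.norm_conj]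
      have e2 : (2/5 : ℝ) ≤ ‖((49/25 : ℝ) : ℂ) - (starRingEnd ℂ) (ρ i) * z‖ := by
        have := norm_sub_norm_le ((49/25 : ℝ) : ℂ) ((starRingEnd ℂ) (ρ i) * z)
        rw [norm_mul, RCLike.norm_conj, Complex.norm_real] at this
        have h7 : ‖ρ i‖ * ‖z‖ ≤ (13/10) * (6/5) := by
          gcongr; exact (h1 i).1
        norm_num at this
        norm_num at h7 ⊢
        linarith
      rw [div_le_iff₀ (by linarith)]
      have := (h1 i).1
      linarith
    have e3 := hder z hz'
    simp only [Finset.sum_const, Finset.card_univ, Fintype.card_fin, nsmul_eq_mul] at e1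
    nlinarith
  · intro z hz hfz
    have hz' : ‖z‖ < 6/5 := by simpa using hz
    have hprod : ∀ i ∈ Finset.univ, z - ρ i ≠ 0 := by
      intro i _ h0
      apply hfz
      rw [h3, Finset.prod_eq_zero (Finset.mem_univ i) h0, zero_mul]
    have hgz := h4 z (by linarith)
    have e1 : logDeriv f z = ∑ i, 1 / (z - ρ i) + logDeriv g z := by
      have : f = fun z => (∏ i, (z - ρ i)) * g z := funext h3
      rw [this, logDeriv_mul z (Finset.prod_ne_zero_iff.mpr hprod) hgz (by fun_prop) (h2 z),
        logDeriv_prod hprod (by fun_prop)]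
      congr 1
      refine Finset.sum_congr rfl fun i _ => ?_
      simp [logDeriv_apply]
    have e2 : logDeriv G z = logDeriv g z + ∑ i, -(starRingEnd ℂ) (ρ i) /
        (((49/25 : ℝ) : ℂ) - (starRingEnd ℂ) (ρ i) * z) := by
      rw [hG, logDeriv_mul z hgz (hbl z (by linarith)) (h2 z) (bl_differentiable ρ z)]
      congr 1
      have hb : bl ρ = fun z => ∏ i, (((49/25 : ℝ) : ℂ) - (starRingEnd ℂ) (ρ i) * z) /
        ((7/5 : ℝ) : ℂ) := rfl
      rw [hb, logDeriv_prod (s := Finset.univ) (f := fun i z => (((49/25 : ℝ) : ℂ) -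
        (starRingEnd ℂ) (ρ i) * z) / ((7/5 : ℝ) : ℂ)) (x := z) (fun i _ => div_ne_zero (hfac i z (by linarith)) (by norm_num))
        (by fun_prop)]
      refine Finset.sum_congr rfl fun i _ => ?_
      have hfi := hfac i z (by linarith)
      have hd : HasDerivAt (fun z => (((49/25 : ℝ) : ℂ) - (starRingEnd ℂ) (ρ i) * z) /
        ((7/5 : ℝ) : ℂ)) ((-(starRingEnd ℂ) (ρ i)) / ((7/5 : ℝ) : ℂ)) z := by
        have := (((hasDerivAt_id z).const_mul ((starRingEnd ℂ) (ρ i))).const_sub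
          ((49/25 : ℝ) : ℂ)).div_const ((7/5 : ℝ) : ℂ)
        simpa using this
      rw [logDeriv_apply, hd.deriv]
      have h75 : (((7/5 : ℝ)) : ℂ) ≠ 0 := by norm_num
      rw [div_div_div_cancel_right₀ h75]
    rw [← logDeriv_apply, e1]
    change _ = _ + (logDeriv G z + _)
    rw [e2, add_assoc (logDeriv g z), ← Finset.sum_add_distrib]
    have : ∀ i ∈ Finset.univ, (-(starRingEnd ℂ) (ρ i) /
        (((49/25 : ℝ) : ℂ) - (starRingEnd ℂ) (ρ i) * z) + (starRingEnd ℂ) (ρ i) /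
        (((49/25 : ℝ) : ℂ) - (starRingEnd ℂ) (ρ i) * z)) = 0 := by
      intro i _; rw [neg_div]; ring
    rw [Finset.sum_eq_zero this, add_zero]
  · intro z hz hfz
    rw [h3, mul_eq_zero] at hfz
    rcases hfz with hfz | hfz
    · obtain ⟨i, _, hi⟩ := Finset.prod_eq_zero_iff.mp hfz
      exact ⟨i, (sub_eq_zero.mp hi).symm⟩
    · exact absurd hfz (h4 z hz)

end PAP


/-! Part 2 -/

namespace PAP
open Complex Metric

lemma sum_range_zmod (q : ℕ) [NeZero q] (f : ZMod q → ℂ) :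
    ∑ i ∈ Finset.range q, f (i : ZMod q) = ∑ a, f a := by
  refine Finset.sum_nbij' (fun i => (i : ZMod q)) (fun a => a.val) ?_ ?_ ?_ ?_ ?_
  · simp
  · intro a _; simpa using ZMod.val_lt a
  · intro i hi
    exact ZMod.val_cast_of_lt (by simpa using hi)
  · intro a _; simp
  · simp

lemma char_sum_range_le {q : ℕ} [NeZero q] {χ : DirichletCharacter ℂ q} (hχ : χ ≠ 1) (n : ℕ) :
    ‖∑ k ∈ Finset.range n, χ (k : ZMod q)‖ ≤ q := by
  induction n using Nat.strong_induction_on with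
  | _ n ih =>
    rcases lt_or_ge n q with h | h
    · calc ‖∑ k ∈ Finset.range n, χ (k : ZMod q)‖ ≤ ∑ k ∈ Finset.range n, (1:ℝ) :=
          norm_sum_le_of_le _ fun k _ => χ.norm_le_one _
        _ = n := by simp
        _ ≤ q := by exact_mod_cast h.le
    · obtain ⟨m, rfl⟩ := Nat.exists_eq_add_of_le' h
      rw [Finset.sum_range_add]
      have : ∑ x ∈ Finset.range q, χ ((m + x : ℕ) : ZMod q) = 0 := by
        have h1 := sum_range_zmod q (fun a => χ ((m : ZMod q) + a))
        have h2 : ∑ a, χ ((m : ZMod q) + a) = ∑ a, χ a :=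
          Fintype.sum_equiv (Equiv.addLeft (m : ZMod q)) _ _ (fun a => rfl)
        rw [h2, MulChar.sum_eq_zero_of_ne_one hχ] at h1
        simpa using h1
      rw [this, add_zero]
      exact ih m (by have := NeZero.pos q; omega)

lemma char_sum_Icc_le {q : ℕ} [NeZero q] {χ : DirichletCharacter ℂ q} (hχ : χ ≠ 1) (n : ℕ) :
    ‖∑ k ∈ Finset.Icc 1 n, χ (k : ZMod q)‖ ≤ q + 1 := by
  have h1 : ∑ k ∈ Finset.Icc 1 n, χ (k : ZMod q) =
      ∑ k ∈ Finset.range (n+1), χ (k : ZMod q) - χ ((0:ℕ) : ZMod q) := by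
    rw [Finset.sum_range_succ', Finset.range_eq_Ico,
      Finset.sum_Ico_add' (fun k : ℕ => χ (k : ZMod q)) 0 n 1, add_sub_cancel_right]
    rfl
  rw [h1]
  refine (norm_sub_le _ _).trans (add_le_add (char_sum_range_le hχ _) (χ.norm_le_one _))

/-- the partial sum function -/
noncomputable def Sχ {q : ℕ} (χ : DirichletCharacter ℂ q) (t : ℝ) : ℂ :=
  ∑ k ∈ Finset.Icc 1 ⌊t⌋₊, χ (k : ZMod q)

lemma Sχ_small {q : ℕ} (χ : DirichletCharacter ℂ q) {t : ℝ} (ht : t < 1) : Sχ χ t = 0 := by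
  have : ⌊t⌋₊ = 0 := Nat.floor_eq_zero.mpr ht
  simp [Sχ, this]

lemma Sχ_measurable {q : ℕ} (χ : DirichletCharacter ℂ q) : Measurable (Sχ χ) :=
  (measurable_from_nat (f := fun n => ∑ k ∈ Finset.Icc 1 n, χ (k : ZMod q))).comp Nat.measurable_floor

lemma mellin_bound {q : ℕ} [NeZero q] {χ : DirichletCharacter ℂ q} (hχ : χ ≠ 1) {s : ℂ}
    (hs : 0 < s.re) : ‖mellin (Sχ χ) (-s)‖ ≤ (q+1) / s.re := by
  have h1 : mellin (Sχ χ) (-s) = ∫ t : ℝ in Set.Ioi 1, (t : ℂ) ^ (-s - 1) • Sχ χ t := by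
    rw [mellin, ← MeasureTheory.integral_Ici_eq_integral_Ioi (x := (1:ℝ))]
    refine MeasureTheory.setIntegral_eq_of_subset_of_forall_sdiff_eq_zero
      measurableSet_Ioi (fun t ht => Set.mem_Ioi.mpr (lt_of_lt_of_le one_pos (Set.mem_Ici.mp ht)))
      (fun t ht => ?_)
    have : t < 1 := by simpa using ht.2
    simp [Sχ_small χ this]
  rw [h1]
  have h2 := integral_Ioi_rpow_of_lt (a := -s.re - 1) (by linarith) (c := 1) one_pos
  have h3 := integrableOn_Ioi_rpow_of_lt (a := -s.re - 1) (by linarith) (c := 1) one_pos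
  calc _ ≤ ∫ t : ℝ in Set.Ioi 1, (q+1) * t ^ (-s.re - 1) := by
        refine MeasureTheory.norm_integral_le_of_norm_le (h3.const_mul _) ?_
        refine (MeasureTheory.ae_restrict_iff' measurableSet_Ioi).mpr (Eventually.of_forall ?_)
        intro t ht
        have ht0 : 0 < t := lt_trans one_pos ht
        rw [norm_smul, Complex.norm_cpow_eq_rpow_re_of_pos ht0, mul_comm]
        have : (-s - 1).re = -s.re - 1 := by simp
        rw [this]
        gcongr
        exact char_sum_Icc_le hχ _
    _ = (q+1) / s.re := by
        rw [MeasureTheory.integral_const_mul, h2]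
        simp
        field_simp

lemma LFunction_eq_mellin {q : ℕ} [NeZero q] {χ : DirichletCharacter ℂ q} (hχ : χ ≠ 1) {s : ℂ}
    (hs : 0 < s.re) : χ.LFunction s = s * mellin (Sχ χ) (-s) := by
  have hO : ∀ l : Filter ℝ, Sχ χ =O[l] (fun _ => (1:ℝ)) := by
    intro l
    refine Asymptotics.IsBigO.of_bound (q+1) (Eventually.of_forall fun t => ?_)
    simpa [Sχ] using char_sum_Icc_le hχ _
  have hdiff : ∀ z : ℂ, 0 < z.re → DifferentiableAt ℂ (fun s => s * mellin (Sχ χ) (-s)) z := by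
    intro z hz
    have : DifferentiableAt ℂ (mellin (Sχ χ)) (-z) := by
      refine mellin_differentiableAt_of_isBigO_rpow (a := 0) (b := -z.re - 1) ?_ ?_ (by simpa using hz)
        ?_ (by simp)
      · apply MeasureTheory.LocallyIntegrable.locallyIntegrableOn
        exact (MeasureTheory.locallyIntegrable_const ((q:ℝ)+1)).mono
          (Sχ_measurable χ).aestronglyMeasurable (Eventually.of_forall fun t => by
            rw [Real.norm_of_nonneg (by positivity)]; exact char_sum_Icc_le hχ _)
      · simpa using hO atTop
      · have : Sχ χ =ᶠ[nhdsWithin 0 (Set.Ioi 0)] fun _ => 0 := by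
          have : Set.Iio (1:ℝ) ∈ nhdsWithin 0 (Set.Ioi (0:ℝ)) :=
            mem_nhdsWithin_of_mem_nhds (Iio_mem_nhds one_pos)
          filter_upwards [this] with t ht using Sχ_small χ ht
        exact this.trans_isBigO (Asymptotics.isBigO_zero _ _)
    exact differentiableAt_id.mul (this.comp z differentiableAt_id.neg)
  have hopen : IsOpen {z : ℂ | 0 < z.re} := isOpen_lt continuous_const Complex.continuous_re
  have hpre : IsPreconnected {z : ℂ | 0 < z.re} := (convex_halfSpace_re_gt 0).isPreconnected
  have hA1 : AnalyticOnNhd ℂ χ.LFunction {z : ℂ | 0 < z.re} :=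
    (DirichletCharacter.differentiable_LFunction hχ).differentiableOn.analyticOnNhd hopen
  have hA2 : AnalyticOnNhd ℂ (fun s => s * mellin (Sχ χ) (-s)) {z : ℂ | 0 < z.re} :=
    DifferentiableOn.analyticOnNhd (fun z hz => (hdiff z hz).differentiableWithinAt) hopen
  refine hA1.eqOn_of_preconnected_of_eventuallyEq hA2 hpre (z₀ := 2) (by simp) ?_ hs
  have : {z : ℂ | 1 < z.re} ∈ nhds (2:ℂ) :=
    (isOpen_lt continuous_const Complex.continuous_re).mem_nhds (by simp)
  filter_upwards [this] with z hz
  have hz1 : 1 < z.re := hz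
  rw [DirichletCharacter.LFunction_eq_LSeries χ hz1]
  rw [LSeries_eq_mul_integral _ le_rfl (by linarith)
    (DirichletCharacter.LSeriesSummable_of_one_lt_re χ hz1)]
  · congr 1
    rw [mellin]
    rw [← MeasureTheory.integral_Ici_eq_integral_Ioi]
    rw [MeasureTheory.setIntegral_eq_of_subset_of_forall_sdiff_eq_zero (s := Set.Ici 1)
      (t := Set.Ioi (0:ℝ)) measurableSet_Ioi
      (fun t ht => lt_of_lt_of_le one_pos ht) (fun t ht => ?_)]
    · refine MeasureTheory.integral_congr_ae (Eventually.of_forall fun t => ?_)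
      simp only [smul_eq_mul, Sχ]
      rw [mul_comm]
      congr 2
      ring
    · have : t < 1 := by simpa using ht.2
      simp [Sχ_small χ this]
  · refine Asymptotics.IsBigO.of_bound (q+1) (Eventually.of_forall fun t => ?_)
    simpa using char_sum_Icc_le hχ _

lemma norm_LFunction_le {q : ℕ} [NeZero q] {χ : DirichletCharacter ℂ q} (hχ : χ ≠ 1) {s : ℂ}
    (hs : 0 < s.re) : ‖χ.LFunction s‖ ≤ ‖s‖ * ((q+1) / s.re) := by
  rw [LFunction_eq_mellin hχ hs, norm_mul]
  gcongr
  exact mellin_bound hχ hs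

lemma norm_LFunction_two_ge {q : ℕ} [NeZero q] (χ : DirichletCharacter ℂ q) {s : ℂ}
    (hs : s.re = 2) : 1/3 ≤ ‖χ.LFunction s‖ := by
  have h1 : 1 < s.re := by rw [hs]; norm_num
  rw [DirichletCharacter.LFunction_eq_LSeries χ h1]
  have hsum := DirichletCharacter.LSeriesSummable_of_one_lt_re χ h1
  have hz : Summable (fun n : ℕ => 1 / ((n+2:ℕ):ℝ)^2) :=
    (summable_nat_add_iff (f := fun n : ℕ => 1 / ((n:ℕ):ℝ)^2) 2).mpr hasSum_zeta_two.summable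
  have hz2 : ∑' n : ℕ, 1 / ((n+2:ℕ):ℝ)^2 = π^2/6 - 1 := by
    have := hasSum_zeta_two.summable.sum_add_tsum_nat_add 2
    rw [hasSum_zeta_two.tsum_eq] at this
    simp [Finset.sum_range_succ] at this
    rw [← this]; simp
  unfold LSeries
  rw [← Summable.sum_add_tsum_nat_add (f := LSeries.term (fun n => χ n) s) 2 hsum]
  have h2 : ‖∑' n : ℕ, LSeries.term (fun n => χ n) s (n+2)‖ ≤ π^2/6 - 1 := by
    rw [← hz2]
    refine tsum_of_norm_bounded hz.hasSum fun n => ?_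
    rw [LSeries.norm_term_eq, if_neg (by omega), hs]
    have := χ.norm_le_one ((n+2:ℕ) : ZMod q)
    have e : ((n+2:ℕ):ℝ)^(2:ℝ) = ((n+2:ℕ):ℝ)^2 := by norm_cast
    rw [e]
    gcongr
  have h3 : ∑ i ∈ Finset.range 2, LSeries.term (fun n => χ n) s i = 1 := by
    simp [Finset.sum_range_succ, LSeries.term]
  rw [h3]
  have h4 : π^2/6 - 1 ≤ 2/3 := by
    have := Real.pi_lt_d2
    have := Real.pi_pos
    nlinarith
  have h5 := norm_sub_norm_le (1:ℂ) (-(∑' n : ℕ, LSeries.term (fun n => χ n) s (n+2)))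
  rw [norm_neg, sub_neg_eq_add, norm_one] at h5
  linarith

/-- analytic conductor -/
noncomputable def ell (q : ℕ) (t : ℝ) : ℝ := Real.log (q * (|t| + 4))

lemma ell_ge {q : ℕ} (hq : 2 ≤ q) (t : ℝ) : 2 ≤ ell q t := by
  have hq' : (2:ℝ) ≤ q := by exact_mod_cast hq
  have : Real.log 8 ≤ ell q t := Real.log_le_log (by norm_num) (by nlinarith [abs_nonneg t])
  have h8 : Real.log 8 = 3 * Real.log 2 := by
    rw [show (8:ℝ) = 2^3 by norm_num, Real.log_pow]; norm_num
  have := Real.log_two_gt_d9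
  linarith

structure PFData {q : ℕ} [NeZero q] (χ : DirichletCharacter ℂ q) (t0 : ℝ) where
  n : ℕ
  ρ : Fin n → ℂ
  g : ℂ → ℂ
  zero : ∀ i, χ.LFunction (ρ i) = 0
  near : ∀ i, ‖ρ i - (2 + t0 * I)‖ ≤ 13/10
  n_le : (n:ℝ) ≤ 28 * ell q t0
  g_diff : DifferentiableOn ℂ g (ball (2 + t0 * I) (6/5))
  g_le : ∀ z ∈ ball (2 + t0 * I : ℂ) (6/5), ‖g z‖ ≤ 2200 * ell q t0
  pf : ∀ z ∈ ball (2 + t0 * I : ℂ) (6/5), χ.LFunction z ≠ 0 →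
    deriv χ.LFunction z / χ.LFunction z = ∑ i, 1 / (z - ρ i) + g z
  complete : ∀ z, ‖z - (2 + t0 * I)‖ ≤ 13/10 → χ.LFunction z = 0 → ∃ i, ρ i = z

theorem exists_PFData {q : ℕ} [NeZero q] {χ : DirichletCharacter ℂ q} (hχ : χ ≠ 1) (t0 : ℝ)
    (hq : 2 ≤ q) : Nonempty (PFData χ t0) := by
  set c : ℂ := 2 + t0 * I with hc
  have hq' : (2:ℝ) ≤ q := by exact_mod_cast hq
  have hcre : c.re = 2 := by simp [hc]
  have hcn : ‖c‖ ≤ 2 + |t0| := by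
    refine (norm_add_le _ _).trans ?_
    simp
  have hd := DirichletCharacter.differentiable_LFunction hχ
  have hell := ell_ge hq t0
  have h0 := norm_LFunction_two_ge χ hcre
  have hA : ∀ z, ‖z‖ ≤ 7/5 → ‖χ.LFunction (c + z)‖ ≤ (5/2) * (q * (|t0| + 4)) := by
    intro z hz
    have hre : 3/5 ≤ (c + z).re := by
      rw [Complex.add_re, hcre]
      have := Complex.abs_re_le_norm z
      have := neg_abs_le z.re
      linarith
    refine (norm_LFunction_le hχ (by linarith)).trans ?_
    have e1 : ‖c + z‖ ≤ |t0| + 4 := (norm_add_le _ _).trans (by linarith)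
    have e2 : ((q:ℝ)+1)/(c+z).re ≤ (5/2) * q := by
      rw [div_le_iff₀ (by linarith)]
      nlinarith
    calc _ ≤ (|t0| + 4) * ((5/2) * q) := by gcongr
      _ = _ := by ring
  have hB : χ.LFunction (c + 0) ≠ 0 := by
    intro h
    simp only [add_zero] at h
    rw [h] at h0; norm_num at h0
  have hC : (5/2) * (q * (|t0| + 4)) ≤ ‖χ.LFunction (c + 0)‖ * Real.exp (2 * ell q t0) := by
    simp only [add_zero]
    have e : Real.exp (2 * ell q t0) = (q * (|t0| + 4)) * (q * (|t0| + 4)) := by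
      rw [two_mul, Real.exp_add, ell, Real.exp_log (by positivity)]
    rw [e]
    have h8 : 8 ≤ q * (|t0| + 4) := by nlinarith [abs_nonneg t0]
    have : (1/3) * (q * (|t0| + 4) * (q * (|t0| + 4))) ≤
      ‖χ.LFunction c‖ * (q * (|t0| + 4) * (q * (|t0| + 4))) := by gcongr
    nlinarith
  obtain ⟨n, ρ, g, h1, h2, h3, h4, h5, h6⟩ := partial_fractions_zero
    (f := fun z => χ.LFunction (c + z)) (M := (5/2) * (q * (|t0| + 4))) (B := 2 * ell q t0)
    (by exact hd.comp (by fun_prop)) hA hB hC (by linarith)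
  · have hder : ∀ z, deriv (fun z => χ.LFunction (c + z)) z = deriv χ.LFunction (c + z) := by
      intro z
      exact deriv_comp_const_add χ.LFunction c z
    refine ⟨⟨n, fun i => c + ρ i, fun z => g (z - c), ?_, ?_, ?_, ?_, ?_, ?_, ?_⟩⟩
    · intro i; exact (h1 i).2
    · intro i; rw [← hc]; simpa using (h1 i).1
    · linarith
    · refine h3.comp (by fun_prop) ?_
      intro z hz
      simpa [dist_eq_norm] using hz
    · intro z hz
      have := h4 (z - c) (by simpa [dist_eq_norm] using hz)
      linarith
    · intro z hz hz0
      have := h5 (z - c) (by simpa [dist_eq_norm] using hz) (by simpa using hz0)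
      rw [hder] at this
      simp only [add_sub_cancel] at this
      rw [this]
      congr 1
      refine Finset.sum_congr rfl fun i _ => ?_
      congr 1; ring
    · intro z hz hz0
      obtain ⟨i, hi⟩ := h6 (z - c) hz (by simpa using hz0)
      exact ⟨i, by simp only [hi]; ring⟩

lemma PFData.re_lt {q : ℕ} [NeZero q] {χ : DirichletCharacter ℂ q} {t0 : ℝ} (hχ : χ ≠ 1)
    (P : PFData χ t0) (i : Fin P.n) : (P.ρ i).re < 1 := by
  by_contra! h
  exact DirichletCharacter.LFunction_ne_zero_of_one_le_re χ (Or.inl hχ) h (P.zero i)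

end PAP


/-! Part 3 -/

namespace PAP
open Complex Metric ArithmeticFunction

/-- logarithmic derivative -/
noncomputable def FL {q : ℕ} [NeZero q] (χ : DirichletCharacter ℂ q) (s : ℂ) : ℂ :=
  deriv χ.LFunction s / χ.LFunction s

lemma Lam_summable {σ : ℝ} (hσ : 1 < σ) : Summable (fun n : ℕ => Λ n / (n:ℝ)^σ) := by
  have h := ArithmeticFunction.LSeriesSummable_vonMangoldt (s := (σ:ℂ)) (by simpa using hσ)
  have h2 := h.norm
  refine h2.congr fun n => ?_
  rw [LSeries.norm_term_eq]
  split_ifs with h0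
  · simp [h0]
  · simp [abs_of_nonneg (ArithmeticFunction.vonMangoldt_nonneg)]

lemma Lam_sum : ∃ C0 : ℝ, 1 ≤ C0 ∧ ∀ η : ℝ, 0 < η → η ≤ 1 →
    ∑' n : ℕ, Λ n / (n:ℝ)^(1+η) ≤ 1/η + C0 := by
  have hc := ArithmeticFunction.vonMangoldt.continuousOn_LFunctionResidueClassAux (q := 1) 1
  have hK : IsCompact ((fun x : ℝ => (x:ℂ)) '' Set.Icc 1 2) :=
    isCompact_Icc.image Complex.continuous_ofReal
  obtain ⟨C, hC⟩ := hK.exists_bound_of_continuousOn (hc.mono (by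
    rintro _ ⟨x, hx, rfl⟩; simpa using hx.1))
  refine ⟨max C 1, le_max_right _ _, fun η h0 h1 => ?_⟩
  have h2 := hC ((1+η : ℝ):ℂ) ⟨1+η, ⟨by linarith, by linarith⟩, rfl⟩
  rw [ArithmeticFunction.vonMangoldt.eqOn_LFunctionResidueClassAux (q := 1) isUnit_one
    (show ((1+η:ℝ):ℂ) ∈ {s : ℂ | 1 < s.re} by simp [h0])] at h2
  have h3 : LSeries (fun n => ((ArithmeticFunction.vonMangoldt.residueClass (1 : ZMod 1) n : ℝ):ℂ))
      ((1+η:ℝ):ℂ) = ((∑' n : ℕ, Λ n / (n:ℝ)^(1+η) : ℝ) : ℂ) := by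
    rw [LSeries, Complex.ofReal_tsum]
    refine tsum_congr fun n => ?_
    rcases eq_or_ne n 0 with rfl | hn
    · simp
    rw [LSeries.term_of_ne_zero hn]
    rw [Complex.ofReal_div, Complex.ofReal_cpow (by positivity)]
    congr 2
    rw [ArithmeticFunction.vonMangoldt.residueClass, Set.indicator_of_mem]
    exact Subsingleton.elim _ _
  simp only [h3] at h2
  have h4 : ((∑' n : ℕ, Λ n / (n:ℝ)^(1+η) : ℝ) : ℂ) - ((Nat.totient 1 : ℕ) : ℂ)⁻¹ / (((1+η:ℝ):ℂ) - 1) =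
      (((∑' n : ℕ, Λ n / (n:ℝ)^(1+η)) - 1/η : ℝ) : ℂ) := by
    push_cast
    simp
  rw [h4, Complex.norm_real] at h2
  have := le_abs_self ((∑' n : ℕ, Λ n / (n:ℝ)^(1+η)) - 1/η)
  have := le_max_left C 1
  rw [Real.norm_eq_abs] at h2
  linarith

lemma FL_hasSum {q : ℕ} [NeZero q] (χ : DirichletCharacter ℂ q) {s : ℂ} (hs : 1 < s.re) :
    HasSum (fun n : ℕ => χ n * Λ n / (n:ℂ)^s) (-FL χ s) := by
  have h1 := DirichletCharacter.LSeries_twist_vonMangoldt_eq χ hs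
  have h2 := DirichletCharacter.LSeriesSummable_twist_vonMangoldt χ hs
  have h3 : -FL χ s = LSeries ((fun n : ℕ => χ n) * fun n : ℕ => (Λ n : ℂ)) s := by
    rw [h1, FL, DirichletCharacter.deriv_LFunction_eq_deriv_LSeries χ hs,
      DirichletCharacter.LFunction_eq_LSeries χ hs, neg_div]
  rw [h3]
  have h4 := h2.hasSum
  refine h4.congr_fun ?_ |> fun h => h
  intro n
  rcases eq_or_ne n 0 with rfl | hn
  · simp
  · rw [LSeries.term_of_ne_zero hn]; simp

lemma norm_FL_le {q : ℕ} [NeZero q] (χ : DirichletCharacter ℂ q) {s : ℂ} (hs : 1 < s.re) :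
    ‖FL χ s‖ ≤ ∑' n : ℕ, Λ n / (n:ℝ)^s.re := by
  rw [← norm_neg, ← (FL_hasSum χ hs).tsum_eq]
  refine tsum_of_norm_bounded (Lam_summable hs).hasSum fun n => ?_
  rcases eq_or_ne n 0 with rfl | hn
  · simp
  rw [norm_div, norm_mul, Complex.norm_natCast_cpow_of_pos (Nat.pos_of_ne_zero hn),
    Complex.norm_real, Real.norm_of_nonneg ArithmeticFunction.vonMangoldt_nonneg]
  gcongr
  exact mul_le_of_le_one_left ArithmeticFunction.vonMangoldt_nonneg (χ.norm_le_one _)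

lemma mem_ball_line {η t t0 : ℝ} (h0 : 0 < η) (h1 : η ≤ 1) (ht : |t - t0| ≤ 1/4) :
    (1 + η + t * I : ℂ) ∈ ball (2 + t0 * I : ℂ) (6/5) := by
  rw [mem_ball, dist_eq_norm]
  have : (1 + η + t * I - (2 + t0 * I) : ℂ) = ((η - 1 : ℝ) : ℂ) + ((t - t0 : ℝ):ℂ) * I := by
    push_cast; ring
  rw [this, Complex.norm_add_mul_I, Real.sqrt_lt' (by norm_num)]
  have := abs_le.mp ht
  nlinarith

lemma LFunction_ne {q : ℕ} [NeZero q] {χ : DirichletCharacter ℂ q} (hχ : χ ≠ 1) {s : ℂ}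
    (hs : 1 ≤ s.re) : χ.LFunction s ≠ 0 :=
  DirichletCharacter.LFunction_ne_zero_of_one_le_re χ (Or.inl hχ) hs

lemma PFData.FL_eq {q : ℕ} [NeZero q] {χ : DirichletCharacter ℂ q} (hχ : χ ≠ 1) {t0 : ℝ}
    (P : PFData χ t0) {s : ℂ} (hs : s ∈ ball (2 + t0 * I : ℂ) (6/5)) (h1 : 1 ≤ s.re) :
    FL χ s = ∑ i, 1 / (s - P.ρ i) + P.g s :=
  P.pf s hs (LFunction_ne hχ h1)

lemma re_inv_sub {s ρ : ℂ} : (1/(s - ρ)).re = (s.re - ρ.re) / ‖s - ρ‖^2 := by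
  rw [one_div, Complex.inv_re, Complex.normSq_eq_norm_sq, Complex.sub_re]

lemma PFData.sum_re_le {q : ℕ} [NeZero q] {χ : DirichletCharacter ℂ q} (hχ : χ ≠ 1) {t0 : ℝ}
    (P : PFData χ t0) {C0 : ℝ} (hC0 : ∀ η : ℝ, 0 < η → η ≤ 1 →
    ∑' n : ℕ, Λ n / (n:ℝ)^(1+η) ≤ 1/η + C0) {η t : ℝ} (h0 : 0 < η) (h1 : η ≤ 1)
    (ht : |t - t0| ≤ 1/4) :
    ∑ i, (1 / ((1 + η + t * I : ℂ) - P.ρ i)).re ≤ 1/η + C0 + 2200 * ell q t0 := by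
  have hb := mem_ball_line h0 h1 ht
  have hre : (1 + η + t * I : ℂ).re = 1 + η := by simp
  have h2 := P.FL_eq hχ hb (by rw [hre]; linarith)
  have h3 := norm_FL_le χ (s := 1 + η + t * I) (by rw [hre]; linarith)
  rw [hre] at h3
  have h4 := h3.trans (hC0 η h0 h1)
  have h5 := P.g_le _ hb
  rw [← Complex.re_sum]
  have h6 : (∑ i, 1 / ((1 + η + t * I : ℂ) - P.ρ i)) = FL χ (1 + η + t * I) - P.g (1 + η + t * I) := by
    rw [h2]; ring
  rw [h6]
  refine (Complex.re_le_norm _).trans ((norm_sub_le _ _).trans ?_)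
  linarith

lemma PFData.sum_inv_sq_le {q : ℕ} [NeZero q] {χ : DirichletCharacter ℂ q} (hχ : χ ≠ 1) {t0 : ℝ}
    (P : PFData χ t0) {C0 : ℝ} (hC0 : ∀ η : ℝ, 0 < η → η ≤ 1 →
    ∑' n : ℕ, Λ n / (n:ℝ)^(1+η) ≤ 1/η + C0) {η t : ℝ} (h0 : 0 < η) (h1 : η ≤ 1)
    (ht : |t - t0| ≤ 1/4) :
    ∑ i, η / ‖(1 + η + t * I : ℂ) - P.ρ i‖^2 ≤ 1/η + C0 + 2200 * ell q t0 := by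
  refine le_trans (Finset.sum_le_sum fun i _ => ?_) (P.sum_re_le hχ hC0 h0 h1 ht)
  rw [re_inv_sub]
  have := P.re_lt hχ i
  have hre : (1 + η + t * I : ℂ).re = 1 + η := by simp
  gcongr
  rw [hre]; linarith

/-- one term lower bound for the real part. -/
lemma neg_re_FL_le {q : ℕ} [NeZero q] {χ : DirichletCharacter ℂ q} (hχ : χ ≠ 1) (hq : 2 ≤ q)
    {η γ : ℝ} (h0 : 0 < η) (h1 : η ≤ 1) :
    (-FL χ (1 + η + γ * I)).re ≤ 2200 * ell q γ ∧
    ∀ β : ℝ, 9/10 ≤ β → χ.LFunction (β + γ * I) = 0 →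
      (-FL χ (1 + η + γ * I)).re ≤ 2200 * ell q γ - 1 / (1 + η - β) := by
  obtain ⟨P⟩ := exists_PFData hχ γ hq
  have hb := mem_ball_line (t := γ) (t0 := γ) h0 h1 (by norm_num)
  have hre : (1 + η + γ * I : ℂ).re = 1 + η := by simp
  have h2 := P.FL_eq hχ hb (by rw [hre]; linarith)
  have h5 := P.g_le _ hb
  have h6 : -(P.g (1 + η + γ * I)).re ≤ 2200 * ell q γ := by
    have := Complex.abs_re_le_norm (P.g (1 + η + γ * I))
    have := neg_abs_le (P.g (1 + η + γ * I)).re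
    linarith
  have hpos : ∀ i, 0 ≤ (1 / ((1 + η + γ * I : ℂ) - P.ρ i)).re := by
    intro i
    rw [re_inv_sub]
    have := P.re_lt hχ i
    apply div_nonneg _ (by positivity)
    rw [hre]; linarith
  rw [h2, Complex.neg_re, Complex.add_re, Complex.re_sum]
  constructor
  · have := Finset.sum_nonneg (fun i (_ : i ∈ Finset.univ) => hpos i)
    linarith
  · intro β hβ hz
    have hβ1 : β < 1 := by
      by_contra! h
      exact LFunction_ne hχ (s := β + γ * I) (by simpa using h) hz
    obtain ⟨i, hi⟩ := P.complete (β + γ * I) (by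
      have : (β + γ * I - (2 + γ * I) : ℂ) = ((β - 2 : ℝ):ℂ) := by push_cast; ring
      rw [this, Complex.norm_real, Real.norm_eq_abs, abs_le]
      constructor <;> linarith) hz
    have h7 := Finset.single_le_sum (fun i (_ : i ∈ Finset.univ) => hpos i) (Finset.mem_univ i)
    have h8 : (1 / ((1 + η + γ * I : ℂ) - P.ρ i)).re = 1 / (1 + η - β) := by
      rw [hi]
      have : (1 + η + γ * I - (β + γ * I) : ℂ) = ((1 + η - β : ℝ):ℂ) := by push_cast; ring
      rw [this, ← Complex.ofReal_one, ← Complex.ofReal_div, Complex.ofReal_re]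
    rw [h8] at h7
    linarith

lemma exists_psi {p1 p2 : ℕ} (hp1 : p1.Prime) (hp2 : p2.Prime) (hne : p1 ≠ p2)
    [NeZero p1] [NeZero p2] [NeZero (p1 * p2)]
    {χ1 : DirichletCharacter ℂ p1} {χ2 : DirichletCharacter ℂ p2} (h1 : χ1 ≠ 1) :
    ∃ ψ : DirichletCharacter ℂ (p1 * p2), ψ ≠ 1 ∧ ∀ n : ℕ, ψ n = χ1 n * (starRingEnd ℂ) (χ2 n) := by
  have hcop : Nat.Coprime p1 p2 := (Nat.coprime_primes hp1 hp2).mpr hne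
  have hψ : ∀ n : ℕ, (DirichletCharacter.changeLevel (dvd_mul_right p1 p2) χ1 *
    DirichletCharacter.changeLevel (dvd_mul_left p2 p1) χ2⁻¹) (n : ZMod (p1*p2)) =
      χ1 n * (starRingEnd ℂ) (χ2 n) := by
    intro n
    have e3 : (starRingEnd ℂ) (χ2 n) = χ2⁻¹ n := by
      rw [← MulChar.star_eq_inv]; rfl
    rw [MulChar.mul_apply]
    by_cases hn : IsUnit (n : ZMod (p1*p2))
    · have hc : IsCoprime ((n:ℕ):ℤ) ((p1*p2 : ℕ):ℤ) := by
        rwa [Nat.isCoprime_iff_coprime, ← ZMod.isUnit_iff_coprime]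
      have a1 := DirichletCharacter.changeLevel_eq_cast_of_dvd' χ1 (dvd_mul_right p1 p2) hc
      have a2 := DirichletCharacter.changeLevel_eq_cast_of_dvd' χ2⁻¹ (dvd_mul_left p2 p1) hc
      simp only [Int.cast_natCast] at a1 a2
      rw [a1, a2, e3]
    · rw [MulChar.map_nonunit _ hn, zero_mul]
      rw [ZMod.isUnit_iff_coprime, Nat.coprime_mul_iff_right, not_and_or] at hn
      rcases hn with hn | hn
      · rw [MulChar.map_nonunit χ1 (by rwa [ZMod.isUnit_iff_coprime]), zero_mul]
      · rw [MulChar.map_nonunit χ2 (by rwa [ZMod.isUnit_iff_coprime]), _root_.map_zero, mul_zero]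
  refine ⟨_, fun h => ?_, hψ⟩
  apply h1
  ext a
  rw [MulChar.one_apply_coe]
  obtain ⟨n, hn1, hn2⟩ := Nat.chineseRemainder hcop ((a : ZMod p1).val) 1
  have e1 : (n : ZMod p1) = (a : ZMod p1) := by
    rw [(ZMod.natCast_eq_natCast_iff _ _ _).mpr hn1]; simp
  have e2 : (n : ZMod p2) = 1 := by
    rw [(ZMod.natCast_eq_natCast_iff _ _ _).mpr hn2]; simp
  have := hψ n
  rw [h, e1, e2, map_one, map_one, mul_one] at this
  rw [← this]
  apply MulChar.one_apply
  rw [ZMod.isUnit_iff_coprime, Nat.coprime_mul_iff_right]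
  constructor
  · rw [← ZMod.isUnit_iff_coprime, e1]; exact a.isUnit
  · rw [← ZMod.isUnit_iff_coprime, e2]; exact isUnit_one

lemma re_char_sum {q : ℕ} [NeZero q] (χ : DirichletCharacter ℂ q) {η : ℝ} (h0 : 0 < η) (γ : ℝ) :
    HasSum (fun n : ℕ => Λ n / (n:ℝ)^(1+η) * (χ n * (n:ℂ)^(-(γ*I))).re)
      (-FL χ (1 + η + γ * I)).re := by
  have h := Complex.hasSum_re (FL_hasSum χ (s := 1 + η + γ * I) (by simpa using h0))
  convert h using 1
  ext n
  rcases eq_or_ne n 0 with rfl | hn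
  · simp
  have hn' : (n:ℂ) ≠ 0 := by exact_mod_cast hn
  have e1 : (n:ℂ)^(1 + η + γ * I : ℂ) = (((n:ℝ)^(1+η) : ℝ):ℂ) * (n:ℂ)^(γ*I) := by
    rw [Complex.cpow_add _ _ hn', Complex.ofReal_cpow (by positivity)]
    push_cast; rfl
  rw [e1, Complex.cpow_neg]
  rw [show χ n * (Λ n : ℂ) / ((((n:ℝ)^(1+η) : ℝ):ℂ) * (n:ℂ)^(γ*I)) =
    ((Λ n / (n:ℝ)^(1+η) : ℝ) : ℂ) * (χ n * ((n:ℂ)^(γ*I))⁻¹) by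
      push_cast; rw [div_mul_eq_div_div]; ring]
  rw [Complex.re_ofReal_mul]

theorem two_zeros : ∃ c : ℝ, 0 < c ∧ c ≤ 1/100 ∧ ∀ (p1 p2 : ℕ) (_ : p1.Prime) (_ : p2.Prime)
    (_ : p1 ≠ p2) [NeZero p1] [NeZero p2]
    (χ1 : DirichletCharacter ℂ p1) (χ2 : DirichletCharacter ℂ p2) (_ : χ1 ≠ 1) (_ : χ2 ≠ 1)
    (ρ1 ρ2 : ℂ) (_ : χ1.LFunction ρ1 = 0) (_ : χ2.LFunction ρ2 = 0) (B : ℝ)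
    (_ : ell p1 ρ1.im ≤ B) (_ : ell p2 ρ2.im ≤ B) (_ : ell (p1*p2) (ρ1.im - ρ2.im) ≤ B),
    ¬ (1 - c / B ≤ ρ1.re ∧ 1 - c / B ≤ ρ2.re) := by
  obtain ⟨C0, hC1, hC0⟩ := Lam_sum
  set c1 : ℝ := (3/5) / (14000 + 2 * C0) with hc1
  have hpos : 0 < 14000 + 2 * C0 := by linarith
  have hc1pos : 0 < c1 := by positivity
  have hc1le : c1 ≤ 1/100 := by
    rw [hc1, div_le_iff₀ hpos]; linarith
  refine ⟨c1/9, by positivity, by linarith, ?_⟩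
  intro p1 p2 hp1 hp2 hne _ _ χ1 χ2 hχ1 hχ2 ρ1 ρ2 hz1 hz2 B hB1 hB2 hB3 ⟨hb1, hb2⟩
  have : NeZero (p1 * p2) := ⟨mul_ne_zero hp1.ne_zero hp2.ne_zero⟩
  obtain ⟨ψ, hψ1, hψ⟩ := exists_psi (χ2 := χ2) hp1 hp2 hne hχ1
  have hBge : 2 ≤ B := (ell_ge hp1.two_le _).trans hB1
  set η : ℝ := c1 / B with hη
  have hη0 : 0 < η := by positivity
  have hη1 : η ≤ 1 := by
    rw [hη, div_le_iff₀ (by linarith)]; linarith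
  have hcB : c1 / 9 / B = η / 9 := by rw [hη]; ring
  have hηs : η ≤ 1/10 := by
    rw [hη, div_le_iff₀ (by linarith)]; linarith
  rw [hcB] at hb1 hb2
  have S0 := (Lam_summable (σ := 1 + η) (by linarith)).hasSum
  have S1 := re_char_sum χ1 hη0 ρ1.im
  have S2 := re_char_sum χ2 hη0 ρ2.im
  have S3 := re_char_sum ψ hη0 (ρ1.im - ρ2.im)
  have T := (((S0.mul_left 3).add (S1.mul_left 2)).add (S2.mul_left 2)).add (S3.mul_left 2)
  have hT := T.nonneg (fun n => ?_)
  · have B1 := (neg_re_FL_le hχ1 hp1.two_le (γ := ρ1.im) hη0 hη1).2 ρ1.re (by linarith) (by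
      rwa [Complex.re_add_im])
    have B2 := (neg_re_FL_le hχ2 hp2.two_le (γ := ρ2.im) hη0 hη1).2 ρ2.re (by linarith) (by
      rwa [Complex.re_add_im])
    have B3 := (neg_re_FL_le hψ1 (hp1.two_le.trans (Nat.le_mul_of_pos_right _ hp2.pos))
      (γ := ρ1.im - ρ2.im) hη0 hη1).1
    have B0 := hC0 η hη0 hη1
    have D : ∀ β : ℝ, 1 - η/9 ≤ β → β < 1 → (9/10) * (1/η) ≤ 1/(1+η-β) := by
      intro β h1 h2
      rw [div_eq_mul_one_div (9:ℝ) 10, mul_one_div, div_le_div_iff₀ hη0 (by linarith)]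
      linarith
    have hlt1 : ρ1.re < 1 := by
      by_contra! h
      exact LFunction_ne hχ1 h hz1
    have hlt2 : ρ2.re < 1 := by
      by_contra! h
      exact LFunction_ne hχ2 h hz2
    have D1 := D _ hb1 hlt1
    have D2 := D _ hb2 hlt2
    have e : 1/η = (14000 + 2*C0) * (5/3) * B := by
      rw [hη, hc1]; field_simp
    have e5 : 0 ≤ (B - 2) * C0 := mul_nonneg (by linarith) (by linarith)
    nlinarith
  · have hL : 0 ≤ Λ n / (n:ℝ)^(1+η) := div_nonneg ArithmeticFunction.vonMangoldt_nonneg (by positivity)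
    rcases eq_or_ne n 0 with rfl | hn
    · simp
    have hn' : (n:ℂ) ≠ 0 := by exact_mod_cast hn
    set z1 := χ1 n * (n:ℂ)^(-(ρ1.im*I)) with hz1
    set z2 := χ2 n * (n:ℂ)^(-(ρ2.im*I)) with hz2
    have e3 : ψ n * (n:ℂ)^(-(((ρ1.im - ρ2.im : ℝ) : ℂ)*I)) = z1 * (starRingEnd ℂ) z2 := by
      rw [hψ, hz1, hz2, map_mul]
      have : (starRingEnd ℂ) ((n:ℂ)^(-(ρ2.im*I))) = (n:ℂ)^(ρ2.im*I) := by
        have := Complex.cpow_conj (n:ℂ) (-(ρ2.im*I)) (by rw [Complex.natCast_arg]; exact Real.pi_pos.ne)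
        rw [Complex.conj_natCast] at this
        rw [← this]
        simp
      rw [this, show (-(((ρ1.im - ρ2.im : ℝ) : ℂ)*I)) = -(ρ1.im*I) + ρ2.im*I by push_cast; ring,
        Complex.cpow_add _ _ hn']
      ring
    have hn1 : ∀ γ : ℝ, ‖(n:ℂ)^(-(γ*I))‖ = 1 := by
      intro γ
      rw [Complex.norm_natCast_cpow_of_pos (Nat.pos_of_ne_zero hn)]; simp
    have N1 : ‖z1‖ ≤ 1 := by rw [hz1, norm_mul, hn1, mul_one]; exact χ1.norm_le_one _
    have N2 : ‖z2‖ ≤ 1 := by rw [hz2, norm_mul, hn1, mul_one]; exact χ2.norm_le_one _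
    rw [e3]
    have key : 0 ≤ 3 + 2 * z1.re + 2 * z2.re + 2 * (z1 * (starRingEnd ℂ) z2).re := by
      have a1 : z1.re^2 + z1.im^2 ≤ 1 := by
        have := Complex.sq_norm z1
        rw [Complex.normSq_apply] at this
        nlinarith [norm_nonneg z1]
      have a2 : z2.re^2 + z2.im^2 ≤ 1 := by
        have := Complex.sq_norm z2
        rw [Complex.normSq_apply] at this
        nlinarith [norm_nonneg z2]
      simp only [Complex.mul_re, Complex.conj_re, Complex.conj_im]
      nlinarith [sq_nonneg (1 + z1.re + z2.re), sq_nonneg (z1.im + z2.im)]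
    have := mul_nonneg hL key
    linarith

/-- `p` has a bad zero. -/
def Bad (c : ℝ) (p : ℕ) : Prop := ∃ _ : NeZero p, ∃ χ : DirichletCharacter ℂ p, χ ≠ 1 ∧
  ∃ ρ : ℂ, χ.LFunction ρ = 0 ∧ |ρ.im| ≤ (p:ℝ)^4 ∧ 1 - c / Real.log p < ρ.re

theorem bad_unique : ∃ c : ℝ, 0 < c ∧ c ≤ 1/100 ∧ ∀ (p1 p2 : ℕ) (_ : p1.Prime) (_ : p2.Prime)
    (_ : 3 ≤ p1) (_ : 3 ≤ p2)
    (_ : ⌊Real.log (Real.log p1)⌋₊ = ⌊Real.log (Real.log p2)⌋₊) (_ : Bad c p1) (_ : Bad c p2),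
    p1 = p2 := by
  obtain ⟨c, hc0, hc1, H⟩ := two_zeros
  refine ⟨c/30, by positivity, by linarith, ?_⟩
  have hlog3 : 1 < Real.log 3 := by
    rw [Real.lt_log_iff_exp_lt (by norm_num)]
    have := Real.exp_one_lt_d9; linarith
  have hlt : ∀ p1 p2 : ℕ, 3 ≤ p1 → 3 ≤ p2 → ⌊Real.log (Real.log p1)⌋₊ = ⌊Real.log (Real.log p2)⌋₊ →
      Real.log p1 ≤ 3 * Real.log p2 := by
    intro p1 p2 h1 h2 h
    have l1 : 1 < Real.log p1 := hlog3.trans_le (Real.log_le_log (by norm_num) (by exact_mod_cast h1))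
    have l2 : 1 < Real.log p2 := hlog3.trans_le (Real.log_le_log (by norm_num) (by exact_mod_cast h2))
    have k1 := Nat.lt_floor_add_one (Real.log (Real.log p1))
    have k2 := Nat.floor_le (Real.log_nonneg l2.le)
    rw [h] at k1
    have k3 : Real.log (Real.log p1) ≤ 1 + Real.log (Real.log p2) := by linarith
    have k4 := Real.exp_le_exp.mpr k3
    rw [Real.exp_add, Real.exp_log (by linarith), Real.exp_log (by linarith)] at k4
    have := Real.exp_one_lt_d9
    nlinarith
  intro p1 p2 hp1 hp2 h31 h32 hfl hb1 hb2
  by_contra hne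
  -- wlog ordering is avoided using the max
  obtain ⟨i1, χ1, hχ1, ρ1, hz1, him1, hre1⟩ := hb1
  obtain ⟨i2, χ2, hχ2, ρ2, hz2, him2, hre2⟩ := hb2
  have h12 := hlt p1 p2 h31 h32 hfl
  have h21 := hlt p2 p1 h32 h31 hfl.symm
  have c31 : (3:ℝ) ≤ p1 := by exact_mod_cast h31
  have c32 : (3:ℝ) ≤ p2 := by exact_mod_cast h32
  have l1 : 1 < Real.log p1 := hlog3.trans_le (Real.log_le_log (by norm_num) c31)
  have l2 : 1 < Real.log p2 := hlog3.trans_le (Real.log_le_log (by norm_num) c32)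
  set M := max (Real.log p1) (Real.log p2) with hM
  have e0 : ∀ p : ℕ, 3 ≤ p → ∀ t : ℝ, |t| ≤ (p:ℝ)^4 → ell p t ≤ 10 * Real.log p := by
    intro p hp t ht
    have hp' : (3:ℝ) ≤ p := by exact_mod_cast hp
    rw [ell, ← Real.log_rpow (by linarith)]
    apply Real.log_le_log (by positivity)
    have : (p:ℝ)^(10:ℝ) = (p:ℝ)^10 := by norm_cast
    rw [this]
    have h1 : |t| + 4 ≤ (p:ℝ)^9 := by
      have : (p:ℝ)^4 * 1 + 4 ≤ (p:ℝ)^4 * (p:ℝ)^5 := by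
        have h4 : (3:ℝ)^4 ≤ (p:ℝ)^4 := by gcongr
        have h5 : (3:ℝ)^5 ≤ (p:ℝ)^5 := by gcongr
        nlinarith
      have h9 : (p:ℝ)^9 = (p:ℝ)^4 * (p:ℝ)^5 := by ring
      linarith
    calc (p:ℝ) * (|t| + 4) ≤ p * (p:ℝ)^9 := by gcongr
      _ = (p:ℝ)^10 := by ring
  have e1 := e0 p1 h31 _ him1
  have e2 := e0 p2 h32 _ him2
  have m1 : Real.log p1 ≤ M := le_max_left _ _
  have m2 : Real.log p2 ≤ M := le_max_right _ _
  have eM : Real.exp M ≥ p1 ∧ Real.exp M ≥ p2 := by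
    constructor
    · calc (p1:ℝ) = Real.exp (Real.log p1) := (Real.exp_log (by linarith)).symm
        _ ≤ _ := Real.exp_le_exp.mpr m1
    · calc (p2:ℝ) = Real.exp (Real.log p2) := (Real.exp_log (by linarith)).symm
        _ ≤ _ := Real.exp_le_exp.mpr m2
  have e3 : ell (p1*p2) (ρ1.im - ρ2.im) ≤ 10 * M := by
    rw [ell, Real.log_le_iff_le_exp (by push_cast; positivity)]
    set Z := Real.exp M with hZ
    have hZ3 : 3 ≤ Z := c31.trans eM.1
    have : Real.exp (10 * M) = Z^10 := by rw [hZ, ← Real.exp_nat_mul]; norm_num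
    rw [this]
    have habs : |ρ1.im - ρ2.im| ≤ Z^4 + Z^4 := by
      refine (abs_sub _ _).trans (add_le_add (him1.trans ?_) (him2.trans ?_))
      · exact pow_le_pow_left₀ (by positivity) eM.1 4
      · exact pow_le_pow_left₀ (by positivity) eM.2 4
    push_cast
    calc (p1:ℝ) * p2 * (|ρ1.im - ρ2.im| + 4) ≤ Z * Z * (Z^4 + Z^4 + 4) := by
          gcongr
          · exact eM.1
          · exact eM.2
      _ ≤ Z * Z * Z^8 := by
          gcongr
          have h4 : (3:ℝ)^4 ≤ Z^4 := by gcongr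
          nlinarith [show Z^8 = Z^4*Z^4 by ring]
      _ = Z^10 := by ring
  refine H p1 p2 hp1 hp2 hne χ1 χ2 hχ1 hχ2 ρ1 ρ2 hz1 hz2 (10 * M) (by linarith) (by linarith) e3 ⟨?_, ?_⟩
  · refine le_trans ?_ hre1.le
    have : c / 30 / Real.log p1 ≤ c / (10 * M) := by
      rw [div_div]
      apply div_le_div_of_nonneg_left hc0.le (by linarith)
      have : M ≤ 3 * Real.log p1 := max_le (by linarith) h21
      linarith
    linarith
  · refine le_trans ?_ hre2.le
    have : c / 30 / Real.log p2 ≤ c / (10 * M) := by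
      rw [div_div]
      apply div_le_div_of_nonneg_left hc0.le (by linarith)
      have : M ≤ 3 * Real.log p2 := max_le h12 (by linarith)
      linarith
    linarith

end PAP


/-! Part 4 -/

namespace PAP
open Complex Metric

/-- There is a radius in [1/4,1/2] far from all given points on average. -/
lemma exists_radius {ι : Type*} (s : Finset ι) (hs : s.Nonempty) (a : ι → ℝ) :
    ∃ r : ℝ, 1/4 ≤ r ∧ r ≤ 1/2 ∧ (1:ℝ) ≤ 16 ^ s.card * ∏ j ∈ s, |a j - r| := by
  by_contra! hcon
  have hn : 1 ≤ s.card := hs.card_pos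
  set P : Polynomial ℝ := ∏ j ∈ s, (Polynomial.X + Polynomial.C (3 - 8 * a j)) with hP
  have hmon : P.Monic := Polynomial.monic_prod_of_monic _ _ fun j _ => Polynomial.monic_X_add_C _
  have hdeg : P.natDegree = s.card := by
    rw [hP, Polynomial.natDegree_prod_of_monic _ _ fun j _ => Polynomial.monic_X_add_C _,
      Finset.sum_congr rfl fun j _ => Polynomial.natDegree_X_add_C _]
    simp
  have hb : ∀ x ∈ Set.Icc (-1:ℝ) 1, |(Polynomial.C ((2:ℝ)^s.card) * P).eval x| ≤ 1 := by
    intro x hx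
    have h := hcon ((x+3)/8) (by linarith [hx.1]) (by linarith [hx.2])
    rw [Polynomial.eval_mul, Polynomial.eval_C, hP, Polynomial.eval_prod, abs_mul, Finset.abs_prod,
      abs_of_pos (by positivity)]
    refine le_trans (le_of_eq ?_) h.le
    have : ∀ j ∈ s, |Polynomial.eval x (Polynomial.X + Polynomial.C (3 - 8 * a j))|
        = 8 * |a j - (x+3)/8| := by
      intro j _
      simp only [Polynomial.eval_add, Polynomial.eval_X, Polynomial.eval_C]
      rw [show x + (3 - 8 * a j) = (-8) * (a j - (x+3)/8) by ring, abs_mul]; norm_num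
    rw [Finset.prod_congr rfl this, Finset.prod_mul_distrib, Finset.prod_const, ← mul_assoc,
      ← mul_pow]
    norm_num
  have hd : (Polynomial.C ((2:ℝ)^s.card) * P).degree ≤ (s.card : ℕ) := by
    refine (Polynomial.degree_mul_le _ _).trans ?_
    rw [Polynomial.degree_C (by positivity), zero_add, ← hdeg]
    exact Polynomial.degree_le_natDegree
  have h := Polynomial.Chebyshev.coeff_le_of_forall_abs_le_one hd hb
  rw [Polynomial.coeff_C_mul, ← hdeg, hmon.coeff_natDegree, hdeg, mul_one] at h
  have : (2:ℝ)^(s.card - 1) < 2 ^ s.card := by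
    apply pow_lt_pow_right₀ (by norm_num); omega
  linarith

lemma turan_alg {ι : Type*} [DecidableEq ι] (s : Finset ι) (z : ι → ℂ)
    (v : ℂ) (hz : ∀ i ∈ s, ‖z i‖ ≤ 1) (hv : ‖v‖ ≤ 3/2) (m : ℕ) (S : ℝ)
    (hne : ∀ i ∈ s, v ≠ z i)
    (hS : ∀ k, m + 1 ≤ k → k ≤ m + s.card → ‖∑ i ∈ s, z i ^ k‖ ≤ S) (hS0 : 0 ≤ S) :
    ‖∑ i ∈ s, z i ^ (m+1) * (v - z i)⁻¹‖ * ∏ j ∈ s, ‖v - z j‖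
      ≤ 2 ^ s.card * (s.card * (3/2) ^ s.card * S) := by
  set c : Finset ι → ℂ := fun T => ∏ i ∈ s \ T, (- z i) with hc
  have hA : ∀ w : ℂ, ∏ j ∈ s, (w - z j) = ∑ T ∈ s.powerset, w ^ T.card * c T := by
    intro w
    simp_rw [sub_eq_add_neg]
    rw [Finset.prod_add]
    refine Finset.sum_congr rfl fun T _ => ?_
    rw [Finset.prod_const]
  have hcn : ∀ T ∈ s.powerset, ‖c T‖ ≤ 1 := by
    intro T _
    rw [hc]; simp only [norm_prod, norm_neg]
    exact Finset.prod_le_one (fun _ _ => norm_nonneg _)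
      fun i hi => hz i (Finset.mem_sdiff.1 hi).1
  have key : (∑ i ∈ s, z i ^ (m+1) * (v - z i)⁻¹) * ∏ j ∈ s, (v - z j)
      = ∑ T ∈ s.powerset, c T * ∑ l ∈ Finset.range T.card, v ^ l *
          ∑ i ∈ s, z i ^ (m + 1 + (T.card - 1 - l)) := by
    rw [Finset.sum_mul]
    have h1 : ∀ i ∈ s, z i ^ (m+1) * (v - z i)⁻¹ * ∏ j ∈ s, (v - z j)
        = ∑ T ∈ s.powerset, c T * ∑ l ∈ Finset.range T.card, v ^ l *
          z i ^ (m + 1 + (T.card - 1 - l)) := by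
      intro i hi
      have h0 : ∏ j ∈ s, (z i - z j) = 0 := Finset.prod_eq_zero hi (sub_self _)
      have h2 : ∏ j ∈ s, (v - z j) = ∑ T ∈ s.powerset, (v^T.card - z i ^ T.card) * c T := by
        rw [← sub_zero (∏ j ∈ s, (v - z j)), ← h0, hA, hA, ← Finset.sum_sub_distrib]
        exact Finset.sum_congr rfl fun T _ => by ring
      rw [h2, Finset.mul_sum]
      refine Finset.sum_congr rfl fun T _ => ?_
      rw [← (Commute.all v (z i)).mul_geom_sum₂]
      have hne' : v - z i ≠ 0 := sub_ne_zero.2 (hne i hi)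
      have : z i ^ (m+1) * (v - z i)⁻¹ * ((v - z i) * (∑ l ∈ Finset.range T.card,
          v ^ l * z i ^ (T.card - 1 - l)) * c T)
          = c T * (z i ^ (m+1) * ∑ l ∈ Finset.range T.card, v ^ l * z i ^ (T.card - 1 - l)) := by
        field_simp
      rw [this, Finset.mul_sum]
      congr 1
      refine Finset.sum_congr rfl fun l _ => ?_
      rw [pow_add]; ring
    rw [Finset.sum_congr rfl h1, Finset.sum_comm]
    refine Finset.sum_congr rfl fun T _ => ?_
    rw [← Finset.mul_sum, Finset.sum_comm]
    congr 1
    refine Finset.sum_congr rfl fun l _ => ?_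
    rw [Finset.mul_sum]
  rw [← norm_prod, ← norm_mul, key]
  refine (norm_sum_le _ _).trans ?_
  have hT : ∀ T ∈ s.powerset, ‖c T * ∑ l ∈ Finset.range T.card, v ^ l *
      ∑ i ∈ s, z i ^ (m + 1 + (T.card - 1 - l))‖ ≤ s.card * (3/2) ^ s.card * S := by
    intro T hT
    have hTc : T.card ≤ s.card := Finset.card_le_card (Finset.mem_powerset.1 hT)
    rw [norm_mul]
    refine (mul_le_mul (hcn T hT) (norm_sum_le _ _) (norm_nonneg _) zero_le_one).trans ?_
    rw [one_mul]
    have hl : ∀ l ∈ Finset.range T.card, ‖v ^ l * ∑ i ∈ s, z i ^ (m + 1 + (T.card - 1 - l))‖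
        ≤ (3/2) ^ s.card * S := by
      intro l hl
      rw [Finset.mem_range] at hl
      rw [norm_mul, norm_pow]
      apply mul_le_mul _ (hS _ (by omega) (by omega)) (norm_nonneg _) (by positivity)
      calc ‖v‖ ^ l ≤ (3/2) ^ l := pow_le_pow_left₀ (norm_nonneg _) hv _
        _ ≤ (3/2) ^ s.card := pow_le_pow_right₀ (by norm_num) (by omega)
    refine (Finset.sum_le_card_nsmul _ _ _ hl).trans ?_
    rw [Finset.card_range, nsmul_eq_mul, mul_assoc]
    gcongr
  refine (Finset.sum_le_card_nsmul _ _ _ hT).trans (le_of_eq ?_)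
  rw [Finset.card_powerset, nsmul_eq_mul]; push_cast; ring

theorem turan {ι : Type*} [DecidableEq ι] (s : Finset ι) (z : ι → ℂ)
    (hz : ∀ i ∈ s, ‖z i‖ ≤ 1) (i0 : ι) (hi0 : i0 ∈ s) (h1 : z i0 = 1) (m : ℕ) :
    ∃ k, m + 1 ≤ k ∧ k ≤ m + s.card ∧ (1:ℝ) ≤ 2 ^ m * 96 ^ s.card * ‖∑ i ∈ s, z i ^ k‖ := by
  have hn : 1 ≤ s.card := Finset.card_pos.2 ⟨i0, hi0⟩
  obtain ⟨k, hk, hmax⟩ := Finset.exists_max_image (Finset.Icc (m+1) (m+s.card))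
    (fun k => ‖∑ i ∈ s, z i ^ k‖) ⟨m+1, Finset.mem_Icc.2 (by omega)⟩
  rw [Finset.mem_Icc] at hk
  refine ⟨k, hk.1, hk.2, ?_⟩
  set S := ‖∑ i ∈ s, z i ^ k‖ with hSdef
  have hS0 : 0 ≤ S := norm_nonneg _
  obtain ⟨r, hr1, hr2, hr⟩ := exists_radius s ⟨i0, hi0⟩ (fun j => ‖z j - 1‖)
  have hprod : ∏ j ∈ s, |‖z j - 1‖ - r| ≠ 0 := by
    intro h; rw [h, mul_zero] at hr; linarith
  have hne0 : ∀ j ∈ s, ‖z j - 1‖ ≠ r := by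
    intro j hj h
    exact hprod (Finset.prod_eq_zero hj (by rw [h]; simp))
  have hsph : ∀ v ∈ sphere (1:ℂ) r, ∀ j ∈ s, |‖z j - 1‖ - r| ≤ ‖v - z j‖ := by
    intro v hv j _
    rw [mem_sphere, Complex.dist_eq] at hv
    rw [← hv, abs_sub_comm]
    calc _ ≤ ‖(v - 1) - (z j - 1)‖ := abs_norm_sub_norm_le _ _
      _ = _ := by congr 1; ring
  have hvne : ∀ v ∈ closedBall (1:ℂ) r, v ≠ 0 := by
    rintro v hv rfl
    rw [mem_closedBall, Complex.dist_eq] at hv; norm_num at hv; linarith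
  have hinteg : ∀ j ∈ s, (2 * π * I : ℂ)⁻¹ • (∮ v in C(1, r), (v ^ (m+1))⁻¹ * (z j ^ (m+1) * (v - z j)⁻¹))
      = if ‖z j - 1‖ < r then 1 else 0 := by
    intro j hj
    split_ifs with hlt
    · have hf : ContinuousOn (fun v : ℂ => (v ^ (m+1))⁻¹ * z j ^ (m+1)) (closedBall 1 r) :=
        ContinuousOn.mul (ContinuousOn.inv₀ (by fun_prop)
          fun v hv => pow_ne_zero _ (hvne v hv)) continuousOn_const
      have := two_pi_I_inv_smul_circleIntegral_sub_inv_smul_of_differentiable_on_off_countable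
        (R := r) (c := 1) (w := z j) (f := fun v => (v ^ (m+1))⁻¹ * z j ^ (m+1))
        Set.countable_empty (by rw [mem_ball, Complex.dist_eq]; exact hlt) hf
        (fun v hv => by
          have := hvne v (ball_subset_closedBall hv.1)
          exact DifferentiableAt.mul (DifferentiableAt.inv (by fun_prop) (pow_ne_zero _ this))
            (differentiableAt_const _))
      have hzj := hvne (z j) (by rw [mem_closedBall, Complex.dist_eq]; exact hlt.le)
      rw [inv_mul_cancel₀ (pow_ne_zero _ hzj)] at this
      rw [← this]
      congr 2
      ext v
      rw [smul_eq_mul]; ring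
    · have hgt : r < ‖z j - 1‖ := lt_of_le_of_ne (not_lt.1 hlt) (hne0 j hj).symm
      have hne2 : ∀ v ∈ closedBall (1:ℂ) r, v - z j ≠ 0 := by
        intro v hv h
        rw [sub_eq_zero] at h
        rw [mem_closedBall, Complex.dist_eq, h] at hv; linarith
      have hf : ContinuousOn (fun v : ℂ => (v ^ (m+1))⁻¹ * (z j ^ (m+1) * (v - z j)⁻¹))
          (closedBall 1 r) :=
        ContinuousOn.mul (ContinuousOn.inv₀ (by fun_prop)
          fun v hv => pow_ne_zero _ (hvne v hv)) (continuousOn_const.mul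
            (ContinuousOn.inv₀ (by fun_prop) hne2))
      rw [circleIntegral_eq_zero_of_differentiable_on_off_countable (by linarith)
        Set.countable_empty hf, smul_zero]
      intro v hv
      have h1 := hvne v (ball_subset_closedBall hv.1)
      have h2 := hne2 v (ball_subset_closedBall hv.1)
      exact DifferentiableAt.mul (DifferentiableAt.inv (by fun_prop) (pow_ne_zero _ h1))
        ((differentiableAt_const _).mul (DifferentiableAt.inv (by fun_prop) h2))
  have hvsph : ∀ v ∈ sphere (1:ℂ) r, ∀ j ∈ s, v ≠ z j := by
    intro v hv j hj h
    rw [mem_sphere, Complex.dist_eq, h] at hv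
    exact hne0 j hj hv
  have hsum : (2 * π * I : ℂ)⁻¹ • (∮ v in C(1, r), (v ^ (m+1))⁻¹ * ∑ j ∈ s, z j ^ (m+1) * (v - z j)⁻¹)
      = ((s.filter (fun j => ‖z j - 1‖ < r)).card : ℂ) := by
    have : (∮ v in C(1, r), (v ^ (m+1))⁻¹ * ∑ j ∈ s, z j ^ (m+1) * (v - z j)⁻¹)
        = ∑ j ∈ s, ∮ v in C(1, r), (v ^ (m+1))⁻¹ * (z j ^ (m+1) * (v - z j)⁻¹) := by
      rw [← circleIntegral.integral_fun_sum]
      · simp_rw [Finset.mul_sum]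
      · intro j hj
        refine ContinuousOn.circleIntegrable (by linarith) ?_
        exact ContinuousOn.mul (ContinuousOn.inv₀ (by fun_prop)
          fun v hv => pow_ne_zero _ (hvne v (sphere_subset_closedBall hv))) (continuousOn_const.mul
            (ContinuousOn.inv₀ (by fun_prop) fun v hv => sub_ne_zero.2 (hvsph v hv j hj)))
    rw [this, Finset.smul_sum, Finset.sum_congr rfl hinteg, Finset.sum_boole]
  have hN : (1:ℝ) ≤ ((s.filter (fun j => ‖z j - 1‖ < r)).card : ℝ) := by
    have : 0 < (s.filter (fun j => ‖z j - 1‖ < r)).card := by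
      apply Finset.card_pos.2
      exact ⟨i0, by simp [hi0, h1]; linarith⟩
    exact_mod_cast this
  have hbd := circleIntegral.norm_two_pi_i_inv_smul_integral_le_of_norm_le_const (c := 1) (R := r)
    (f := fun v => (v ^ (m+1))⁻¹ * ∑ j ∈ s, z j ^ (m+1) * (v - z j)⁻¹)
    (C := 2 ^ (m+1) * (16^s.card * (2 ^ s.card * (s.card * (3/2) ^ s.card * S)))) (by linarith) (by
      intro v hv
      have hv' := hv
      rw [mem_sphere, Complex.dist_eq] at hv'
      have hv1 : ‖v‖ ≤ 3/2 := by
        calc ‖v‖ = ‖(v - 1) + 1‖ := by congr 1; ring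
          _ ≤ ‖v - 1‖ + ‖(1:ℂ)‖ := norm_add_le _ _
          _ ≤ 3/2 := by rw [hv']; norm_num; linarith
      have hv2 : 1/2 ≤ ‖v‖ := by
        have := norm_sub_norm_le (1:ℂ) (1 - v)
        rw [norm_sub_rev 1 v, hv'] at this
        simp at this; linarith
      have h := turan_alg s z v hz hv1 m S (hvsph v hv) (fun k h1 h2 => hmax k (Finset.mem_Icc.2 ⟨h1, h2⟩)) hS0
      rw [norm_mul, norm_inv, norm_pow]
      apply mul_le_mul _ _ (norm_nonneg _) (by positivity)
      · rw [← inv_pow]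
        apply pow_le_pow_left₀ (by positivity)
        rw [inv_le_comm₀ (by linarith) (by norm_num)]; linarith
      · have hpr : ∏ j ∈ s, |‖z j - 1‖ - r| ≤ ∏ j ∈ s, ‖v - z j‖ :=
          Finset.prod_le_prod (fun _ _ => abs_nonneg _) (hsph v hv)
        have h3 : 1 ≤ 16 ^ s.card * ∏ j ∈ s, ‖v - z j‖ := hr.trans (by gcongr)
        calc _ = ‖∑ j ∈ s, z j ^ (m+1) * (v - z j)⁻¹‖ * 1 := (mul_one _).symm
          _ ≤ ‖∑ j ∈ s, z j ^ (m+1) * (v - z j)⁻¹‖ * (16 ^ s.card * ∏ j ∈ s, ‖v - z j‖) := by gcongr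
          _ = 16 ^ s.card * (‖∑ j ∈ s, z j ^ (m+1) * (v - z j)⁻¹‖ * ∏ j ∈ s, ‖v - z j‖) := by ring
          _ ≤ _ := by gcongr)
  rw [hsum, Complex.norm_natCast] at hbd
  have hcard : (s.card:ℝ) ≤ 2 ^ s.card := by exact_mod_cast (Nat.lt_two_pow_self).le
  calc (1:ℝ) ≤ r * (2 ^ (m+1) * (16^s.card * (2 ^ s.card * (s.card * (3/2) ^ s.card * S)))) := hN.trans hbd
    _ ≤ (1/2) * (2 ^ (m+1) * (16^s.card * (2 ^ s.card * (2 ^ s.card * (3/2) ^ s.card * S)))) := by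
        gcongr
    _ = 2 ^ m * ((16 * (2 * (2 * (3/2)))) ^ s.card) * S := by
        rw [mul_pow, mul_pow, mul_pow, pow_succ]; ring
    _ = _ := by norm_num

end PAP


/-! Part 5 -/

namespace PAP
open Finset

lemma mob_sum (N : ℕ) :
    ∑ k ∈ N.divisors, (ArithmeticFunction.moebius (N / k) : ℝ) = if N = 1 then 1 else 0 := by
  rw [Nat.sum_div_divisors N (fun k => (ArithmeticFunction.moebius k : ℝ))]
  have h := congrArg (fun f => f N) (ArithmeticFunction.coe_moebius_mul_coe_zeta (R := ℝ))
  simp only [ArithmeticFunction.coe_mul_zeta_apply, ArithmeticFunction.one_apply] at h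
  simpa using h

lemma mob_sum2 (D e δ : ℕ) (he : 1 ≤ e) (hδ : 1 ≤ δ) (hδD : δ ≤ D) (hed : e ∣ δ) :
    ∑ d ∈ Icc 1 D with e ∣ d ∧ d ∣ δ, (ArithmeticFunction.moebius (δ / d) : ℝ)
      = if δ = e then 1 else 0 := by
  obtain ⟨N, rfl⟩ := hed
  have hN : 1 ≤ N := Nat.pos_of_ne_zero (by rintro rfl; simp at hδ)
  have h := mob_sum N
  have : (if e * N = e then (1:ℝ) else 0) = if N = 1 then 1 else 0 := by
    have h0 : e ≠ 0 := by omega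
    congr 1
    simp [h0]
  rw [this, ← h]
  symm
  apply Finset.sum_bij (fun k _ => e * k)
  · intro k hk
    rw [Nat.mem_divisors] at hk
    have hk0 : 1 ≤ k := Nat.pos_of_dvd_of_pos hk.1 hN
    simp only [mem_filter, mem_Icc]
    exact ⟨⟨Nat.mul_pos he hk0, (Nat.mul_le_mul_left e (Nat.le_of_dvd hN hk.1)).trans hδD⟩,
      dvd_mul_right _ _, Nat.mul_dvd_mul_left e hk.1⟩
  · intro a _ b _ hab
    exact Nat.eq_of_mul_eq_mul_left he hab
  · intro d hd
    simp only [mem_filter, mem_Icc] at hd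
    obtain ⟨k, rfl⟩ := hd.2.1
    exact ⟨k, Nat.mem_divisors.2 ⟨Nat.dvd_of_mul_dvd_mul_left he hd.2.2, by omega⟩, rfl⟩
  · intro k _
    rw [Nat.mul_div_mul_left _ _ he]

noncomputable def GG (D : ℕ) : ℝ := ∑ δ ∈ Icc 1 D, (ArithmeticFunction.moebius δ : ℝ)^2 / (δ.totient : ℝ)
noncomputable def yy (D δ : ℕ) : ℝ := (ArithmeticFunction.moebius δ : ℝ) / ((δ.totient : ℝ) * GG D)
noncomputable def lam (D d : ℕ) : ℝ :=
  d * ∑ δ ∈ Icc 1 D with d ∣ δ, (ArithmeticFunction.moebius (δ / d) : ℝ) * yy D δ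

lemma GG_pos (D : ℕ) (hD : 1 ≤ D) : 0 < GG D := by
  have : (1:ℝ) ≤ GG D := by
    have := Finset.single_le_sum (f := fun δ : ℕ => (ArithmeticFunction.moebius δ : ℝ)^2 / (δ.totient : ℝ))
      (s := Icc 1 D) (fun i _ => by positivity) (mem_Icc.2 ⟨le_rfl, hD⟩)
    simpa [GG] using this
  linarith

lemma lam_inv (D e : ℕ) (he : 1 ≤ e) (heD : e ≤ D) :
    ∑ d ∈ Icc 1 D with e ∣ d, lam D d / d = yy D e := by
  have h1 : ∀ d ∈ (Icc 1 D).filter (fun d => e ∣ d), lam D d / d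
      = ∑ δ ∈ Icc 1 D, if d ∣ δ then (ArithmeticFunction.moebius (δ / d) : ℝ) * yy D δ else 0 := by
    intro d hd
    simp only [mem_filter, mem_Icc] at hd
    have : (d:ℝ) ≠ 0 := by
      have : 1 ≤ d := hd.1.1
      positivity
    rw [lam, mul_div_cancel_left₀ _ this, Finset.sum_filter]
  rw [Finset.sum_congr rfl h1, Finset.sum_comm]
  have h2 : ∀ δ ∈ Icc 1 D, (∑ d ∈ Icc 1 D with e ∣ d,
      if d ∣ δ then (ArithmeticFunction.moebius (δ / d) : ℝ) * yy D δ else 0)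
      = if δ = e then yy D e else 0 := by
    intro δ hδ
    rw [mem_Icc] at hδ
    rw [← Finset.sum_filter, Finset.filter_filter, ← Finset.sum_mul]
    by_cases hed : e ∣ δ
    · rw [mob_sum2 D e δ he hδ.1 hδ.2 hed]
      split_ifs with h
      · rw [h, one_mul]
      · rw [zero_mul]
    · rw [Finset.filter_false_of_mem, if_neg]
      · simp
      · rintro rfl; exact hed dvd_rfl
      · rintro d _ ⟨h1, h2⟩; exact hed (h1.trans h2)
  rw [Finset.sum_congr rfl h2, Finset.sum_ite_eq' _ _ (fun _ => yy D e), if_pos (mem_Icc.2 ⟨he, heD⟩)]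

lemma lam_one (D : ℕ) (hD : 1 ≤ D) : lam D 1 = 1 := by
  have hG := GG_pos D hD
  rw [lam]
  simp only [one_dvd, Finset.filter_true, Nat.div_one, Nat.cast_one, one_mul]
  have : ∀ δ ∈ Icc 1 D, (ArithmeticFunction.moebius δ : ℝ) * yy D δ
      = (ArithmeticFunction.moebius δ : ℝ)^2 / (δ.totient : ℝ) / GG D := by
    intro δ _
    rw [yy, div_div]; ring
  rw [Finset.sum_congr rfl this, ← Finset.sum_div, ← GG, div_self hG.ne']

lemma abs_moebius_real (n : ℕ) : |(ArithmeticFunction.moebius n : ℝ)| ≤ 1 := by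
  have := ArithmeticFunction.abs_moebius_le_one (n := n)
  exact_mod_cast this

lemma abs_lam_le (D d : ℕ) (hD : 1 ≤ D) (hd : d ≤ D) : |lam D d| ≤ D := by
  have hG := GG_pos D hD
  rw [lam, abs_mul, abs_of_nonneg (Nat.cast_nonneg d)]
  have : |∑ δ ∈ Icc 1 D with d ∣ δ, (ArithmeticFunction.moebius (δ / d) : ℝ) * yy D δ| ≤ 1 := by
    refine (Finset.abs_sum_le_sum_abs _ _).trans ?_
    have h1 : ∀ δ ∈ (Icc 1 D).filter (fun δ => d ∣ δ),
        |(ArithmeticFunction.moebius (δ / d) : ℝ) * yy D δ|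
        ≤ (ArithmeticFunction.moebius δ : ℝ)^2 / (δ.totient : ℝ) / GG D := by
      intro δ _
      rw [abs_mul, yy, abs_div, abs_of_nonneg (by positivity : 0 ≤ (δ.totient : ℝ) * GG D), div_div]
      calc _ ≤ 1 * (|(ArithmeticFunction.moebius δ : ℝ)| / ((δ.totient : ℝ) * GG D)) := by
            gcongr; exact abs_moebius_real _
        _ = _ := by
            rw [one_mul]
            congr 1
            rcases ArithmeticFunction.moebius_eq_or δ with h | h | h <;> simp [h]
    refine (Finset.sum_le_sum h1).trans ?_
    refine (Finset.sum_le_sum_of_subset_of_nonneg (Finset.filter_subset _ _)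
      (fun _ _ _ => by positivity)).trans ?_
    rw [← Finset.sum_div, ← GG, div_self hG.ne']
  calc (d:ℝ) * _ ≤ D * 1 := by gcongr
    _ = D := mul_one _

lemma gcd_sum (D d1 d2 : ℕ) (h1 : 1 ≤ d1) (h1D : d1 ≤ D) :
    (Nat.gcd d1 d2 : ℝ) = ∑ e ∈ Icc 1 D with e ∣ d1 ∧ e ∣ d2, (e.totient : ℝ) := by
  have hg : 0 < Nat.gcd d1 d2 := Nat.gcd_pos_of_pos_left _ h1
  have : (Icc 1 D).filter (fun e => e ∣ d1 ∧ e ∣ d2) = (Nat.gcd d1 d2).divisors := by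
    ext e
    simp only [mem_filter, mem_Icc, Nat.mem_divisors, Nat.dvd_gcd_iff]
    constructor
    · rintro ⟨_, h⟩; exact ⟨h, hg.ne'⟩
    · rintro ⟨h, _⟩
      exact ⟨⟨Nat.pos_of_dvd_of_pos h.1 h1, (Nat.le_of_dvd h1 h.1).trans h1D⟩, h⟩
  rw [this]
  conv_lhs => rw [← Nat.sum_totient (Nat.gcd d1 d2)]
  push_cast; rfl

lemma selberg_form (D : ℕ) (hD : 1 ≤ D) :
    ∑ d1 ∈ Icc 1 D, ∑ d2 ∈ Icc 1 D, lam D d1 * lam D d2 / (Nat.lcm d1 d2 : ℝ) = 1 / GG D := by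
  have hG := GG_pos D hD
  have h1 : ∀ d1 ∈ Icc 1 D, ∀ d2 ∈ Icc 1 D, lam D d1 * lam D d2 / (Nat.lcm d1 d2 : ℝ)
      = ∑ e ∈ Icc 1 D, (e.totient : ℝ) * ((if e ∣ d1 then lam D d1 / d1 else 0) *
        (if e ∣ d2 then lam D d2 / d2 else 0)) := by
    intro d1 hd1 d2 hd2
    rw [mem_Icc] at hd1 hd2
    have e1 : (d1:ℝ) ≠ 0 := by have := hd1.1; positivity
    have e2 : (d2:ℝ) ≠ 0 := by have := hd2.1; positivity
    have hgl : (Nat.gcd d1 d2 : ℝ) * (Nat.lcm d1 d2 : ℝ) = d1 * d2 := by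
      exact_mod_cast Nat.gcd_mul_lcm d1 d2
    have e3 : (Nat.lcm d1 d2 : ℝ) ≠ 0 := by
      intro h; rw [h, mul_zero] at hgl; exact mul_ne_zero e1 e2 hgl.symm
    have : lam D d1 * lam D d2 / (Nat.lcm d1 d2 : ℝ)
        = (Nat.gcd d1 d2 : ℝ) * (lam D d1 / d1 * (lam D d2 / d2)) := by
      field_simp
      linear_combination (-(lam D d1 * lam D d2)) * hgl
    rw [this, gcd_sum D d1 d2 hd1.1 hd1.2, Finset.sum_filter, Finset.sum_mul]
    refine Finset.sum_congr rfl fun e _ => ?_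
    by_cases h1 : e ∣ d1 <;> by_cases h2 : e ∣ d2 <;> simp [h1, h2]
  have h2 : ∑ d1 ∈ Icc 1 D, ∑ d2 ∈ Icc 1 D, lam D d1 * lam D d2 / (Nat.lcm d1 d2 : ℝ)
      = ∑ e ∈ Icc 1 D, (e.totient : ℝ) * (∑ d ∈ Icc 1 D with e ∣ d, lam D d / d) ^ 2 := by
    rw [Finset.sum_congr rfl fun d1 hd1 => Finset.sum_congr rfl fun d2 hd2 => h1 d1 hd1 d2 hd2]
    rw [Finset.sum_congr rfl fun d1 _ => Finset.sum_comm]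
    rw [Finset.sum_comm]
    refine Finset.sum_congr rfl fun e _ => ?_
    rw [sq, Finset.sum_filter, Finset.sum_mul_sum, Finset.mul_sum]
    refine Finset.sum_congr rfl fun d1 _ => ?_
    rw [Finset.mul_sum]
  rw [h2]
  have h3 : ∀ e ∈ Icc 1 D, (e.totient : ℝ) * (∑ d ∈ Icc 1 D with e ∣ d, lam D d / d) ^ 2
      = (ArithmeticFunction.moebius e : ℝ)^2 / (e.totient : ℝ) / (GG D)^2 := by
    intro e he
    rw [mem_Icc] at he
    have : (e.totient : ℝ) ≠ 0 := by
      have := Nat.totient_pos.2 he.1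
      positivity
    rw [lam_inv D e he.1 he.2, yy]
    field_simp
  rw [Finset.sum_congr rfl h3, ← Finset.sum_div, ← GG]
  field_simp

lemma GG_ge (D : ℕ) (hD : 1 ≤ D) : Real.log (D + 1) / 2 ≤ GG D := by
  have h1 : ∑ δ ∈ (Icc 1 D).filter Squarefree, (1:ℝ)/δ ≤ GG D := by
    rw [GG, Finset.sum_filter]
    refine Finset.sum_le_sum fun δ hδ => ?_
    rw [mem_Icc] at hδ
    split_ifs with hs
    · rw [← Int.cast_pow, ArithmeticFunction.moebius_sq_eq_one_of_squarefree hs, Int.cast_one]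
      apply one_div_le_one_div_of_le
      · exact_mod_cast Nat.totient_pos.2 hδ.1
      · exact_mod_cast Nat.totient_le δ
    · positivity
  have h2 : ∑ n ∈ Icc 1 D, (1:ℝ)/n ≤ (∑ m ∈ Icc 1 D, (1:ℝ)/(m:ℝ)^2) *
      ∑ δ ∈ (Icc 1 D).filter Squarefree, (1:ℝ)/δ := by
    rw [Finset.sum_mul_sum, ← Finset.sum_product']
    have hex : ∀ n ∈ Icc 1 D, ∃ x : ℕ × ℕ, x ∈ (Icc 1 D) ×ˢ ((Icc 1 D).filter Squarefree) ∧
        x.1 ^ 2 * x.2 = n := by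
      intro n hn
      rw [mem_Icc] at hn
      obtain ⟨a, b, hab, hs⟩ := Nat.sq_mul_squarefree n
      have ha : 1 ≤ a := Nat.pos_of_ne_zero (by rintro rfl; simp at hab; omega)
      have hb : 1 ≤ b := Nat.pos_of_ne_zero (by rintro rfl; simp at hab; omega)
      refine ⟨(b, a), ?_, hab⟩
      simp only [mem_product, mem_filter, mem_Icc]
      have h1 : b ≤ n := by rw [← hab]; nlinarith [Nat.le_mul_of_pos_right (b^2) ha]
      have h2 : a ≤ n := by rw [← hab]; exact Nat.le_mul_of_pos_left a (by positivity)
      exact ⟨⟨hb, h1.trans hn.2⟩, ⟨ha, h2.trans hn.2⟩, hs⟩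
    choose! f hf using hex
    have : ∑ n ∈ Icc 1 D, (1:ℝ)/n = ∑ x ∈ (Icc 1 D).image f, 1 / (x.1:ℝ)^2 * (1/x.2) := by
      rw [Finset.sum_image]
      · refine Finset.sum_congr rfl fun n hn => ?_
        conv_lhs => rw [← (hf n hn).2]
        push_cast
        rw [one_div_mul_one_div]
      · intro a ha b hb hab
        rw [← (hf a ha).2, ← (hf b hb).2, hab]
    rw [this]
    apply Finset.sum_le_sum_of_subset_of_nonneg
    · intro x hx
      obtain ⟨n, hn, rfl⟩ := Finset.mem_image.1 hx
      exact (hf n hn).1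
    · intro _ _ _; positivity
  have h3 : ∑ m ∈ Icc 1 D, (1:ℝ)/(m:ℝ)^2 ≤ 2 := by
    have : Icc 1 D = Ioc 0 D := rfl
    rw [this]
    have := sum_Ioc_inv_sq_le_sub (α := ℝ) (k := 1) (n := D) one_ne_zero hD
    have h0 : Ioc 0 D = insert 1 (Ioc 1 D) := by ext; simp; omega
    rw [h0, Finset.sum_insert (by simp)]
    simp only [one_div]
    have h4 : (0:ℝ) ≤ (D:ℝ)⁻¹ := by positivity
    push_cast at this ⊢
    norm_num at this ⊢
    linarith
  have h4 : Real.log (D + 1) ≤ ∑ n ∈ Icc 1 D, (1:ℝ)/n := by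
    have := log_add_one_le_harmonic D
    rw [harmonic_eq_sum_Icc] at this
    push_cast at this
    simpa using this
  have h5 : 0 ≤ ∑ δ ∈ (Icc 1 D).filter Squarefree, (1:ℝ)/δ := Finset.sum_nonneg fun _ _ => by positivity
  nlinarith

lemma count_ap (p M a Y : ℕ) (hp : 0 < p) (hM : 0 < M) (hc : Nat.Coprime p M) :
    |(((Ioc 0 Y).filter (fun n => n % p = a % p ∧ M ∣ n)).card : ℝ) - Y / (p * M)| ≤ 1 := by
  obtain ⟨k, hk1, hk2⟩ := Nat.chineseRemainder hc a 0
  have : (Ioc 0 Y).filter (fun n => n % p = a % p ∧ M ∣ n)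
      = (Ioc 0 Y).filter (fun n => n ≡ k [MOD p * M]) := by
    ext n
    simp only [mem_filter, and_congr_right_iff]
    intro _
    rw [← Nat.modEq_and_modEq_iff_modEq_mul hc]
    constructor
    · rintro ⟨h1, h2⟩
      exact ⟨Nat.ModEq.trans h1 hk1.symm, ((Nat.modEq_zero_iff_dvd).2 h2).trans hk2.symm⟩
    · rintro ⟨h1, h2⟩
      exact ⟨h1.trans hk1, (Nat.modEq_zero_iff_dvd).1 (h2.trans hk2)⟩
  rw [this]
  have hc := Nat.Ioc_filter_modEq_card 0 Y (Nat.mul_pos hp hM) k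
  set N := ((Ioc 0 Y).filter (fun n => n ≡ k [MOD p * M])).card
  have hr : (0:ℚ) < ((p * M : ℕ) : ℚ) := by exact_mod_cast Nat.mul_pos hp hM
  have hle : ((0:ℕ) - (k:ℚ)) / ((p*M:ℕ):ℚ) ≤ ((Y:ℚ) - k) / ((p*M:ℕ):ℚ) := by
    gcongr; simp
  rw [max_eq_left (sub_nonneg.2 (Int.floor_le_floor hle))] at hc
  have hcQ : (N:ℚ) = (⌊((Y:ℚ) - k) / ((p*M:ℕ):ℚ)⌋ : ℚ) - (⌊((0:ℕ) - (k:ℚ)) / ((p*M:ℕ):ℚ)⌋ : ℚ) := by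
    exact_mod_cast hc
  have f1 := Int.floor_le (((Y:ℚ) - k) / ((p*M:ℕ):ℚ))
  have f2 := Int.lt_floor_add_one (((Y:ℚ) - k) / ((p*M:ℕ):ℚ))
  have f3 := Int.floor_le (((0:ℕ) - (k:ℚ)) / ((p*M:ℕ):ℚ))
  have f4 := Int.lt_floor_add_one (((0:ℕ) - (k:ℚ)) / ((p*M:ℕ):ℚ))
  have hq : |(N:ℚ) - Y / (p * M)| ≤ 1 := by
    have e : (Y:ℚ) / (p * M) = ((Y:ℚ) - k) / ((p*M:ℕ):ℚ) - ((0:ℕ) - (k:ℚ)) / ((p*M:ℕ):ℚ) := by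
      push_cast; ring
    rw [e, abs_le]
    constructor <;> linarith
  have hq' : ((|(N:ℚ) - Y / (p * M)| : ℚ) : ℝ) ≤ ((1:ℚ):ℝ) := by exact_mod_cast hq
  push_cast at hq'
  exact hq'

theorem brun_titchmarsh (p a Y : ℕ) (hp : p.Prime) (hY : p ^ 4 ≤ Y) :
    (((Ioc 0 Y).filter (fun q => q.Prime ∧ p < q ∧ q % p = a % p)).card : ℝ)
      ≤ 5 * Y / (p * Real.log p) := by
  set D := Nat.sqrt p with hDdef
  have hp2 := hp.two_le
  have hD : 1 ≤ D := Nat.sqrt_pos.2 (by omega)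
  have hD2 : D * D ≤ p := Nat.sqrt_le p
  have hD3 : p < (D+1)*(D+1) := Nat.lt_succ_sqrt p
  have hDp : D < p := Nat.sqrt_lt_self (by omega)
  have hG := GG_pos D hD
  have hcop : ∀ d ∈ Icc 1 D, Nat.Coprime p d := by
    intro d hd
    rw [mem_Icc] at hd
    exact (Nat.Prime.coprime_iff_not_dvd hp).2 fun h => by
      have := Nat.le_of_dvd (by omega) h; omega
  set F := (Ioc 0 Y).filter (fun n => n % p = a % p) with hF
  have s1 : (((Ioc 0 Y).filter (fun q => q.Prime ∧ p < q ∧ q % p = a % p)).card : ℝ)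
      ≤ ∑ n ∈ F, (∑ d ∈ Icc 1 D, if d ∣ n then lam D d else 0) ^ 2 := by
    rw [Finset.card_eq_sum_ones, Nat.cast_sum]
    calc _ ≤ ∑ n ∈ (Ioc 0 Y).filter (fun q => q.Prime ∧ p < q ∧ q % p = a % p),
          (∑ d ∈ Icc 1 D, if d ∣ n then lam D d else 0) ^ 2 := by
          refine Finset.sum_le_sum fun n hn => ?_
          simp only [mem_filter] at hn
          have : (∑ d ∈ Icc 1 D, if d ∣ n then lam D d else 0) = 1 := by
            rw [Finset.sum_eq_single 1]
            · simp [lam_one D hD]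
            · intro d hd hd1
              rw [mem_Icc] at hd
              rw [if_neg]
              intro h
              rcases (Nat.dvd_prime hn.2.1).1 h with h | h <;> omega
            · intro h; exact absurd (mem_Icc.2 ⟨le_rfl, hD⟩) h
          rw [this]; norm_num
      _ ≤ _ := by
          apply Finset.sum_le_sum_of_subset_of_nonneg
          · intro n hn
            simp only [mem_filter, hF] at hn ⊢
            exact ⟨hn.1, hn.2.2.2⟩
          · intro _ _ _; positivity
  have s2 : ∑ n ∈ F, (∑ d ∈ Icc 1 D, if d ∣ n then lam D d else 0) ^ 2
      = ∑ d1 ∈ Icc 1 D, ∑ d2 ∈ Icc 1 D, lam D d1 * lam D d2 *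
        (((Ioc 0 Y).filter (fun n => n % p = a % p ∧ Nat.lcm d1 d2 ∣ n)).card : ℝ) := by
    simp_rw [sq, Finset.sum_mul_sum]
    rw [Finset.sum_comm]
    refine Finset.sum_congr rfl fun d1 _ => ?_
    rw [Finset.sum_comm]
    refine Finset.sum_congr rfl fun d2 _ => ?_
    rw [← Finset.filter_filter, ← hF, Finset.card_filter, Nat.cast_sum, Finset.mul_sum]
    refine Finset.sum_congr rfl fun n _ => ?_
    by_cases h1 : d1 ∣ n <;> by_cases h2 : d2 ∣ n <;> simp [h1, h2, Nat.lcm_dvd_iff]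
  have s3 : ∀ d1 ∈ Icc 1 D, ∀ d2 ∈ Icc 1 D, lam D d1 * lam D d2 *
        (((Ioc 0 Y).filter (fun n => n % p = a % p ∧ Nat.lcm d1 d2 ∣ n)).card : ℝ)
      ≤ (Y/p) * (lam D d1 * lam D d2 / (Nat.lcm d1 d2 : ℝ)) + D * D := by
    intro d1 h1 d2 h2
    have hl : Nat.Coprime p (Nat.lcm d1 d2) :=
      Nat.Coprime.coprime_dvd_right (Nat.lcm_dvd_mul d1 d2) ((hcop d1 h1).mul_right (hcop d2 h2))
    rw [mem_Icc] at h1 h2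
    have h := count_ap p (Nat.lcm d1 d2) a Y hp.pos (Nat.lcm_pos h1.1 h2.1) hl
    set N := (((Ioc 0 Y).filter (fun n => n % p = a % p ∧ Nat.lcm d1 d2 ∣ n)).card : ℝ)
    have hab : |lam D d1 * lam D d2| ≤ D * D := by
      rw [abs_mul]
      exact mul_le_mul (abs_lam_le D d1 hD h1.2) (abs_lam_le D d2 hD h2.2) (abs_nonneg _) (by positivity)
    have e : lam D d1 * lam D d2 * N = (Y/p) * (lam D d1 * lam D d2 / (Nat.lcm d1 d2 : ℝ))
        + lam D d1 * lam D d2 * (N - Y / (p * (Nat.lcm d1 d2 : ℕ))) := by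
      rw [← div_div]; ring
    rw [e]
    have : lam D d1 * lam D d2 * (N - Y / (p * (Nat.lcm d1 d2 : ℕ))) ≤ D * D := by
      refine (le_abs_self _).trans ?_
      rw [abs_mul]
      calc _ ≤ (D * D : ℝ) * 1 := mul_le_mul hab h (abs_nonneg _) (by positivity)
        _ = _ := mul_one _
    linarith
  have s4 := Finset.sum_le_sum fun d1 h1 => Finset.sum_le_sum (s3 d1 h1)
  simp_rw [Finset.sum_add_distrib, ← Finset.mul_sum] at s4
  rw [selberg_form D hD] at s4
  simp only [Finset.sum_const, Nat.card_Icc, Nat.add_sub_cancel, nsmul_eq_mul] at s4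
  rw [← s2] at s4
  have hGG := GG_ge D hD
  have hpR : (2:ℝ) ≤ p := by exact_mod_cast hp2
  have hlogp : 0 < Real.log p := Real.log_pos (by linarith)
  have hlog : Real.log p / 4 ≤ GG D := by
    have : Real.log p ≤ 2 * Real.log (D+1) := by
      rw [← Real.log_rpow (by positivity), Real.rpow_two]
      apply Real.log_le_log (by linarith)
      have : (p:ℝ) ≤ ((D:ℝ)+1)*((D:ℝ)+1) := by exact_mod_cast hD3.le
      nlinarith
    linarith
  have hYp : (p:ℝ)^4 ≤ Y := by exact_mod_cast hY
  have hDD : (D:ℝ) * D ≤ p := by exact_mod_cast hD2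
  have t1 : (Y:ℝ)/p * (1 / GG D) ≤ 4 * Y / (p * Real.log p) := by
    rw [div_mul_div_comm, div_le_div_iff₀ (by positivity) (by positivity)]
    have : 0 ≤ (Y:ℝ) * p := by positivity
    nlinarith
  have t2 : (D:ℝ) * (D * (D * D)) ≤ Y / (p * Real.log p) := by
    rw [le_div_iff₀ (by positivity)]
    have : Real.log p ≤ p := (Real.log_le_sub_one_of_pos (by linarith)).trans (by linarith)
    calc (D:ℝ) * (D * (D * D)) * (p * Real.log p) = (D * D) * (D * D) * (p * Real.log p) := by ring
      _ ≤ p * p * (p * p) := by gcongr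
      _ = p ^ 4 := by ring
      _ ≤ Y := hYp
  have : 5 * (Y:ℝ) / (p * Real.log p) = 4 * Y / (p * Real.log p) + Y / (p * Real.log p) := by ring
  rw [this]
  linarith

end PAP


/-! Part 6 -/

namespace PAP
open Complex Finset

lemma gauss_fourier (t0 v : ℝ) :
    MeasureTheory.Integrable (fun t : ℝ => (Real.exp (-(t - t0)^2) : ℂ) * cexp (-(t * v : ℝ) * I)) ∧
    ‖∫ t : ℝ, (Real.exp (-(t - t0)^2) : ℂ) * cexp (-(t * v : ℝ) * I)‖
      ≤ 2 * Real.exp (-v^2/4) := by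
  constructor
  · have h0 : MeasureTheory.Integrable (fun t : ℝ => Real.exp (-(t - t0)^2)) := by
      have := (integrable_exp_neg_mul_sq (b := 1) one_pos).comp_sub_right t0
      simpa using this
    refine MeasureTheory.Integrable.mono' h0 (by fun_prop) ?_
    filter_upwards with t
    rw [norm_mul, show (-((t * v : ℝ):ℂ) * I) = ((-(t*v) : ℝ) : ℂ) * I by push_cast; ring,
      Complex.norm_exp_ofReal_mul_I, mul_one, Complex.norm_real, Real.norm_eq_abs,
      abs_of_pos (Real.exp_pos _)]
  · have h1 : ∫ t : ℝ, (Real.exp (-(t - t0)^2) : ℂ) * cexp (-(t * v : ℝ) * I)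
        = ∫ t : ℝ, (Real.exp (-t^2) : ℂ) * cexp (-((t + t0) * v : ℝ) * I) := by
      rw [← MeasureTheory.integral_add_right_eq_self _ t0]
      simp only [add_sub_cancel_right]
    have h2 : ∀ t : ℝ, (Real.exp (-t^2) : ℂ) * cexp (-((t + t0) * v : ℝ) * I)
        = cexp (-(t0 * v : ℝ) * I) * (cexp (I * (-v : ℂ) * t) * cexp (-1 * (t:ℂ)^2)) := by
      intro t
      rw [Complex.ofReal_exp, ← Complex.exp_add, ← Complex.exp_add, ← Complex.exp_add]
      congr 1; push_cast; ring
    rw [h1, MeasureTheory.integral_congr_ae (Filter.Eventually.of_forall h2),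
      MeasureTheory.integral_const_mul,
      fourierIntegral_gaussian (b := 1) (by norm_num) (-v : ℂ)]
    rw [norm_mul, norm_mul, show (-((t0 * v : ℝ):ℂ) * I) = ((-(t0*v) : ℝ) : ℂ) * I by push_cast; ring,
      Complex.norm_exp_ofReal_mul_I, one_mul]
    have e1 : ‖((π:ℂ) / 1) ^ (1/2 : ℂ)‖ ≤ 2 := by
      rw [div_one, Complex.norm_cpow_eq_rpow_re_of_pos Real.pi_pos]
      have : (1/2:ℂ).re = 1/2 := by norm_num
      rw [this, ← Real.sqrt_eq_rpow]
      rw [Real.sqrt_le_left (by norm_num)]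
      linarith [Real.pi_le_four]
    have e2 : ‖cexp (-(-v:ℂ)^2 / (4 * 1))‖ = Real.exp (-v^2/4) := by
      rw [show (-(-v:ℂ)^2 / (4 * 1)) = ((-v^2/4 : ℝ) : ℂ) by push_cast; ring, ← Complex.ofReal_exp,
        Complex.norm_real, Real.norm_eq_abs, abs_of_pos (Real.exp_pos _)]
    rw [e2]
    gcongr

lemma char_orth (p : ℕ) [NeZero p] (q r : ℕ) (hr : Nat.Coprime r p) :
    ∑ χ : DirichletCharacter ℂ p, χ q * (starRingEnd ℂ) (χ r)
      = if q % p = r % p then ((p.totient : ℕ) : ℂ) else 0 := by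
  have hu : IsUnit (r : ZMod p) := (ZMod.isUnit_iff_coprime r p).2 hr
  have h := DirichletCharacter.sum_char_inv_mul_char_eq ℂ hu (q : ZMod p)
  have h2 : ∀ χ : DirichletCharacter ℂ p, χ q * (starRingEnd ℂ) (χ r) = χ ((r : ZMod p)⁻¹) * χ q := by
    intro χ
    have h3 : (starRingEnd ℂ) (χ r) = χ⁻¹ (r : ZMod p) := by
      rw [starRingEnd_apply, MulChar.star_apply']
    rw [h3, MulChar.inv_apply, mul_comm]
    congr 2
    obtain ⟨u, hu'⟩ := hu
    rw [← hu', Ring.inverse_unit, ZMod.inv_coe_unit]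
  rw [Finset.sum_congr rfl fun χ _ => h2 χ, h]
  congr 1
  rw [eq_comm, ZMod.natCast_eq_natCast_iff']
  exact propext eq_comm

lemma min_le_dyadic (q r J : ℕ) (hq : 1 ≤ q) (hJ : r < J) :
    min 1 (((q:ℝ)/r)^2) ≤ ∑ j ∈ range J, 4 * (1/4:ℝ)^j * (if r ≤ 2^j * q then 1 else 0) := by
  have hex : ∃ j, r ≤ 2^j * q := ⟨r, Nat.lt_two_pow_self.le.trans (Nat.le_mul_of_pos_right _ hq)⟩
  have hfr : Nat.find hex ≤ r := Nat.find_min' hex (Nat.lt_two_pow_self.le.trans (Nat.le_mul_of_pos_right _ hq))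
  have hsp := Nat.find_spec hex
  have h1 := Finset.single_le_sum (f := fun j => 4 * (1/4:ℝ)^j * (if r ≤ 2^j * q then 1 else 0))
    (s := range J) (fun j _ => by positivity) (mem_range.2 (lt_of_le_of_lt hfr hJ))
  refine le_trans ?_ h1
  simp only [hsp, if_true, mul_one]
  rcases Nat.eq_zero_or_pos (Nat.find hex) with h | h
  · rw [h]; refine (min_le_left _ _).trans ?_; norm_num
  · refine (min_le_right _ _).trans ?_
    obtain ⟨i, hi⟩ : ∃ i, Nat.find hex = i + 1 := ⟨Nat.find hex - 1, by omega⟩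
    have hm := Nat.find_min hex (m := i) (by omega)
    push Not at hm
    have hm' : (2:ℝ)^i * q < r := by exact_mod_cast hm
    rw [hi]
    have hr0 : (0:ℝ) < r := by
      have : (0:ℝ) ≤ (2:ℝ)^i * q := by positivity
      linarith
    have : (q:ℝ)/r ≤ (1/2)^i := by
      rw [div_le_iff₀ hr0, one_div, inv_pow, inv_mul_eq_div, le_div_iff₀ (by positivity)]
      linarith
    calc ((q:ℝ)/r)^2 ≤ ((1/2)^i)^2 := by gcongr
      _ = _ := by rw [← pow_mul, mul_comm i 2, pow_mul]; norm_num; rw [pow_succ]; ring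

lemma kernel_le (q r : ℕ) (hq : 1 ≤ q) (hr : 1 ≤ r) :
    Real.exp (-(Real.log q - Real.log r)^2/4) ≤ Real.exp 4 * min 1 (((q:ℝ)/r)^2) := by
  have hq' : (0:ℝ) < q := by exact_mod_cast hq
  have hr' : (0:ℝ) < r := by exact_mod_cast hr
  rw [mul_min_of_nonneg _ _ (Real.exp_pos _).le]
  apply le_min
  · rw [mul_one, Real.exp_le_exp]; nlinarith [sq_nonneg (Real.log q - Real.log r)]
  · have : ((q:ℝ)/r)^2 = Real.exp (2 * (Real.log q - Real.log r)) := by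
      rw [two_mul, Real.exp_add, ← sq, Real.exp_sub, Real.exp_log hq', Real.exp_log hr']
    rw [this, ← Real.exp_add, Real.exp_le_exp]
    nlinarith [sq_nonneg (Real.log q - Real.log r + 4)]

lemma kernel_sum (p : ℕ) (hp : p.Prime) (S : Finset ℕ) (hS : ∀ q ∈ S, q.Prime ∧ p^4 ≤ q) (q : ℕ)
    (hq : q ∈ S) :
    ∑ r ∈ S with q % p = r % p, Real.exp (-(Real.log q - Real.log r)^2/4)
      ≤ Real.exp 4 * (40 * q / (p * Real.log p)) := by
  have hp2 := hp.two_le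
  have hlogp : 0 < Real.log p := Real.log_pos (by exact_mod_cast hp.one_lt)
  have hpR : (0:ℝ) < p := by exact_mod_cast hp.pos
  set J := S.sup id + 1
  have hJ : ∀ r ∈ S, r < J := fun r hr => Nat.lt_succ_of_le (Finset.le_sup (f := id) hr)
  have hq1 := (hS q hq).1.one_lt
  calc _ ≤ ∑ r ∈ S with q % p = r % p, Real.exp 4 *
        ∑ j ∈ range J, 4 * (1/4:ℝ)^j * (if r ≤ 2^j * q then 1 else 0) := by
        refine Finset.sum_le_sum fun r hr => ?_
        rw [mem_filter] at hr
        refine (kernel_le q r hq1.le (hS r hr.1).1.one_lt.le).trans ?_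
        gcongr
        exact min_le_dyadic q r J hq1.le (hJ r hr.1)
    _ = Real.exp 4 * ∑ j ∈ range J, 4 * (1/4:ℝ)^j *
        (((S.filter (fun r => q % p = r % p)).filter (fun r => r ≤ 2^j * q)).card : ℝ) := by
        rw [← Finset.mul_sum, Finset.sum_comm]
        congr 1
        refine Finset.sum_congr rfl fun j _ => ?_
        rw [← Finset.mul_sum, Finset.sum_boole]
    _ ≤ Real.exp 4 * ∑ j ∈ range J, 4 * (1/4:ℝ)^j * (5 * (2^j * q) / (p * Real.log p)) := by
        gcongr with j _
        have hY : p^4 ≤ 2^j * q := (hS q hq).2.trans (Nat.le_mul_of_pos_left q (by positivity))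
        have := brun_titchmarsh p q (2^j * q) hp hY
        push_cast at this
        refine le_trans ?_ this
        gcongr
        intro r hr
        simp only [mem_filter, mem_Ioc] at hr ⊢
        refine ⟨⟨(hS r hr.1.1).1.pos, hr.2⟩, (hS r hr.1.1).1, ?_, hr.1.2.symm⟩
        refine lt_of_lt_of_le ?_ (hS r hr.1.1).2
        calc p = p^1 := (pow_one p).symm
          _ < p^4 := Nat.pow_lt_pow_right hp.one_lt (by norm_num)
    _ = Real.exp 4 * ((20 * q / (p * Real.log p)) * ∑ j ∈ range J, (1/2:ℝ)^j) := by
        congr 1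
        rw [Finset.mul_sum]
        refine Finset.sum_congr rfl fun j _ => ?_
        have : (1/2:ℝ)^j = (1/4)^j * 2^j := by rw [← mul_pow]; norm_num
        rw [this]; ring
    _ ≤ Real.exp 4 * ((20 * q / (p * Real.log p)) * 2) := by
        gcongr
        exact sum_geometric_two_le J
    _ = _ := by ring

theorem mean_value (p : ℕ) [NeZero p] (hp : p.Prime) (S : Finset ℕ)
    (hS : ∀ q ∈ S, q.Prime ∧ p^4 ≤ q) (b : ℕ → ℝ) (hb : ∀ q, 0 ≤ b q) (t0 : ℝ) :
    ∑ χ : DirichletCharacter ℂ p, ∫ t in (t0 - 1/4)..(t0 + 1/4),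
      ‖∑ q ∈ S, (b q : ℂ) * χ q * cexp (-(t * Real.log q : ℝ) * I)‖^2
      ≤ 80 * Real.exp 5 / Real.log p * ∑ q ∈ S, (b q)^2 * q := by
  have hp2 := hp.two_le
  have hlogp : 0 < Real.log p := Real.log_pos (by exact_mod_cast hp.one_lt)
  have hpR : (0:ℝ) < p := by exact_mod_cast hp.pos
  have hcop : ∀ q ∈ S, Nat.Coprime q p := by
    intro q hq
    rw [Nat.coprime_primes (hS q hq).1 hp]
    rintro rfl
    have h2 := (hS q hq).2
    have : q^1 < q^4 := Nat.pow_lt_pow_right hp.one_lt (by norm_num)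
    rw [pow_one] at this
    omega
  set f : DirichletCharacter ℂ p → ℝ → ℂ := fun χ t =>
    ∑ q ∈ S, (b q : ℂ) * χ q * cexp (-(t * Real.log q : ℝ) * I) with hf
  have hfc : ∀ χ, Continuous (f χ) := fun χ => by
    rw [hf]; fun_prop
  have hexp : ∀ t : ℝ, ((∑ χ : DirichletCharacter ℂ p, ‖f χ t‖^2 : ℝ) : ℂ)
      = ∑ q ∈ S, ∑ r ∈ S, (if q % p = r % p then ((p.totient : ℕ) : ℂ) * (b q * b r) else 0) *
          cexp (-(t * (Real.log q - Real.log r) : ℝ) * I) := by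
    intro t
    push_cast
    have h1 : ∀ χ : DirichletCharacter ℂ p, ((‖f χ t‖:ℂ))^2 = ∑ q ∈ S, ∑ r ∈ S,
        (χ q * (starRingEnd ℂ) (χ r)) * ((b q * b r) * cexp (-(t * (Real.log q - Real.log r) : ℝ) * I)) := by
      intro χ
      rw [← Complex.mul_conj', hf, _root_.map_sum, Finset.sum_mul_sum]
      refine Finset.sum_congr rfl fun q _ => Finset.sum_congr rfl fun r _ => ?_
      rw [_root_.map_mul, _root_.map_mul, Complex.conj_ofReal, ← Complex.exp_conj]
      have : (-(t * (Real.log q - Real.log r) : ℝ) * I : ℂ) = (-(t * Real.log q : ℝ) * I)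
          + (starRingEnd ℂ) (-(t * Real.log r : ℝ) * I) := by
        rw [_root_.map_mul, _root_.map_neg, Complex.conj_ofReal, Complex.conj_I]; push_cast; ring
      rw [this, Complex.exp_add]; ring
    rw [Finset.sum_congr rfl fun χ _ => h1 χ, Finset.sum_comm]
    refine Finset.sum_congr rfl fun q _ => ?_
    rw [Finset.sum_comm]
    refine Finset.sum_congr rfl fun r hr => ?_
    rw [← Finset.sum_mul, char_orth p q r (hcop r hr)]
    split_ifs <;> push_cast <;> ring
  -- majorize by the Gaussian
  have hgi : ∀ q ∈ S, ∀ r ∈ S, MeasureTheory.Integrable (fun t : ℝ => (Real.exp (-(t - t0)^2) : ℂ) *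
      ((if q % p = r % p then ((p.totient : ℕ) : ℂ) * (b q * b r) else 0) *
          cexp (-(t * (Real.log q - Real.log r) : ℝ) * I))) := by
    intro q _ r _
    have := ((gauss_fourier t0 (Real.log q - Real.log r)).1).const_mul
      (if q % p = r % p then ((p.totient : ℕ) : ℂ) * (b q * b r) else 0)
    refine this.congr (Filter.Eventually.of_forall fun t => ?_)
    simp only; ring
  have hGc : ∀ t : ℝ, ((Real.exp (-(t-t0)^2) * ∑ χ : DirichletCharacter ℂ p, ‖f χ t‖^2 : ℝ) : ℂ)
      = ∑ q ∈ S, ∑ r ∈ S, (Real.exp (-(t - t0)^2) : ℂ) *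
      ((if q % p = r % p then ((p.totient : ℕ) : ℂ) * (b q * b r) else 0) *
          cexp (-(t * (Real.log q - Real.log r) : ℝ) * I)) := by
    intro t
    rw [Complex.ofReal_mul, hexp t, Finset.mul_sum]
    refine Finset.sum_congr rfl fun q _ => ?_
    rw [Finset.mul_sum]
  have hGi : MeasureTheory.Integrable (fun t : ℝ =>
      Real.exp (-(t-t0)^2) * ∑ χ : DirichletCharacter ℂ p, ‖f χ t‖^2) := by
    have : MeasureTheory.Integrable (fun t : ℝ =>
      ((Real.exp (-(t-t0)^2) * ∑ χ : DirichletCharacter ℂ p, ‖f χ t‖^2 : ℝ) : ℂ)) := by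
      simp_rw [hGc]
      exact MeasureTheory.integrable_finsetSum _ fun q hq =>
        MeasureTheory.integrable_finsetSum _ fun r hr => hgi q hq r hr
    exact this.re
  have hGb : ∫ t : ℝ, Real.exp (-(t-t0)^2) * ∑ χ : DirichletCharacter ℂ p, ‖f χ t‖^2
      ≤ ∑ q ∈ S, ∑ r ∈ S, (if q % p = r % p then (p:ℝ) * (b q * b r) else 0) *
        (2 * Real.exp (-(Real.log q - Real.log r)^2/4)) := by
    have h1 : ((∫ t : ℝ, Real.exp (-(t-t0)^2) * ∑ χ : DirichletCharacter ℂ p, ‖f χ t‖^2 : ℝ) : ℂ)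
      = ∑ q ∈ S, ∑ r ∈ S, (if q % p = r % p then ((p.totient : ℕ) : ℂ) * (b q * b r) else 0) *
          ∫ t : ℝ, (Real.exp (-(t - t0)^2) : ℂ) * cexp (-(t * (Real.log q - Real.log r) : ℝ) * I) := by
      rw [← integral_complex_ofReal]
      simp_rw [hGc]
      rw [MeasureTheory.integral_finsetSum _ fun q hq =>
        MeasureTheory.integrable_finsetSum _ fun r hr => hgi q hq r hr]
      refine Finset.sum_congr rfl fun q hq => ?_
      rw [MeasureTheory.integral_finsetSum _ fun r hr => hgi q hq r hr]
      refine Finset.sum_congr rfl fun r hr => ?_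
      rw [← MeasureTheory.integral_const_mul]
      congr 1; ext t; ring
    refine (le_abs_self _).trans ?_
    rw [← Real.norm_eq_abs, ← Complex.norm_real, h1]
    refine (norm_sum_le _ _).trans (Finset.sum_le_sum fun q _ => ?_)
    refine (norm_sum_le _ _).trans (Finset.sum_le_sum fun r _ => ?_)
    rw [norm_mul]
    apply mul_le_mul _ (gauss_fourier t0 _).2 (norm_nonneg _)
    · split_ifs
      · have := hb q; have := hb r; positivity
      · exact le_rfl
    · split_ifs
      · rw [norm_mul, Complex.norm_natCast, ← Complex.ofReal_mul, Complex.norm_real, Real.norm_eq_abs,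
          abs_of_nonneg (mul_nonneg (hb q) (hb r))]
        have := hb q; have := hb r
        gcongr
        exact Nat.totient_le p
      · simp
  have hsym : ∑ q ∈ S, ∑ r ∈ S, (if q % p = r % p then (p:ℝ) * (b q * b r) else 0) *
        (2 * Real.exp (-(Real.log q - Real.log r)^2/4))
      ≤ 2 * p * ∑ q ∈ S, (b q)^2 * ∑ r ∈ S with q % p = r % p,
        Real.exp (-(Real.log q - Real.log r)^2/4) := by
    set K : ℕ → ℕ → ℝ := fun q r => if q % p = r % p then
      Real.exp (-(Real.log q - Real.log r)^2/4) else 0 with hK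
    have hKn : ∀ q r, 0 ≤ K q r := fun q r => by
      rw [hK]; simp only; split_ifs <;> positivity
    have hKs : ∀ q r, K q r = K r q := fun q r => by
      rw [hK]; simp only
      rw [show (Real.log q - Real.log r)^2 = (Real.log r - Real.log q)^2 by ring]
      by_cases h : q % p = r % p
      · rw [if_pos h, if_pos h.symm]
      · rw [if_neg h, if_neg (Ne.symm h)]
    calc _ ≤ ∑ q ∈ S, ∑ r ∈ S, ((p:ℝ) * (b q ^2 * K q r) + p * (b r ^ 2 * K r q)) := by
          refine Finset.sum_le_sum fun q _ => Finset.sum_le_sum fun r _ => ?_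
          rw [hKs r q]
          have h1 : (if q % p = r % p then (p:ℝ) * (b q * b r) else 0) *
            (2 * Real.exp (-(Real.log q - Real.log r)^2/4)) = p * K q r * (2 * b q * b r) := by
            rw [hK]; simp only; split_ifs <;> ring
          rw [h1]
          have := mul_le_mul_of_nonneg_left (two_mul_le_add_sq (b q) (b r))
            (mul_nonneg hpR.le (hKn q r))
          linarith
      _ = 2 * ∑ q ∈ S, ∑ r ∈ S, ((p:ℝ) * (b q ^2 * K q r)) := by
          simp_rw [Finset.sum_add_distrib]
          rw [Finset.sum_comm (f := fun q r => (p:ℝ) * (b r ^ 2 * K r q))]; ring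
      _ = _ := by
          rw [mul_assoc, Finset.mul_sum S _ (p:ℝ)]
          congr 1
          refine Finset.sum_congr rfl fun q _ => ?_
          rw [Finset.sum_filter, Finset.mul_sum, Finset.mul_sum]
  have hfin : ∑ q ∈ S, (b q)^2 * ∑ r ∈ S with q % p = r % p,
        Real.exp (-(Real.log q - Real.log r)^2/4)
      ≤ ∑ q ∈ S, (b q)^2 * (Real.exp 4 * (40 * q / (p * Real.log p))) :=
    Finset.sum_le_sum fun q hq => mul_le_mul_of_nonneg_left (kernel_sum p hp S hS q hq) (sq_nonneg _)
  have hinteg : ∑ χ : DirichletCharacter ℂ p, ∫ t in (t0 - 1/4)..(t0 + 1/4), ‖f χ t‖^2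
      ≤ Real.exp 1 * ∫ t : ℝ, Real.exp (-(t-t0)^2) * ∑ χ : DirichletCharacter ℂ p, ‖f χ t‖^2 := by
    have hci : ∀ χ : DirichletCharacter ℂ p, IntervalIntegrable (fun t => ‖f χ t‖^2)
        MeasureTheory.volume (t0-1/4) (t0+1/4) := fun χ =>
      (((hfc χ).norm).pow 2).intervalIntegrable _ _
    rw [← intervalIntegral.integral_finsetSum fun χ _ => hci χ,
      intervalIntegral.integral_of_le (by linarith), ← MeasureTheory.integral_const_mul]
    have hci2 : MeasureTheory.IntegrableOn (fun t => ∑ χ : DirichletCharacter ℂ p, ‖f χ t‖^2)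
        (Set.Ioc (t0-1/4) (t0+1/4)) := by
      have : Continuous (fun t => ∑ χ : DirichletCharacter ℂ p, ‖f χ t‖^2) :=
        continuous_finsetSum _ fun χ _ => ((hfc χ).norm).pow 2
      exact (this.integrableOn_Icc).mono_set Set.Ioc_subset_Icc_self
    calc _ ≤ ∫ t in Set.Ioc (t0-1/4) (t0+1/4), Real.exp 1 * (Real.exp (-(t-t0)^2) *
          ∑ χ : DirichletCharacter ℂ p, ‖f χ t‖^2) := by
          refine MeasureTheory.setIntegral_mono_on hci2 ((hGi.const_mul _).integrableOn)
            measurableSet_Ioc fun t ht => ?_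
          rw [← mul_assoc, ← Real.exp_add]
          have h1 : 1 ≤ Real.exp (1 + -(t-t0)^2) := by
            apply Real.one_le_exp
            nlinarith [ht.1, ht.2]
          exact le_mul_of_one_le_left (Finset.sum_nonneg fun _ _ => by positivity) h1
      _ ≤ _ := by
          refine MeasureTheory.setIntegral_le_integral (hGi.const_mul _)
            (Filter.Eventually.of_forall fun t => ?_)
          simp only [Pi.zero_apply]
          positivity
  refine hinteg.trans ?_
  calc _ ≤ Real.exp 1 * (2 * p * ∑ q ∈ S, (b q)^2 * (Real.exp 4 * (40 * q / (p * Real.log p)))) := by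
        gcongr
        exact hGb.trans (hsym.trans (by gcongr))
    _ = 80 * (Real.exp 1 * Real.exp 4) / Real.log p * ∑ q ∈ S, (b q)^2 * q := by
        rw [Finset.mul_sum, Finset.mul_sum, Finset.mul_sum]
        refine Finset.sum_congr rfl fun q _ => ?_
        field_simp
        ring
    _ = _ := by rw [← Real.exp_add]; norm_num

end PAP


/-! Part 7 -/

namespace PAP
open Complex Metric ArithmeticFunction

lemma logMul_iter (f : ℕ → ℂ) (k n : ℕ) :
    (LSeries.logMul^[k] f) n = (Complex.log n)^k * f n := by
  induction k generalizing n with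
  | zero => simp
  | succ k ih =>
    rw [Function.iterate_succ', Function.comp_apply, LSeries.logMul, ih, pow_succ]
    ring

lemma FL_eq_LSeries {q : ℕ} [NeZero q] (χ : DirichletCharacter ℂ q) {s : ℂ} (hs : 1 < s.re) :
    FL χ s = - LSeries ((fun n : ℕ => χ n) * fun n : ℕ => (Λ n : ℂ)) s := by
  have h1 := DirichletCharacter.LSeries_twist_vonMangoldt_eq χ hs
  rw [h1, FL, DirichletCharacter.deriv_LFunction_eq_deriv_LSeries χ hs,
      DirichletCharacter.LFunction_eq_LSeries χ hs, neg_div, neg_neg]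

lemma absc_le {q : ℕ} [NeZero q] (χ : DirichletCharacter ℂ q) {s : ℂ} (hs : 1 < s.re) :
    LSeries.abscissaOfAbsConv ((fun n : ℕ => χ n) * fun n : ℕ => (Λ n : ℂ)) < s.re := by
  refine lt_of_le_of_lt (b := ((1:ℝ):EReal)) ?_ (by exact_mod_cast hs)
  refine LSeries.abscissaOfAbsConv_le_of_forall_lt_LSeriesSummable fun y hy => ?_
  exact DirichletCharacter.LSeriesSummable_twist_vonMangoldt χ (by simpa using hy)

lemma FL_iter {q : ℕ} [NeZero q] (χ : DirichletCharacter ℂ q) (k : ℕ) {s : ℂ} (hs : 1 < s.re) :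
    HasSum (fun n : ℕ => χ n * Λ n * ((Real.log n)^k : ℝ) / (n:ℂ)^s)
      ((-1)^(k+1) * iteratedDeriv k (FL χ) s) := by
  set f : ℕ → ℂ := (fun n : ℕ => χ n) * fun n : ℕ => (Λ n : ℂ) with hf
  have h0 : iteratedDeriv k (FL χ) s = iteratedDeriv k (-LSeries f) s := by
    have : FL χ =ᶠ[nhds s] -LSeries f := by
      have ho : IsOpen {s : ℂ | 1 < s.re} := isOpen_lt continuous_const Complex.continuous_re
      filter_upwards [ho.mem_nhds hs] with z hz
      exact FL_eq_LSeries χ hz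
    exact this.iteratedDeriv_eq k
  have h1 := LSeries_iteratedDeriv (f := f) k (absc_le χ hs)
  rw [h0, iteratedDeriv_neg, h1]
  have h2 : LSeriesSummable (LSeries.logMul^[k] f) s := by
    apply LSeriesSummable_of_abscissaOfAbsConv_lt_re
    rw [LSeries.absicssaOfAbsConv_logPowMul]
    exact absc_le χ hs
  have h3 := h2.LSeriesHasSum
  rw [LSeriesHasSum] at h3
  have h4 : (-1:ℂ)^(k+1) * -((-1)^k * LSeries (LSeries.logMul^[k] f) s) =
      LSeries (LSeries.logMul^[k] f) s := by
    have : (-1:ℂ)^k * (-1)^k = 1 := by rw [← mul_pow]; simp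
    linear_combination (LSeries (LSeries.logMul^[k] f) s) * this
  rw [h4]
  convert h3 using 1
  funext n
  rcases eq_or_ne n 0 with rfl | hn
  · simp
  · rw [LSeries.term_of_ne_zero hn, logMul_iter, hf]
    simp only [Pi.mul_apply]
    push_cast
    ring_nf

lemma iter_inv_sub (k : ℕ) (ρ s : ℂ) :
    iteratedDeriv k (fun z => 1/(z-ρ)) s = (-1)^k * k.factorial * ((s-ρ)⁻¹)^(k+1) := by
  have h := congrFun (iter_deriv_inv_linear_sub k (1:ℂ) ρ) s
  rw [iteratedDeriv_eq_iterate]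
  simp only [one_mul, one_pow, mul_one] at h
  simp only [one_div]
  rw [h]
  have e : (s-ρ) ^ (-1 - (k:ℤ)) = ((s-ρ)⁻¹)^(k+1) := by
    rw [show (-1 - (k:ℤ)) = -((k+1 : ℕ):ℤ) by push_cast; ring, zpow_neg, zpow_natCast, inv_pow]
  rw [e]

/-- normalised derivative of the logarithmic derivative, as Dirichlet series. -/
noncomputable def DD {q : ℕ} [NeZero q] (χ : DirichletCharacter ℂ q) (k : ℕ) (s : ℂ) : ℂ :=
  ∑' n : ℕ, χ n * Λ n * ((Real.log n)^k / (k.factorial) : ℝ) / (n:ℂ)^s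

lemma DD_hasSum {q : ℕ} [NeZero q] (χ : DirichletCharacter ℂ q) (k : ℕ) {s : ℂ} (hs : 1 < s.re) :
    HasSum (fun n : ℕ => χ n * Λ n * ((Real.log n)^k / (k.factorial) : ℝ) / (n:ℂ)^s) (DD χ k s) := by
  refine Summable.hasSum ?_
  refine ((FL_iter χ k hs).summable.mul_right ((k.factorial:ℂ)⁻¹)).congr fun n => ?_
  push_cast
  ring

lemma DD_eq {q : ℕ} [NeZero q] (χ : DirichletCharacter ℂ q) (k : ℕ) {s : ℂ} (hs : 1 < s.re) :
    DD χ k s = (-1)^(k+1) * iteratedDeriv k (FL χ) s / k.factorial := by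
  have h1 := (FL_iter χ k hs).mul_right ((k.factorial:ℂ)⁻¹)
  rw [div_eq_mul_inv]
  refine (DD_hasSum χ k hs).unique ?_
  have e : (fun n : ℕ => χ n * Λ n * ((Real.log n)^k / (k.factorial) : ℝ) / (n:ℂ)^s) =
      fun n : ℕ => χ n * Λ n * ((Real.log n)^k : ℝ) / (n:ℂ)^s * ((k.factorial:ℂ)⁻¹) := by
    funext n
    push_cast
    ring
  rw [e]
  exact h1


lemma lemmaA {q : ℕ} [NeZero q] {χ : DirichletCharacter ℂ q} (hχ : χ ≠ 1) {t0 : ℝ}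
    (P : PFData χ t0) (k : ℕ) {η t : ℝ} (h0 : 0 < η) (h1 : η ≤ 1) (ht : |t-t0| ≤ 1/4) :
    ‖DD χ k (1+η+t*I) + ∑ i, ((1+η+t*I - P.ρ i)⁻¹)^(k+1)‖ ≤ 2200 * ell q t0 * 8^k := by
  set s : ℂ := 1+η+t*I with hs
  have hre : s.re = 1 + η := by simp [hs]
  have hdist : ∀ z ∈ closedBall s (1/8), z ∈ ball (2+t0*I) (6/5) := by
    intro z hz
    rw [mem_closedBall] at hz
    rw [mem_ball]
    have hd : dist s (2+t0*I) ≤ 1.04 := by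
      rw [Complex.dist_eq]
      have : s - (2+t0*I) = ((η-1:ℝ):ℂ) + ((t-t0:ℝ):ℂ)*I := by
        rw [hs]; push_cast; ring
      rw [this, Complex.norm_add_mul_I]
      rw [Real.sqrt_le_left (by norm_num)]
      have h3 := sq_le_sq' (by linarith [abs_nonneg (t-t0)]) ht
      rw [sq_abs] at h3
      nlinarith
    calc dist z (2+t0*I) ≤ dist z s + dist s (2+t0*I) := dist_triangle _ _ _
      _ ≤ 1/8 + 1.04 := by gcongr
      _ < 6/5 := by norm_num
  have hsb : s ∈ ball (2+t0*I) (6/5:ℝ) := hdist s (mem_closedBall_self (by norm_num))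
  have hg : ‖iteratedDeriv k P.g s‖ ≤ k.factorial * (2200 * ell q t0) / (1/8)^k := by
    refine Complex.norm_iteratedDeriv_le_of_forall_mem_sphere_norm_le k (by norm_num) ?_ ?_
    · refine DifferentiableOn.diffContOnCl ?_
      rw [closure_ball _ (by norm_num)]
      exact P.g_diff.mono fun z hz => hdist z hz
    · intro z hz
      exact P.g_le z (hdist z (sphere_subset_closedBall hz))
  have hloc : FL χ =ᶠ[nhds s] fun z => ∑ i, 1/(z - P.ρ i) + P.g z := by
    have ho : IsOpen {s : ℂ | 1 < s.re} := isOpen_lt continuous_const Complex.continuous_re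
    filter_upwards [ho.mem_nhds (show 1 < s.re by linarith), isOpen_ball.mem_nhds hsb] with z hz hz2
    exact P.FL_eq hχ hz2 (le_of_lt hz)
  have hne : ∀ i, s - P.ρ i ≠ 0 := by
    intro i h
    have := P.re_lt hχ i
    have h2 : s = P.ρ i := sub_eq_zero.1 h
    rw [← h2, hre] at this
    linarith
  have hcd : ∀ i, ContDiffAt ℂ k (fun z => 1/(z-P.ρ i)) s := by
    intro i
    exact contDiffAt_const.div (contDiffAt_id.sub contDiffAt_const) (hne i)
  have hcg : ContDiffAt ℂ k P.g s :=
    ((P.g_diff.analyticAt (isOpen_ball.mem_nhds hsb)).contDiffAt)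
  have hit : iteratedDeriv k (FL χ) s =
      ∑ i, (-1)^k * k.factorial * ((s - P.ρ i)⁻¹)^(k+1) + iteratedDeriv k P.g s := by
    rw [hloc.iteratedDeriv_eq k]
    have := iteratedDeriv_add (x := s) (n := k) (f := fun z => ∑ i, 1/(z - P.ρ i)) (g := P.g)
      (ContDiffAt.sum fun i _ => hcd i) hcg
    rw [show (fun z => ∑ i, 1/(z - P.ρ i) + P.g z) = (fun z => ∑ i, 1/(z - P.ρ i)) + P.g from rfl,
      this]
    congr 1
    rw [iteratedDeriv_fun_sum fun i _ => hcd i]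
    exact Finset.sum_congr rfl fun i _ => iter_inv_sub k _ _
  rw [DD_eq χ k (by linarith), hit]
  have hk : (k.factorial:ℂ) ≠ 0 := by exact_mod_cast k.factorial_ne_zero
  have e1 : (-1:ℂ)^(k+1) * (∑ i, (-1)^k * k.factorial * ((s - P.ρ i)⁻¹)^(k+1) + iteratedDeriv k P.g s)
      / k.factorial + ∑ i, ((s - P.ρ i)⁻¹)^(k+1) = (-1)^(k+1) * iteratedDeriv k P.g s / k.factorial := by
    rw [← Finset.mul_sum]
    have : (-1:ℂ)^k * (-1)^k = 1 := by rw [← mul_pow]; simp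
    generalize ∑ i, ((s - P.ρ i)⁻¹)^(k+1) = Z
    field_simp
    linear_combination (-(k.factorial * Z)) * this
  rw [e1, norm_div, norm_mul, norm_pow, norm_neg, norm_one, one_pow, one_mul, Complex.norm_natCast,
    div_le_iff₀ (by positivity)]
  refine hg.trans (le_of_eq ?_)
  rw [div_pow, one_pow, div_div_eq_mul_div]
  ring

end PAP


/-! Part 8 -/

namespace PAP
open Complex Metric ArithmeticFunction

lemma PFData.sumsq {q : ℕ} [NeZero q] {χ : DirichletCharacter ℂ q} (hχ : χ ≠ 1) {t0 : ℝ}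
    (P : PFData χ t0) {C0 : ℝ} (hC1 : 1 ≤ C0) (hC0 : ∀ η : ℝ, 0 < η → η ≤ 1 →
    ∑' n : ℕ, Λ n / (n:ℝ)^(1+η) ≤ 1/η + C0) {η t l lam : ℝ} (h0 : 0 < η) (h1 : η ≤ 1)
    (ht : |t-t0| ≤ 1/4) (hl : ell q t0 ≤ 5 * l) (hlam : η * l = lam) (h1l : 1 ≤ lam) :
    ∑ i, (‖(1+η+t*I) - P.ρ i‖^2)⁻¹ ≤ (11001 + C0) * lam / η^2 := by
  have h := P.sum_inv_sq_le hχ hC0 h0 h1 ht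
  have e : ∑ i, η/‖(1+η+t*I) - P.ρ i‖^2 = η * ∑ i, (‖(1+η+t*I) - P.ρ i‖^2)⁻¹ := by
    rw [Finset.mul_sum]; rfl
  rw [e] at h
  rw [le_div_iff₀ (by positivity)]
  calc _ = η * (η * ∑ i, (‖(1+η+t*I) - P.ρ i‖^2)⁻¹) := by ring
    _ ≤ η * (1/η + C0 + 2200 * ell q t0) := by gcongr
    _ ≤ η * (1/η + C0 + 2200 * (5*l)) := by gcongr
    _ = 1 + η * C0 + 11000 * lam := by rw [← hlam]; field_simp; ring
    _ ≤ _ := by nlinarith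

lemma PFData.near_count {q : ℕ} [NeZero q] {χ : DirichletCharacter ℂ q} (hχ : χ ≠ 1) {t0 : ℝ}
    (P : PFData χ t0) {C0 : ℝ} (hC1 : 1 ≤ C0) (hC0 : ∀ η : ℝ, 0 < η → η ≤ 1 →
    ∑' n : ℕ, Λ n / (n:ℝ)^(1+η) ≤ 1/η + C0) {η t l lam : ℝ} (h0 : 0 < η) (h1 : η ≤ 1)
    (ht : |t-t0| ≤ 1/4) (hl : ell q t0 ≤ 5 * l) (hlam : η * l = lam) (h1l : 1 ≤ lam) :
    ((Finset.univ.filter (fun i => ‖(1+η+t*I) - P.ρ i‖ ≤ 2304 * η)).card : ℝ)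
      ≤ 2304^2 * (11001 + C0) * lam := by
  have h := P.sumsq hχ hC1 hC0 h0 h1 ht hl hlam h1l
  set F := Finset.univ.filter (fun i => ‖(1+η+t*I) - P.ρ i‖ ≤ 2304 * η) with hF
  have h2 : (F.card:ℝ) * ((2304*η)^2)⁻¹ ≤ ∑ i, (‖(1+η+t*I) - P.ρ i‖^2)⁻¹ := by
    rw [← nsmul_eq_mul]
    refine (Finset.card_nsmul_le_sum F _ _ fun i hi => ?_).trans
      (Finset.sum_le_univ_sum_of_nonneg fun i => by positivity)
    have hi' := (Finset.mem_filter.1 hi).2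
    have hpos : 0 < ‖(1+η+t*I) - P.ρ i‖ := by
      rw [norm_pos_iff, sub_ne_zero]
      intro hh
      have := P.re_lt hχ i
      rw [← hh] at this
      simp at this
      linarith
    gcongr
  have h3 := h2.trans h
  rw [← div_eq_mul_inv, div_le_iff₀ (by positivity)] at h3
  refine h3.trans (le_of_eq ?_)
  field_simp

lemma far_arith (m k : ℕ) (h : m + 1 ≤ k) : (m:ℝ) * 8 ≤ 4^k := by
  have h1 : (m:ℝ) < 2^m := by exact_mod_cast Nat.lt_two_pow_self
  have hk : (4:ℝ)^(m+1) ≤ 4^k := pow_le_pow_right₀ (by norm_num) h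
  rcases Nat.eq_zero_or_pos m with rfl | hm
  · simp
  have h2 : (2:ℝ) ≤ 2^m := by
    calc (2:ℝ) = 2^1 := by norm_num
      _ ≤ 2^m := pow_le_pow_right₀ (by norm_num) hm
  have h4 : (4:ℝ)^(m+1) = 4 * (2^m * 2^m) := by
    rw [pow_succ, ← mul_pow]; norm_num; ring
  nlinarith

lemma PFData.zero_lower {q : ℕ} [NeZero q] {χ : DirichletCharacter ℂ q} (hχ : χ ≠ 1) {t0 : ℝ}
    (P : PFData χ t0) {C0 : ℝ} (hC1 : 1 ≤ C0) (hC0 : ∀ η : ℝ, 0 < η → η ≤ 1 →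
    ∑' n : ℕ, Λ n / (n:ℝ)^(1+η) ≤ 1/η + C0) {η t l lam C2 : ℝ} (h0 : 0 < η) (h1 : η ≤ 1/20000)
    (ht : |t-t0| ≤ 1/4) (hl : ell q t0 ≤ 5 * l) (hlam : η * l = lam) (h1l : 1 ≤ lam)
    (hC2 : 2304^2 * (11001 + C0) ≤ C2) (m : ℕ) (hm : C2 * lam ≤ m) (i1 : Fin P.n)
    (hre : 1 - η ≤ (P.ρ i1).re) (him : |(P.ρ i1).im - t| ≤ η) :
    ∃ k : ℕ, m ≤ k ∧ k < 2 * m ∧ 3/4 ≤ (576*η)^(k+1) * ‖DD χ k (1+η+t*I)‖ := by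
  set s : ℂ := 1+η+t*I with hs
  have hC2' : 0 < C2 := by nlinarith
  have hpos : ∀ i, 0 < ‖s - P.ρ i‖ := by
    intro i
    rw [norm_pos_iff, sub_ne_zero]
    intro hh
    have := P.re_lt hχ i
    rw [← hh] at this
    simp [hs] at this
    linarith
  -- nearest zero
  obtain ⟨i0, -, hi0⟩ := Finset.exists_min_image Finset.univ (fun i => ‖s - P.ρ i‖)
    ⟨i1, Finset.mem_univ _⟩
  have h3 : ‖s - P.ρ i1‖ ≤ 3 * η := by
    refine (Complex.norm_le_abs_re_add_abs_im _).trans ?_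
    have a1 : |(s - P.ρ i1).re| ≤ 2 * η := by
      have hlt := P.re_lt hχ i1
      simp only [hs, sub_re, add_re, one_re, ofReal_re, mul_re, I_re, mul_zero, ofReal_im, I_im,
        zero_mul, sub_self, add_zero]
      rw [abs_le]; constructor <;> linarith
    have a2 : |(s - P.ρ i1).im| ≤ η := by
      simp only [hs, sub_im, add_im, one_im, ofReal_im, mul_im, I_re, mul_zero, ofReal_re, I_im,
        mul_one, zero_add]
      rw [abs_sub_comm]; simpa using him
    linarith
  have h30 : ‖s - P.ρ i0‖ ≤ 3 * η := (hi0 i1 (Finset.mem_univ _)).trans h3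
  set F := Finset.univ.filter (fun i => ‖s - P.ρ i‖ ≤ 2304 * η) with hF
  have hn : (F.card:ℝ) ≤ 2304^2 * (11001 + C0) * lam :=
    P.near_count hχ hC1 hC0 h0 (by linarith) ht hl hlam h1l
  have hnm : F.card ≤ m := by
    have : (F.card:ℝ) ≤ m := hn.trans ((mul_le_mul_of_nonneg_right hC2 (by linarith)).trans hm)
    exact_mod_cast this
  have hi0F : i0 ∈ F := Finset.mem_filter.2 ⟨Finset.mem_univ _, by linarith⟩
  obtain ⟨k', hk1, hk2, hk3⟩ := turan F (fun i => (s - P.ρ i0)/(s - P.ρ i)) (by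
    intro i hi
    rw [norm_div, div_le_one (hpos i)]
    exact hi0 i (Finset.mem_univ _)) i0 hi0F (by
    rw [div_self]; exact norm_pos_iff.1 (hpos i0)) m
  obtain ⟨k, rfl⟩ : ∃ k, k' = k + 1 := ⟨k'-1, by omega⟩
  refine ⟨k, by omega, by omega, ?_⟩
  set N : ℂ := ∑ i ∈ F, ((s - P.ρ i)⁻¹)^(k+1) with hN
  have hmain : 1 ≤ (576*η)^(k+1) * ‖N‖ := by
    have e : ∑ i ∈ F, ((s - P.ρ i0)/(s - P.ρ i))^(k+1) = (s - P.ρ i0)^(k+1) * N := by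
      rw [hN, Finset.mul_sum]
      refine Finset.sum_congr rfl fun i _ => ?_
      rw [div_eq_mul_inv, mul_pow]
    rw [e, norm_mul, norm_pow] at hk3
    calc (1:ℝ) ≤ 2^m * 96^F.card * (‖s - P.ρ i0‖^(k+1) * ‖N‖) := hk3
      _ ≤ 2^(k+1) * 96^(k+1) * ((3*η)^(k+1) * ‖N‖) := by
        gcongr
        · norm_num
        · omega
        · norm_num
        · omega
      _ = (576*η)^(k+1) * ‖N‖ := by
        rw [← mul_pow, ← mul_assoc, ← mul_pow]; ring_nf
  -- far zeros
  have hfar : (576*η)^(k+1) * ‖∑ i, ((s - P.ρ i)⁻¹)^(k+1) - N‖ ≤ 1/8 := by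
    have e : ∑ i, ((s - P.ρ i)⁻¹)^(k+1) - N = ∑ i ∈ Finset.univ.filter
        (fun i => ¬ ‖s - P.ρ i‖ ≤ 2304 * η), ((s - P.ρ i)⁻¹)^(k+1) := by
      rw [hN, hF, ← Finset.sum_filter_add_sum_filter_not Finset.univ
        (fun i => ‖s - P.ρ i‖ ≤ 2304 * η)]
      ring
    have b : ‖∑ i, ((s - P.ρ i)⁻¹)^(k+1) - N‖ ≤
        ((2304*η)⁻¹)^(k-1) * ((11001 + C0) * lam / η^2) := by
      rw [e]
      refine (norm_sum_le _ _).trans ?_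
      refine le_trans ?_ (mul_le_mul_of_nonneg_left
        (P.sumsq hχ hC1 hC0 h0 (by linarith) ht hl hlam h1l) (by positivity))
      rw [Finset.mul_sum]
      refine le_trans (Finset.sum_le_sum fun i hi => ?_)
        (Finset.sum_le_univ_sum_of_nonneg fun i => by positivity)
      have hi' := (Finset.mem_filter.1 hi).2
      push Not at hi'
      have hk : k + 1 = (k-1) + 2 := by
        have : 0 < F.card := Finset.card_pos.2 ⟨i0, hi0F⟩
        omega
      rw [norm_pow, norm_inv, hk, pow_add, ← hs, inv_pow _ 2]
      have := hpos i
      gcongr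
    have hk0 : 1 ≤ k := by
      have : 0 < F.card := Finset.card_pos.2 ⟨i0, hi0F⟩
      omega
    have e2 : ((2304*η)⁻¹)^(k-1) * ((11001 + C0) * lam / η^2) =
        ((2304*η)⁻¹)^(k+1) * (2304^2 * (11001 + C0) * lam) := by
      rw [show k + 1 = (k-1) + 2 by omega, pow_add]
      field_simp
    rw [e2] at b
    have hX : 2304^2 * (11001 + C0) * lam ≤ m := 
      (mul_le_mul_of_nonneg_right hC2 (by linarith)).trans hm
    calc (576*η)^(k+1) * ‖∑ i, ((s - P.ρ i)⁻¹)^(k+1) - N‖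
        ≤ (576*η)^(k+1) * (((2304*η)⁻¹)^(k+1) * m) := by
          gcongr
          exact b.trans (by gcongr)
      _ = m / 4^(k+1) := by
          rw [← mul_assoc, ← mul_pow]
          rw [show 576*η*(2304*η)⁻¹ = 4⁻¹ by field_simp; norm_num, inv_pow]
          ring
      _ ≤ 1/8 := by
          rw [div_le_iff₀ (by positivity)]
          have := far_arith m (k+1) hk1
          linarith
  have hA := lemmaA hχ P k h0 (by linarith) ht
  rw [← hs] at hA
  have hg : (576*η)^(k+1) * (2200 * ell q t0 * 8^k) ≤ 1/8 := by
    have hl0 : 0 < l := by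
      by_contra hh
      push Not at hh
      nlinarith
    have hk4 : 88000 * 576 * lam ≤ 4^k := by
      have h5 : (m:ℝ) ≤ k := by exact_mod_cast (by omega : m ≤ k)
      have h6 : (k:ℝ) < 4^k := by exact_mod_cast Nat.lt_pow_self (by norm_num)
      have : 88000 * 576 * lam ≤ C2 * lam := by gcongr; nlinarith
      linarith
    have h7 : ((4608*η)^k : ℝ) ≤ (1/4)^k := by gcongr; linarith
    calc (576*η)^(k+1) * (2200 * ell q t0 * 8^k) ≤ (576*η)^(k+1) * (2200 * (5*l) * 8^k) := by gcongr
      _ = 11000 * 576 * lam * (4608*η)^k := by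
        rw [pow_succ, show 4608 * η = 576*η*8 by ring, mul_pow (576*η) 8, ← hlam]; ring
      _ ≤ 11000 * 576 * lam * (1/4)^k := by gcongr
      _ = (88000 * 576 * lam) / 4^k / 8 := by rw [div_pow, one_pow]; ring
      _ ≤ 1 / 8 := by
        gcongr
        rw [div_le_one (by positivity)]
        exact hk4
  have hfin : ‖N‖ ≤ ‖DD χ k s‖ + 2200 * ell q t0 * 8^k + ‖∑ i, ((s - P.ρ i)⁻¹)^(k+1) - N‖ := by
    have : N = -(DD χ k s) + (DD χ k s + ∑ i, ((s - P.ρ i)⁻¹)^(k+1)) -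
      (∑ i, ((s - P.ρ i)⁻¹)^(k+1) - N) := by ring
    rw [this]
    refine (norm_sub_le _ _).trans ?_
    rw [← this]
    gcongr
    refine (norm_add_le _ _).trans ?_
    rw [norm_neg]
    gcongr
  have hw : 0 ≤ (576*η)^(k+1) := by positivity
  have := mul_le_mul_of_nonneg_left hfin hw
  linarith [mul_add ((576*η)^(k+1)) (‖DD χ k s‖ + 2200 * ell q t0 * 8^k)
    (‖∑ i, ((s - P.ρ i)⁻¹)^(k+1) - N‖), mul_add ((576*η)^(k+1)) (‖DD χ k s‖) (2200 * ell q t0 * 8^k)]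

end PAP


/-! Part 9 -/

namespace PAP
open Complex Metric ArithmeticFunction

lemma np_summable : Summable (fun n : ℕ => if n.Prime then 0 else Λ n / (n:ℝ)^(3/4:ℝ)) := by
  obtain ⟨C, hC⟩ := Chebyshev.psi_sub_theta_le_mul_sqrt
  set f : ℕ → ℝ := fun n => if n.Prime then 0 else Λ n with hf
  have h0 : ∀ n, 0 ≤ f n := fun n => by
    simp only [hf]; split_ifs
    · exact le_rfl
    · exact vonMangoldt_nonneg
  have h := LSeriesSummable_of_sum_norm_bigO_and_nonneg (f := f) (r := 1/2) (s := ((3/4:ℝ):ℂ)) (by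
    refine Asymptotics.IsBigO.of_bound C (Eventually.of_forall fun n => ?_)
    have h1 := Chebyshev.psi_sub_theta_eq_sum_not_prime (n:ℝ)
    have h2 : ∑ k ∈ Finset.Icc 1 n, f k = Chebyshev.psi n - Chebyshev.theta n := by
      rw [h1, Nat.floor_natCast, Finset.sum_filter]
      refine Finset.sum_congr ?_ fun k _ => ?_
      · ext k; rw [Finset.mem_Icc, Finset.mem_Ioc]; omega
      · simp only [hf]; split_ifs <;> simp_all
    rw [Real.norm_of_nonneg (Finset.sum_nonneg fun k _ => h0 k), h2,
      Real.norm_of_nonneg (by positivity), ← Real.sqrt_eq_rpow]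
    exact hC n) h0 (by norm_num) (by simp; norm_num)
  refine h.norm.congr fun n => ?_
  rw [LSeries.norm_term_eq]
  rcases eq_or_ne n 0 with rfl | hn
  · simp
  rw [if_neg hn]
  simp only [hf, ofReal_re]
  split_ifs
  · simp
  · simp [abs_of_nonneg (vonMangoldt_nonneg)]

lemma logpow_le (k n : ℕ) (hn : 1 ≤ n) {c : ℝ} (hc : 0 < c) :
    (Real.log n)^k / k.factorial ≤ (1/c)^k * (n:ℝ)^c := by
  have hl : 0 ≤ Real.log n := Real.log_natCast_nonneg n
  have h := Real.pow_div_factorial_le_exp (c * Real.log n) (by positivity) k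
  rw [show Real.exp (c * Real.log n) = (n:ℝ)^c by
    rw [Real.rpow_def_of_pos (by positivity)]; ring_nf] at h
  calc (Real.log n)^k / k.factorial = (1/c)^k * ((c * Real.log n)^k / k.factorial) := by
        rw [mul_pow, ← mul_div_assoc, ← mul_assoc, ← mul_pow, one_div_mul_cancel hc.ne', one_pow, one_mul]
    _ ≤ _ := by gcongr

lemma fact_lower (k : ℕ) : ((k:ℝ)/3)^k ≤ k.factorial := by
  have h := Real.pow_div_factorial_le_exp (k:ℝ) (by positivity) k
  have h2 : Real.exp k ≤ 3^k := by
    rw [← Real.exp_one_pow]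
    gcongr
    have := Real.exp_one_lt_d9
    linarith
  rw [div_le_iff₀ (by positivity)] at h
  rw [div_pow, div_le_iff₀ (by positivity)]
  nlinarith [(by positivity : (0:ℝ) < k.factorial)]

/-- the weights used in the zero detecting polynomial -/
noncomputable def bw (η : ℝ) (k n : ℕ) : ℝ :=
  Real.log n * ((Real.log n)^k / k.factorial) / (n:ℝ)^(1+η)

noncomputable def SS (p N : ℕ) : Finset ℕ := (Finset.range N).filter (fun q => q.Prime ∧ p^4 ≤ q)

lemma term_eq {p : ℕ} (χ : DirichletCharacter ℂ p) (η t : ℝ) (k n : ℕ)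
    (hn : n.Prime) : χ n * Λ n * ((Real.log n)^k / (k.factorial) : ℝ) / (n:ℂ)^(1+η+t*I : ℂ) =
      (bw η k n : ℂ) * χ n * cexp (-(t * Real.log n : ℝ) * I) := by
  have hn0 : (n:ℂ) ≠ 0 := by exact_mod_cast hn.ne_zero
  rw [vonMangoldt_apply_prime hn, bw, Complex.cpow_add _ _ hn0]
  have e1 : (n:ℂ)^(1+η:ℂ) = (((n:ℝ)^(1+η) : ℝ):ℂ) := by
    rw [Complex.ofReal_cpow (by positivity)]; push_cast; rfl
  have e2 : ((n:ℂ)^(t*I:ℂ))⁻¹ = cexp (-(t * Real.log n : ℝ) * I) := by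
    rw [Complex.cpow_def_of_ne_zero hn0, ← Complex.exp_neg, ← Complex.natCast_log]
    congr 1; push_cast; ring
  rw [e1, div_eq_mul_inv, mul_inv, e2]
  push_cast
  ring

lemma term_norm {p : ℕ} (χ : DirichletCharacter ℂ p) (η t : ℝ) (k n : ℕ) :
    ‖χ n * Λ n * ((Real.log n)^k / (k.factorial) : ℝ) / (n:ℂ)^(1+η+t*I : ℂ)‖ ≤
      (Real.log n)^k / k.factorial * (Λ n / (n:ℝ)^(1+η)) := by
  rcases Nat.eq_zero_or_pos n with rfl | hn
  · simp
  have hl : 0 ≤ Real.log n := Real.log_natCast_nonneg n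
  rw [norm_div, norm_mul, norm_mul, Complex.norm_natCast_cpow_of_pos hn, Complex.norm_real,
    Complex.norm_real, Real.norm_of_nonneg vonMangoldt_nonneg, Real.norm_of_nonneg (by positivity)]
  have e : (1+η+t*I : ℂ).re = 1+η := by simp
  rw [e]
  have h1 := DirichletCharacter.norm_le_one χ (n : ZMod p)
  have h2 : 0 ≤ Λ n := vonMangoldt_nonneg
  calc _ ≤ 1 * Λ n * ((Real.log n)^k / k.factorial) / (n:ℝ)^(1+η) := by gcongr
    _ = _ := by ring

lemma tail_small {σ : ℝ} (hσ : 1 < σ) {ε : ℝ} (hε : 0 < ε) : ∃ N : ℕ, ∃ T : ℝ, T ≤ ε ∧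
    HasSum (fun n : ℕ => if n < N then 0 else Λ n / (n:ℝ)^σ) T := by
  have hs := Lam_summable hσ
  have ht := hs.hasSum.tendsto_sum_nat
  have := (ht.eventually (lt_mem_nhds (show (∑' n : ℕ, Λ n / (n:ℝ)^σ) - ε < _ by linarith))).exists
  obtain ⟨N, hN⟩ := this
  refine ⟨N, (∑' n : ℕ, Λ n / (n:ℝ)^σ) - ∑ n ∈ Finset.range N, Λ n / (n:ℝ)^σ, by linarith, ?_⟩
  have h2 : HasSum (fun n : ℕ => if n ∈ Finset.range N then Λ n / (n:ℝ)^σ else 0)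
      (∑ n ∈ Finset.range N, Λ n / (n:ℝ)^σ) := by
    rw [← Finset.sum_congr rfl (fun n hn => if_pos hn)]
    exact hasSum_sum_of_ne_finset_zero fun n hn => if_neg hn
  have e : (fun n : ℕ => if n < N then 0 else Λ n / (n:ℝ)^σ) =
      fun n : ℕ => Λ n / (n:ℝ)^σ - if n ∈ Finset.range N then Λ n / (n:ℝ)^σ else 0 := by
    funext n
    by_cases h : n < N <;> simp [h]
  rw [e]
  exact hs.hasSum.sub h2

/-- truncation of the Dirichlet series to primes in a finite window. -/
lemma truncate : ∃ C3 : ℝ, 1 ≤ C3 ∧ ∀ (p : ℕ) [NeZero p], p.Prime → ∀ lam η : ℝ, 1 ≤ lam →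
    η * Real.log p = lam → 0 < η → η ≤ 1/20000 → ∀ m : ℕ, C3 * lam ≤ m → ∃ N : ℕ,
    ∀ (χ : DirichletCharacter ℂ p) (t : ℝ) (k : ℕ), m ≤ k → k < 2*m →
    (576*η)^(k+1) * ‖DD χ k (1+η+t*I) - ∑ q ∈ SS p N, (bw η k q : ℂ) * χ q *
      cexp (-(t * Real.log q : ℝ) * I)‖ ≤ 3/8 := by
  obtain ⟨C0, hC1, hC0⟩ := Lam_sum
  set C1 := ∑' n : ℕ, (if n.Prime then 0 else Λ n / (n:ℝ)^(3/4:ℝ)) with hC1d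
  have hC1nn : 0 ≤ C1 := tsum_nonneg fun n => by
    split_ifs
    · exact le_rfl
    · have : 0 ≤ Λ n := vonMangoldt_nonneg
      positivity
  refine ⟨27648 + 4608 * (1 + C0) + C1, by nlinarith, fun p _ hp lam η h1l hlam h0 h1 m hm => ?_⟩
  set M : ℝ := 1152^(2*m) with hM
  have hMpos : 0 < M := by positivity
  obtain ⟨N, T, hT, hTs⟩ := tail_small (σ := 1 + η/2) (by linarith) (ε := 1/(8*M)) (by positivity)
  refine ⟨N, fun χ t k hk1 hk2 => ?_⟩
  have hmk : (m:ℝ) ≤ k := by exact_mod_cast hk1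
  have hkl : (27648 + 4608 * (1 + C0) + C1) * lam ≤ k := hm.trans hmk
  have hk4608 : 4608 * (1 + C0) ≤ k := by nlinarith
  have hkC1 : C1 ≤ k := by nlinarith
  have hk276 : 27648 * lam ≤ k := by nlinarith
  set l := Real.log p with hl
  have hl0 : 0 < l := Real.log_pos (by exact_mod_cast hp.one_lt)
  set f : ℕ → ℂ := fun n => χ n * Λ n * ((Real.log n)^k / (k.factorial) : ℝ) / (n:ℂ)^(1+η+t*I : ℂ)
    with hf
  have hsum : HasSum f (DD χ k (1+η+t*I)) := DD_hasSum χ k (by simp [h0])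
  have hS : ∑ q ∈ SS p N, (bw η k q : ℂ) * χ q * cexp (-(t * Real.log q : ℝ) * I) =
      ∑ q ∈ SS p N, f q := by
    refine Finset.sum_congr rfl fun q hq => ?_
    rw [← term_eq χ η t k q (Finset.mem_filter.1 hq).2.1]
  have h2 : HasSum (fun n : ℕ => if n ∈ SS p N then f n else 0) (∑ n ∈ SS p N, f n) := by
    rw [← Finset.sum_congr rfl (fun n hn => if_pos hn)]
    exact hasSum_sum_of_ne_finset_zero fun n hn => if_neg hn
  have h3 := hsum.sub h2
  rw [hS, ← h3.tsum_eq]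
  have hA := ((Lam_summable (σ := 1+η) (by linarith)).hasSum).mul_left ((4*l)^k / k.factorial)
  have hB := (np_summable.hasSum).mul_left ((4:ℝ)^k)
  have hC := hTs.mul_left ((2/η)^k)
  have hbound := tsum_of_norm_bounded (f := fun b => f b - if b ∈ SS p N then f b else 0)
    ((hA.add hB).add hC) (fun n => by
      have hΛ : 0 ≤ Λ n := vonMangoldt_nonneg
      have hA0 : 0 ≤ (4*l)^k / k.factorial * (Λ n / (n:ℝ)^(1+η)) := by positivity
      have hB0 : 0 ≤ (4:ℝ)^k * (if n.Prime then 0 else Λ n / (n:ℝ)^(3/4:ℝ)) := by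
        split_ifs
        · simp
        · positivity
      have hC0' : 0 ≤ (2/η)^k * (if n < N then 0 else Λ n / (n:ℝ)^(1+η/2)) := by
        split_ifs
        · simp
        · positivity
      by_cases hn : n ∈ SS p N
      · simp only [if_pos hn, sub_self, norm_zero]
        positivity
      simp only [if_neg hn, sub_zero]
      have hfn := term_norm χ η t k n
      rcases Nat.eq_zero_or_pos n with rfl | hn0
      · have : f 0 = 0 := by simp [hf]
        rw [this, norm_zero]
        linarith
      have hn1 : (1:ℝ) ≤ n := by exact_mod_cast hn0
      have hnpos : (0:ℝ) < n := by linarith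
      have hlog : 0 ≤ Real.log n := Real.log_natCast_nonneg n
      by_cases hnp : n < p^4
      · have : (Real.log n)^k / k.factorial * (Λ n / (n:ℝ)^(1+η)) ≤
            (4*l)^k / k.factorial * (Λ n / (n:ℝ)^(1+η)) := by
          gcongr
          have h5 : Real.log n ≤ Real.log ((p:ℝ)^4) :=
            Real.log_le_log hnpos (by exact_mod_cast hnp.le)
          rw [Real.log_pow] at h5
          exact_mod_cast h5
        linarith
      by_cases hpr : n.Prime
      · have hN : ¬ n < N := fun h => hn (Finset.mem_filter.2 ⟨Finset.mem_range.2 h, hpr, by omega⟩)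
        rw [if_neg hN]
        have h6 := logpow_le k n hn0 (c := η/2) (by positivity)
        have h7 : (Real.log n)^k / k.factorial * (Λ n / (n:ℝ)^(1+η)) ≤
          (2/η)^k * (Λ n / (n:ℝ)^(1+η/2)) := by
          calc _ ≤ (1/(η/2))^k * (n:ℝ)^(η/2) * (Λ n / (n:ℝ)^(1+η)) := by gcongr
            _ = _ := by
              rw [show (1+η) = (1 + η/2) + η/2 by ring, Real.rpow_add hnpos]
              have : (n:ℝ)^(η/2) ≠ 0 := by positivity
              rw [show 1/(η/2) = 2/η by field_simp]
              field_simp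
        linarith
      · rw [if_neg hpr] at hB0 ⊢
        have h6 := logpow_le k n hn0 (c := 1/4) (by positivity)
        have h7 : (Real.log n)^k / k.factorial * (Λ n / (n:ℝ)^(1+η)) ≤
          4^k * (Λ n / (n:ℝ)^(3/4:ℝ)) := by
          calc _ ≤ (1/(1/4))^k * (n:ℝ)^(1/4:ℝ) * (Λ n / (n:ℝ)^(3/4+1/4:ℝ)) := by
                have h9 : (n:ℝ)^(3/4+1/4:ℝ) ≤ (n:ℝ)^(1+η) :=
                  Real.rpow_le_rpow_of_exponent_le hn1 (by linarith)
                exact mul_le_mul h6 (div_le_div_of_nonneg_left hΛ (by positivity) h9)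
                  (by positivity) (by positivity)
            _ = _ := by
              rw [Real.rpow_add hnpos]
              have : (n:ℝ)^(1/4:ℝ) ≠ 0 := by positivity
              rw [show (1:ℝ)/(1/4) = 4 by norm_num]
              field_simp
        linarith)
  have hk4 : (k:ℝ) ≤ 4^k := by exact_mod_cast (Nat.lt_pow_self (by norm_num)).le
  have hk8 : (k:ℝ) ≤ 8^k := by exact_mod_cast (Nat.lt_pow_self (by norm_num)).le
  have pA : (576*η)^(k+1) * ((4*l)^k / k.factorial * ∑' n : ℕ, Λ n / (n:ℝ)^(1+η)) ≤ 1/8 := by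
    have hh := hC0 η h0 (by linarith)
    have hq : (2304*lam)^k / k.factorial ≤ (1/4)^k := by
      rw [div_le_iff₀ (by positivity)]
      calc (2304*lam)^k ≤ ((1/4)*((k:ℝ)/3))^k :=
          pow_le_pow_left₀ (by positivity) (by linarith) k
        _ = (1/4)^k * ((k:ℝ)/3)^k := by rw [mul_pow]
        _ ≤ _ := by gcongr; exact fact_lower k
    calc _ ≤ (576*η)^(k+1) * ((4*l)^k / k.factorial * (1/η+C0)) := by gcongr
      _ = 576 * (1 + C0 * η) * ((2304*lam)^k / k.factorial) := by
        rw [← hlam, pow_succ, show 2304*(η*l) = (576*η)*(4*l) by ring, mul_pow (576*η) (4*l)]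
        field_simp
      _ ≤ 576 * (1 + C0 * 1) * (1/4)^k := by gcongr; linarith
      _ = (4608 * (1 + C0)) / 4^k / 8 := by rw [div_pow, one_pow]; ring
      _ ≤ 1/8 := by
        gcongr
        rw [div_le_one (by positivity)]
        linarith
  have pB : (576*η)^(k+1) * (4^k * C1) ≤ 1/8 := by
    calc (576*η)^(k+1) * (4^k * C1) = (2304*η)^k * (576*η) * C1 := by
          rw [pow_succ, show 2304 * η = 576*η*4 by ring, mul_pow (576*η) 4]; ring
      _ ≤ (1/8)^k * (1/8) * C1 := by gcongr <;> linarith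
      _ = C1 / 8^k / 8 := by rw [div_pow, one_pow]; ring
      _ ≤ 1/8 := by
        gcongr
        rw [div_le_one (by positivity)]
        linarith
  have pC : (576*η)^(k+1) * ((2/η)^k * T) ≤ 1/8 := by
    calc (576*η)^(k+1) * ((2/η)^k * T) ≤ (576*η)^(k+1) * ((2/η)^k * (1/(8*M))) := by gcongr
      _ = (576*η) * 1152^k * (1/(8*M)) := by
        rw [pow_succ, show (1152:ℝ) = 576*η*(2/η) by field_simp; norm_num, mul_pow (576*η)]; ring
      _ ≤ 1 * M * (1/(8*M)) := by
        gcongr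
        · linarith
        · rw [hM]; exact pow_le_pow_right₀ (by norm_num) (by omega)
      _ = 1/8 := by field_simp
  have hw : 0 ≤ (576*η)^(k+1) := by positivity
  have := mul_le_mul_of_nonneg_left hbound hw
  refine this.trans ?_
  rw [mul_add, mul_add]
  linarith

lemma ell_le {p : ℕ} (hp : p.Prime) {t0 : ℝ} (ht : |t0| ≤ (p:ℝ)^3) :
    ell p t0 ≤ 5 * Real.log p := by
  have h2 : (2:ℝ) ≤ p := by exact_mod_cast hp.two_le
  rw [ell, ← Nat.cast_ofNat (n := 5), ← Real.log_pow]
  apply Real.log_le_log (by positivity)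
  have : |t0| + 4 ≤ (p:ℝ)^4 := by nlinarith [pow_le_pow_left₀ (by norm_num) h2 3]
  calc (p:ℝ) * (|t0|+4) ≤ p * p^4 := by gcongr
    _ = p^5 := by ring

lemma detect : ∃ C2 : ℝ, 1 ≤ C2 ∧ ∀ (p : ℕ) [NeZero p], p.Prime → ∀ lam η : ℝ, 1 ≤ lam →
    η * Real.log p = lam → 0 < η → η ≤ 1/20000 → ∀ m : ℕ, C2 * lam ≤ m → ∃ N : ℕ,
    ∀ (χ : DirichletCharacter ℂ p), χ ≠ 1 → ∀ t0 : ℝ, |t0| ≤ (p:ℝ)^3 → ∀ P : PFData χ t0,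
    ∀ t : ℝ, |t-t0| ≤ 1/4 → 
    (Finset.univ.filter (fun i => 1 - η ≤ (P.ρ i).re ∧ |(P.ρ i).im - t| ≤ η)).card ≤ m ∧ 
    ∀ i1, 1 - η ≤ (P.ρ i1).re → |(P.ρ i1).im - t| ≤ η → 
    ∃ k : ℕ, m ≤ k ∧ k < 2*m ∧ 
    1/4 ≤ (576*η)^(k+1) * ‖∑ q ∈ SS p N, (bw η k q : ℂ) * χ q *
      cexp (-(t * Real.log q : ℝ) * I)‖ := by
  obtain ⟨C3, h3, htr⟩ := truncate
  obtain ⟨C0, hC1, hC0⟩ := Lam_sum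
  refine ⟨2304^2 * (11001 + C0) + C3, by nlinarith, fun p _ hp lam η h1l hlam h0 h1 m hm => ?_⟩
  obtain ⟨N, hN⟩ := htr p hp lam η h1l hlam h0 h1 m (by nlinarith)
  refine ⟨N, fun χ hχ t0 ht0 P t ht => ⟨?_, fun i1 hre him => ?_⟩⟩
  · have h := P.near_count hχ hC1 hC0 h0 (by linarith) ht (ell_le hp ht0) hlam h1l
    have h4 : (Finset.univ.filter (fun i => 1 - η ≤ (P.ρ i).re ∧ |(P.ρ i).im - t| ≤ η)).card ≤
        (Finset.univ.filter (fun i => ‖(1+η+t*I) - P.ρ i‖ ≤ 2304 * η)).card := by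
      refine Finset.card_le_card fun i hi => ?_
      obtain ⟨-, hre, him⟩ := Finset.mem_filter.1 hi
      refine Finset.mem_filter.2 ⟨Finset.mem_univ _, ?_⟩
      refine (Complex.norm_le_abs_re_add_abs_im _).trans ?_
      have hlt := P.re_lt hχ i
      have e1 : ((1+η+t*I) - P.ρ i).re = 1 + η - (P.ρ i).re := by simp
      have e2 : ((1+η+t*I) - P.ρ i).im = t - (P.ρ i).im := by simp
      rw [e1, e2, abs_sub_comm t, abs_of_pos (by linarith)]
      linarith
    have h5 : ((Finset.univ.filter (fun i => 1 - η ≤ (P.ρ i).re ∧ |(P.ρ i).im - t| ≤ η)).card:ℝ) ≤ m := by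
      refine le_trans (by exact_mod_cast h4) (h.trans (le_trans ?_ hm))
      gcongr
      linarith
    exact_mod_cast h5
  · obtain ⟨k, hk1, hk2, hk⟩ := P.zero_lower hχ hC1 hC0 h0 h1 ht (ell_le hp ht0) hlam h1l
      (C2 := 2304^2 * (11001 + C0) + C3) (by linarith) m hm i1 hre him
    refine ⟨k, hk1, hk2, ?_⟩
    have h6 := hN χ t k hk1 hk2
    set Y := ∑ q ∈ SS p N, (bw η k q : ℂ) * χ q * cexp (-(t * Real.log q : ℝ) * I)
    have h7 : ‖DD χ k (1+η+t*I)‖ ≤ ‖DD χ k (1+η+t*I) - Y‖ + ‖Y‖ := by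
      simpa using norm_add_le (DD χ k (1+η+t*I) - Y) Y
    have hw : 0 ≤ (576*η)^(k+1) := by positivity
    have := mul_le_mul_of_nonneg_left h7 hw
    rw [mul_add] at this
    linarith

end PAP


/-! Part 10 -/

namespace PAP
open Complex Metric ArithmeticFunction

lemma fact_ratio (k : ℕ) : ((2*k+1).factorial : ℝ) ≤ 16^k * (k.factorial:ℝ)^2 := by
  have h1 : (2*k).factorial = Nat.centralBinom k * k.factorial * k.factorial := by
    rw [Nat.centralBinom]
    have := Nat.choose_mul_factorial_mul_factorial (n := 2*k) (k := k) (by omega)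
    rw [show 2*k-k = k by omega] at this
    exact this.symm
  have h2 : Nat.centralBinom k ≤ 4^k := by
    rw [Nat.centralBinom]
    calc (2*k).choose k ≤ 2^(2*k) := Nat.choose_le_two_pow _ _
      _ = 4^k := by rw [pow_mul]; norm_num
  have h3 : 2*k+1 ≤ 4^k := by
    induction k with
    | zero => simp
    | succ k ih => 
      have ih' : 2*k+1 ≤ 4^k := by
        clear h1 h2
        clear ih
        induction k with
        | zero => simp
        | succ j ih => rw [pow_succ]; omega
      rw [pow_succ]; omega
  have h4 : (2*k+1).factorial ≤ 16^k * k.factorial^2 := by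
    rw [Nat.factorial_succ, h1]
    calc (2*k+1) * (Nat.centralBinom k * k.factorial * k.factorial)
        ≤ 4^k * (4^k * k.factorial * k.factorial) := by gcongr
      _ = 16^k * k.factorial^2 := by
        rw [show (16:ℕ) = 4*4 by norm_num, mul_pow]; ring
  exact_mod_cast h4

lemma bw_sum {C0 : ℝ} (hC1 : 1 ≤ C0) (hC0 : ∀ η : ℝ, 0 < η → η ≤ 1 →
    ∑' n : ℕ, Λ n / (n:ℝ)^(1+η) ≤ 1/η + C0) {η : ℝ} (h0 : 0 < η) (h1 : η ≤ 1) (p N k : ℕ) :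
    ∑ q ∈ SS p N, (bw η k q)^2 * q ≤ 16^k * (1/η)^(2*k+2) * (1 + C0) := by
  have ht : ∀ q ∈ SS p N, (bw η k q)^2 * q ≤ 16^k * (1/η)^(2*k+1) * (Λ q / (q:ℝ)^(1+η)) := by
    intro q hq
    have hpr := (Finset.mem_filter.1 hq).2.1
    rw [vonMangoldt_apply_prime hpr]
    have hq0 : (0:ℝ) < q := by exact_mod_cast hpr.pos
    have hl : 0 ≤ Real.log q := Real.log_natCast_nonneg q
    have h2 := logpow_le (2*k+1) q hpr.one_lt.le h0
    have h3 := fact_ratio k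
    rw [div_le_iff₀ (by positivity)] at h2
    have e : (bw η k q)^2 * q = (Real.log q)^(2*k+1) * Real.log q /
        ((k.factorial:ℝ)^2 * (q:ℝ)^(1+η) * (q:ℝ)^η) := by
      rw [bw, Real.rpow_add hq0, Real.rpow_one]
      have : (q:ℝ)^η ≠ 0 := by positivity
      field_simp
      ring
    rw [e, div_le_iff₀ (by positivity)]
    calc (Real.log q)^(2*k+1) * Real.log q
        ≤ ((1/η)^(2*k+1) * (q:ℝ)^η * (16^k * (k.factorial:ℝ)^2)) * Real.log q := by
          gcongr
          exact h2.trans (by gcongr)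
      _ = _ := by
        field_simp
  calc _ ≤ ∑ q ∈ SS p N, 16^k * (1/η)^(2*k+1) * (Λ q / (q:ℝ)^(1+η)) := Finset.sum_le_sum ht
    _ = 16^k * (1/η)^(2*k+1) * ∑ q ∈ SS p N, (Λ q / (q:ℝ)^(1+η)) := by rw [Finset.mul_sum]
    _ ≤ 16^k * (1/η)^(2*k+1) * (1/η + C0) := by
      gcongr
      refine ((Lam_summable (σ := 1+η) (by linarith)).sum_le_tsum _ fun n _ => ?_).trans (hC0 η h0 h1)
      have : 0 ≤ Λ n := vonMangoldt_nonneg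
      positivity
    _ ≤ 16^k * (1/η)^(2*k+1) * ((1/η) * (1 + C0)) := by
      gcongr
      have : 1 ≤ 1/η := by rw [le_div_iff₀ h0]; linarith
      nlinarith
    _ = _ := by rw [pow_succ (1/η) (2*k+1)]; ring

lemma int_ind {γ η t0 : ℝ} (h0 : 0 < η) (h1 : η ≤ 1/8) (h : |γ - t0| ≤ 1/8) :
    ∫ t in (t0-1/4)..(t0+1/4), (Set.Icc (γ-η) (γ+η)).indicator (fun _ => (1:ℝ)) t = 2*η := by
  rw [intervalIntegral.integral_of_le (by linarith), ← MeasureTheory.integral_Icc_eq_integral_Ioc,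
    MeasureTheory.setIntegral_indicator measurableSet_Icc]
  have hab := abs_le.1 h
  have : Set.Icc (t0-1/4) (t0+1/4) ∩ Set.Icc (γ-η) (γ+η) = Set.Icc (γ-η) (γ+η) := by
    rw [Set.inter_eq_right]
    apply Set.Icc_subset_Icc <;> linarith
  rw [this]
  simp
  rw [max_eq_left (by linarith)]
  ring

theorem density : ∃ C7 : ℝ, 1 ≤ C7 ∧ ∀ (p : ℕ) [NeZero p], p.Prime → ∀ lam : ℝ, 1 ≤ lam →
    lam / Real.log p ≤ 1/20000 → ∀ t0 : ℝ, |t0| ≤ (p:ℝ)^3 →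
    ∀ P : (∀ χ : {χ : DirichletCharacter ℂ p // χ ≠ 1}, PFData χ.1 t0),
    ∑ χ : {χ : DirichletCharacter ℂ p // χ ≠ 1},
      ((Finset.univ.filter (fun i => 1 - lam / Real.log p ≤ ((P χ).ρ i).re ∧
        |((P χ).ρ i).im - t0| ≤ 1/8)).card : ℝ) ≤ C7 * Real.exp (C7 * lam) := by
  classical
  obtain ⟨C2, hC2, hdet⟩ := detect
  obtain ⟨C0, hC1, hC0⟩ := Lam_sum
  set K : ℝ := 8 * 576^2 * (80 * Real.exp 5) * (1 + C0) with hK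
  refine ⟨max K (80*C2), le_max_of_le_right (by linarith), fun p _ hp lam h1l hη t0 ht0 P => ?_⟩
  set l := Real.log p with hl
  have hl0 : 0 < l := Real.log_pos (by exact_mod_cast hp.one_lt)
  set η := lam / l with hηd
  have h0 : 0 < η := by positivity
  have hlam : η * l = lam := by rw [hηd]; field_simp
  set m : ℕ := ⌈C2 * lam⌉₊ with hm
  have hm1 : C2 * lam ≤ m := Nat.le_ceil _
  have hm2 : (m:ℝ) ≤ 2 * C2 * lam := by
    have := (Nat.ceil_lt_add_one (show 0 ≤ C2 * lam by nlinarith)).le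
    nlinarith
  obtain ⟨N, hN⟩ := hdet p hp lam η h1l hlam h0 hη m hm1
  set Y : ℕ → DirichletCharacter ℂ p → ℝ → ℂ := fun k χ t => ∑ q ∈ SS p N, (bw η k q : ℂ) * χ q *
      cexp (-(t * Real.log q : ℝ) * I) with hY
  have hYc : ∀ k χ, Continuous (fun t => ‖Y k χ t‖^2) := by
    intro k χ
    simp only [hY]
    refine ((continuous_finsetSum _ fun q _ => ?_).norm).pow 2
    fun_prop
  -- single character
  have hone : ∀ χ : {χ : DirichletCharacter ℂ p // χ ≠ 1},
      2 * η * ((Finset.univ.filter (fun i => 1 - η ≤ ((P χ).ρ i).re ∧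
        |((P χ).ρ i).im - t0| ≤ 1/8)).card : ℝ) ≤
      ∑ k ∈ Finset.Ico m (2*m), (m * (16 * ((576*η)^(k+1))^2)) *
        ∫ t in (t0-1/4)..(t0+1/4), ‖Y k χ.1 t‖^2 := by
    intro χ
    set Z := Finset.univ.filter (fun i => 1 - η ≤ ((P χ).ρ i).re ∧
        |((P χ).ρ i).im - t0| ≤ 1/8) with hZ
    set g : Fin (P χ).n → ℝ → ℝ := fun i =>
      (Set.Icc (((P χ).ρ i).im-η) (((P χ).ρ i).im+η)).indicator (fun _ => (1:ℝ)) with hg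
    have hgi : ∀ i, IntervalIntegrable (g i) MeasureTheory.volume (t0-1/4) (t0+1/4) := by
      intro i
      rw [intervalIntegrable_iff]
      refine MeasureTheory.Integrable.indicator ?_ measurableSet_Icc
      rw [← MeasureTheory.IntegrableOn, ← intervalIntegrable_iff]
      exact intervalIntegrable_const
    have e1 : 2 * η * (Z.card : ℝ) = ∫ t in (t0-1/4)..(t0+1/4), ∑ i ∈ Z, g i t := by
      rw [intervalIntegral.integral_finsetSum fun i _ => hgi i]
      rw [Finset.sum_congr rfl fun i hi => int_ind h0 (by linarith) (Finset.mem_filter.1 hi).2.2]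
      rw [Finset.sum_const, nsmul_eq_mul]; ring
    have e2 : ∑ k ∈ Finset.Ico m (2*m), (m * (16 * ((576*η)^(k+1))^2)) *
        ∫ t in (t0-1/4)..(t0+1/4), ‖Y k χ.1 t‖^2 =
        ∫ t in (t0-1/4)..(t0+1/4), ∑ k ∈ Finset.Ico m (2*m),
          (m * (16 * ((576*η)^(k+1))^2)) * ‖Y k χ.1 t‖^2 := by
      rw [intervalIntegral.integral_finsetSum]
      · refine Finset.sum_congr rfl fun k _ => ?_
        rw [intervalIntegral.integral_const_mul]
      · intro k _
        exact ((hYc k χ.1).const_mul _).intervalIntegrable _ _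
    rw [e1, e2]
    refine intervalIntegral.integral_mono_on (by linarith) ?_ ?_ fun t ht => ?_
    · have := IntervalIntegrable.sum Z (f := g) (fun i _ => hgi i)
      simpa [Finset.sum_fn] using this
    · exact (continuous_finsetSum _ fun k _ => (hYc k χ.1).const_mul _).intervalIntegrable _ _
    · have ht' : |t-t0| ≤ 1/4 := by rw [abs_le]; constructor <;> linarith [ht.1, ht.2]
      obtain ⟨hc, hd⟩ := hN χ.1 χ.2 t0 ht0 (P χ) t ht'
      have hgval : ∀ i, g i t = if |((P χ).ρ i).im - t| ≤ η then 1 else 0 := by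
        intro i
        simp only [hg, Set.indicator_apply, Set.mem_Icc, abs_le]
        congr 1
        apply propext
        constructor
        · rintro ⟨a, b⟩; constructor <;> linarith
        · rintro ⟨a, b⟩; constructor <;> linarith
      have hL : ∑ i ∈ Z, g i t = ((Z.filter (fun i => |((P χ).ρ i).im - t| ≤ η)).card : ℝ) := by
        rw [Finset.sum_congr rfl fun i _ => hgval i, ← Finset.sum_filter]
        simp
      rw [hL]
      rcases (Z.filter (fun i => |((P χ).ρ i).im - t| ≤ η)).eq_empty_or_nonempty with he | ⟨i1, hi1⟩
      · rw [he]
        simp only [Finset.card_empty, Nat.cast_zero]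
        positivity
      · obtain ⟨hi2, hi3⟩ := Finset.mem_filter.1 hi1
        obtain ⟨-, hi4, -⟩ := Finset.mem_filter.1 hi2
        obtain ⟨k, hk1, hk2, hk⟩ := hd i1 hi4 hi3
        have hcard : ((Z.filter (fun i => |((P χ).ρ i).im - t| ≤ η)).card : ℝ) ≤ m := by
          have : (Z.filter (fun i => |((P χ).ρ i).im - t| ≤ η)).card ≤ m := by
            refine le_trans (Finset.card_le_card fun i hi => ?_) hc
            obtain ⟨a, b⟩ := Finset.mem_filter.1 hi
            obtain ⟨-, c, -⟩ := Finset.mem_filter.1 a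
            exact Finset.mem_filter.2 ⟨Finset.mem_univ _, c, b⟩
          exact_mod_cast this
        have hsq : 1 ≤ 16 * ((576*η)^(k+1))^2 * ‖Y k χ.1 t‖^2 := by
          have : (1/4)^2 ≤ ((576*η)^(k+1) * ‖Y k χ.1 t‖)^2 := by
            apply pow_le_pow_left₀ (by norm_num)
            exact hk
          rw [mul_pow] at this
          linarith
        refine le_trans ?_ (Finset.single_le_sum (f := fun k => (m * (16 * ((576*η)^(k+1))^2)) *
          ‖Y k χ.1 t‖^2) (fun k _ => by positivity) (Finset.mem_Ico.2 ⟨hk1, hk2⟩))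
        calc _ ≤ (m:ℝ) * 1 := by linarith
          _ ≤ m * (16 * ((576*η)^(k+1))^2 * ‖Y k χ.1 t‖^2) := by gcongr
          _ = _ := by ring
  -- mean value
  have hmv : ∀ k, ∑ χ : {χ : DirichletCharacter ℂ p // χ ≠ 1},
      ∫ t in (t0-1/4)..(t0+1/4), ‖Y k χ.1 t‖^2 ≤
      80 * Real.exp 5 / l * (16^k * (1/η)^(2*k+2) * (1 + C0)) := by
    intro k
    have h1 := mean_value p hp (SS p N) (fun q hq => (Finset.mem_filter.1 hq).2)
      (bw η k) (fun q => by
        have hlq : 0 ≤ Real.log q := Real.log_natCast_nonneg q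
        rw [bw]; positivity) t0
    have h2 : ∑ χ : {χ : DirichletCharacter ℂ p // χ ≠ 1},
        ∫ t in (t0-1/4)..(t0+1/4), ‖Y k χ.1 t‖^2 ≤
        ∑ χ : DirichletCharacter ℂ p, ∫ t in (t0-1/4)..(t0+1/4), ‖Y k χ t‖^2 := by
      have hnn : ∀ χ : DirichletCharacter ℂ p,
          0 ≤ ∫ t in (t0-1/4)..(t0+1/4), ‖Y k χ t‖^2 := fun χ =>
        intervalIntegral.integral_nonneg (by linarith) fun t _ => by positivity
      rw [← Finset.sum_subtype (p := fun χ : DirichletCharacter ℂ p => χ ≠ 1)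
        (Finset.univ.filter (fun χ => χ ≠ 1)) (by simp)
        (fun χ => ∫ t in (t0-1/4)..(t0+1/4), ‖Y k χ t‖^2)]
      exact Finset.sum_le_univ_sum_of_nonneg hnn
    refine h2.trans (h1.trans ?_)
    gcongr
    exact bw_sum hC1 hC0 h0 (by linarith) p N k
  set T := ∑ χ : {χ : DirichletCharacter ℂ p // χ ≠ 1},
      ((Finset.univ.filter (fun i => 1 - η ≤ ((P χ).ρ i).re ∧
        |((P χ).ρ i).im - t0| ≤ 1/8)).card : ℝ) with hT
  have hfin : 2 * η * T ≤ ∑ k ∈ Finset.Ico m (2*m), (m * (16 * ((576*η)^(k+1))^2)) *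
      (80 * Real.exp 5 / l * (16^k * (1/η)^(2*k+2) * (1 + C0))) := by
    rw [hT, Finset.mul_sum]
    refine (Finset.sum_le_sum fun χ _ => hone χ).trans ?_
    rw [Finset.sum_comm]
    refine Finset.sum_le_sum fun k _ => ?_
    rw [← Finset.mul_sum]
    gcongr
    exact hmv k
  have hterm : ∀ k ∈ Finset.Ico m (2*m), (m * (16 * ((576*η)^(k+1))^2)) *
      (80 * Real.exp 5 / l * (16^k * (1/η)^(2*k+2) * (1 + C0))) ≤
      2 / l * K * m * 5308416^(2*m) := by
    intro k hk
    have e : (m * (16 * ((576*η)^(k+1))^2)) *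
      (80 * Real.exp 5 / l * (16^k * (1/η)^(2*k+2) * (1 + C0))) = 2 / l * K * m * 5308416^k := by
      have a1 : ((576*η)^(k+1))^2 * (1/η)^(2*k+2) = 576^(2*k+2) := by
        rw [← pow_mul, show (k+1)*2 = 2*k+2 by ring, ← mul_pow]
        congr 1; field_simp
      have a2 : (5308416:ℝ)^k = 576^(2*k) * 16^k := by
        rw [pow_mul, ← mul_pow]; norm_num
      rw [a2, hK]
      calc _ = m * 16 * (80 * Real.exp 5) / l * 16^k * (1 + C0) *
          (((576*η)^(k+1))^2 * (1/η)^(2*k+2)) := by ring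
        _ = _ := by rw [a1, pow_add]; ring
    rw [e]
    have hKpos : 0 ≤ K := by rw [hK]; positivity
    gcongr
    · norm_num
    · exact (Finset.mem_Ico.1 hk).2.le
  have hsum := hfin.trans (Finset.sum_le_card_nsmul _ _ _ hterm)
  rw [Nat.card_Ico, show 2*m-m = m by omega, nsmul_eq_mul] at hsum
  have hKpos : 0 ≤ K := by rw [hK]; positivity
  have hT1 : T ≤ K * ((m:ℝ)^2 * 5308416^(2*m)) := by
    have hTnn : 0 ≤ T := Finset.sum_nonneg fun _ _ => by positivity
    have h1 : 2 * lam * T ≤ 2 * (K * ((m:ℝ)^2 * 5308416^(2*m))) := by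
      have := mul_le_mul_of_nonneg_left hsum hl0.le
      calc 2 * lam * T = l * (2 * η * T) := by rw [← hlam]; ring
        _ ≤ _ := this
        _ = _ := by field_simp
    nlinarith
  have hm4 : (m:ℝ)^2 ≤ 4^m := by
    have : (m:ℝ) ≤ 2^m := by exact_mod_cast Nat.lt_two_pow_self.le
    calc (m:ℝ)^2 ≤ (2^m)^2 := by gcongr
      _ = 4^m := by rw [← pow_mul, mul_comm, pow_mul]; norm_num
  have hexp : (4:ℝ) * 5308416^2 ≤ Real.exp 40 := by
    have h1 : (2.7:ℝ) ≤ Real.exp 1 := by linarith [Real.exp_one_gt_d9]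
    have h2 : (2.7:ℝ)^40 ≤ Real.exp 1 ^ 40 := by gcongr
    rw [Real.exp_one_pow] at h2
    refine le_trans (by norm_num) h2
  calc T ≤ K * (4^m * 5308416^(2*m)) := hT1.trans (by gcongr)
    _ = K * (4 * 5308416^2)^m := by rw [mul_pow, pow_mul]
    _ ≤ K * (Real.exp 40)^m := by gcongr
    _ = K * Real.exp (m * 40) := by rw [← Real.exp_nat_mul]
    _ ≤ max K (80*C2) * Real.exp (max K (80*C2) * lam) := by
      have hz : (m:ℝ) * 40 ≤ max K (80*C2) * lam := by
        calc (m:ℝ) * 40 ≤ 80 * C2 * lam := by linarith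
          _ ≤ _ := by gcongr; exact le_max_right _ _
      exact mul_le_mul (le_max_left _ _) (Real.exp_le_exp.2 hz) (Real.exp_pos _).le
        (hKpos.trans (le_max_left _ _))

end PAP


/-! Part 11 -/

namespace PAP
open Complex Metric ArithmeticFunction

lemma logLam_le (k n : ℕ) {r : ℝ} (hr : 0 < r) :
    (Real.log n)^k / k.factorial * (Λ n / (n:ℝ)^(1+r)) ≤ (2/r)^k * (Λ n / (n:ℝ)^(1+r/2)) := by
  have hΛ : 0 ≤ Λ n := vonMangoldt_nonneg
  rcases Nat.eq_zero_or_pos n with rfl | hn0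
  · simp
  have hnpos : (0:ℝ) < n := by exact_mod_cast hn0
  have h6 := logpow_le k n hn0 (c := r/2) (by positivity)
  calc _ ≤ (1/(r/2))^k * (n:ℝ)^(r/2) * (Λ n / (n:ℝ)^(1+r)) := by gcongr
    _ = _ := by
      rw [show (1+r) = (1 + r/2) + r/2 by ring, Real.rpow_add hnpos]
      have : (n:ℝ)^(r/2) ≠ 0 := by positivity
      rw [show 1/(r/2) = 2/r by field_simp]
      field_simp

lemma logLam_nonneg (k n : ℕ) (r : ℝ) : 0 ≤ (Real.log n)^k / k.factorial * (Λ n / (n:ℝ)^(1+r)) := by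
  have hΛ : 0 ≤ Λ n := vonMangoldt_nonneg
  have hl : 0 ≤ Real.log n := Real.log_natCast_nonneg n
  positivity

lemma logLam_summable (k : ℕ) {r : ℝ} (hr : 0 < r) :
    Summable (fun n : ℕ => (Real.log n)^k / k.factorial * (Λ n / (n:ℝ)^(1+r))) :=
  Summable.of_nonneg_of_le (fun n => logLam_nonneg k n r) (fun n => logLam_le k n hr)
    ((Lam_summable (σ := 1 + r/2) (by linarith)).mul_left _)

lemma DD_cont {p : ℕ} [NeZero p] (χ : DirichletCharacter ℂ p) (k : ℕ) {r : ℝ} (hr : 0 < r) :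
    Continuous (fun t : ℝ => DD χ k (1+r+t*I)) := by
  unfold DD
  refine continuous_tsum (fun n => ?_) (logLam_summable k hr) (fun n t => term_norm χ r t k n)
  rcases Nat.eq_zero_or_pos n with rfl | hn
  · simpa using continuous_const
  · have hn0 : (n:ℂ) ≠ 0 := by exact_mod_cast hn.ne'
    refine Continuous.div continuous_const ?_ (fun t => by simp [hn0])
    refine Continuous.const_cpow (by fun_prop) (Or.inl hn0)

lemma int_zero (κ : ℕ) (hκ : 1 ≤ κ) {A r γ x y : ℝ} (hA : 0 < A) (hr : 0 < r) (hxy : x ≤ y) :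
    ∫ t in x..y, (r^2/(A^2 + (t-γ)^2))^κ ≤ (r/A)^(2*κ) * (π * A / √κ) := by
  have hκ0 : (0:ℝ) < κ := by exact_mod_cast hκ
  have hs : 0 < √(κ:ℝ) := Real.sqrt_pos.2 hκ0
  set c := √(κ:ℝ)/A with hc
  have hc0 : 0 < c := by positivity
  have hpt : ∀ t : ℝ, (r^2/(A^2 + (t-γ)^2))^κ ≤ (r/A)^(2*κ) * (1 + (c*t - c*γ)^2)⁻¹ := by
    intro t
    have e : r^2/(A^2 + (t-γ)^2) = (r/A)^2 * (1 + ((t-γ)/A)^2)⁻¹ := by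
      have : A^2 + (t-γ)^2 ≠ 0 := by positivity
      field_simp
    rw [e, mul_pow, ← pow_mul, inv_pow]
    gcongr
    have hb := one_add_mul_le_pow (a := ((t-γ)/A)^2) (by nlinarith [sq_nonneg ((t-γ)/A)]) κ
    refine le_trans (le_of_eq ?_) hb
    rw [show c*t - c*γ = √(κ:ℝ) * ((t-γ)/A) by rw [hc]; field_simp, mul_pow, Real.sq_sqrt hκ0.le]
  have hi1 : Continuous (fun t : ℝ => (r^2/(A^2 + (t-γ)^2))^κ) := by
    refine Continuous.pow (Continuous.div continuous_const (by fun_prop) fun t => ?_) κ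
    positivity
  have hi2 : Continuous (fun t : ℝ => (1 + (c*t - c*γ)^2)⁻¹) := by
    refine Continuous.inv₀ (by fun_prop) fun t => ?_
    positivity
  calc ∫ t in x..y, (r^2/(A^2 + (t-γ)^2))^κ
      ≤ ∫ t in x..y, (r/A)^(2*κ) * (1 + (c*t - c*γ)^2)⁻¹ :=
        intervalIntegral.integral_mono_on hxy (hi1.intervalIntegrable _ _)
          ((hi2.const_mul _).intervalIntegrable _ _) fun t _ => hpt t
    _ = (r/A)^(2*κ) * (c⁻¹ * (Real.arctan (c*y-c*γ) - Real.arctan (c*x-c*γ))) := by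
        rw [intervalIntegral.integral_const_mul,
          intervalIntegral.integral_comp_mul_sub (fun u => (1+u^2)⁻¹) hc0.ne', integral_inv_one_add_sq,
          smul_eq_mul]
    _ ≤ (r/A)^(2*κ) * (c⁻¹ * π) := by
        gcongr
        linarith [Real.arctan_lt_pi_div_two (c*y-c*γ), Real.neg_pi_div_two_lt_arctan (c*x-c*γ)]
    _ = _ := by rw [hc]; field_simp

lemma exp_half_le {x : ℝ} (h0 : 0 ≤ x) (h1 : x ≤ 1) : Real.exp (x/2) ≤ 1 + x := by
  have h := Real.add_one_le_exp (-(x/2))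
  have h2 : Real.exp (x/2) * Real.exp (-(x/2)) = 1 := by rw [← Real.exp_add]; simp
  have hp := Real.exp_pos (x/2)
  nlinarith

lemma zero_weight {κ : ℕ} {r U d : ℝ} (hU : 0 < U) (hr0 : 0 < r)
    (hkr : r * U ≤ 2 * κ) (hd0 : 0 ≤ d) (hd : d ≤ r) :
    (r/(r+d))^(2*κ) ≤ Real.exp (-(U*d/2)) := by
  have hx0 : 0 ≤ d/r := by positivity
  have hx1 : d/r ≤ 1 := by rw [div_le_one hr0]; exact hd
  have h := exp_half_le hx0 hx1
  have e : r/(r+d) = (1+d/r)⁻¹ := by field_simp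
  rw [e, inv_pow]
  calc ((1+d/r)^(2*κ))⁻¹ ≤ ((Real.exp (d/r/2))^(2*κ))⁻¹ := by gcongr
    _ = Real.exp (-(κ * (d/r))) := by
      rw [← Real.exp_nat_mul, ← Real.exp_neg]; push_cast; ring_nf
    _ ≤ _ := by
      rw [Real.exp_le_exp, neg_le_neg_iff, ← mul_div_assoc, div_le_div_iff₀ (by norm_num) hr0]
      nlinarith

lemma geom_exp (J : ℕ) {D : ℝ} (hD : D ≤ -1) :
    ∑ j ∈ Finset.range J, Real.exp (D * j) ≤ 2 := by
  have h1 : ∀ j ∈ Finset.range J, Real.exp (D * j) ≤ (1/2:ℝ)^j := by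
    intro j _
    rw [mul_comm, Real.exp_nat_mul]
    gcongr
    calc Real.exp D ≤ Real.exp (-1) := Real.exp_le_exp.2 hD
      _ ≤ 1/2 := by
        rw [Real.exp_neg, inv_le_comm₀ (Real.exp_pos _) (by norm_num)]
        have := Real.exp_one_gt_d9
        norm_num; linarith
  refine (Finset.sum_le_sum h1).trans ?_
  have := sum_geometric_two_le J
  simpa using this

/-- sum over zeros near the line -/
lemma zero_sum : ∃ C9 : ℝ, 1 ≤ C9 ∧ ∀ (p : ℕ) [NeZero p], p.Prime → ∀ c : ℝ, 0 < c → ¬ Bad c p →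
    ∀ M : ℝ, C9 ≤ M → 40000 ≤ Real.log p → ∀ t0 : ℝ, |t0| ≤ (p:ℝ)^3 →
    ∀ P : (∀ χ : {χ : DirichletCharacter ℂ p // χ ≠ 1}, PFData χ.1 t0),
    ∑ χ : {χ : DirichletCharacter ℂ p // χ ≠ 1},
      ∑ i ∈ (Finset.univ.filter (fun i => 1 - 1/40000 ≤ ((P χ).ρ i).re ∧
        |((P χ).ρ i).im - t0| ≤ 1/8)), Real.exp (-(M * ((1 - ((P χ).ρ i).re) * Real.log p)/2))
      ≤ C9 * Real.exp (-(c*M/4)) := by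
  obtain ⟨C7, h7, hden⟩ := density
  refine ⟨max (4 * C7 + 4) (2 * C7 * Real.exp C7), le_max_of_le_left (by linarith),
    fun p _ hp c hc hbad M hM hl t0 ht0 P => ?_⟩
  have hM1 : 4 * C7 + 4 ≤ M := (le_max_left _ _).trans hM
  set l := Real.log p with hld
  set J := ⌊l/20000⌋₊ with hJ
  have hp2 : (2:ℝ) ≤ p := by exact_mod_cast hp.two_le
  have hl0 : 0 < l := by linarith
  have hpt : ∀ χ : {χ : DirichletCharacter ℂ p // χ ≠ 1},
      ∀ i ∈ (Finset.univ.filter (fun i => 1 - 1/40000 ≤ ((P χ).ρ i).re ∧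
        |((P χ).ρ i).im - t0| ≤ 1/8)), Real.exp (-(M * ((1 - ((P χ).ρ i).re) * l)/2)) ≤
        Real.exp (-(c*M/4)) * ∑ j ∈ Finset.range J, Real.exp (-(M/4) * j) *
          (if 1 - ((j:ℝ)+1)/l ≤ ((P χ).ρ i).re ∧ |((P χ).ρ i).im - t0| ≤ 1/8 then 1 else 0) := by
    intro χ i hi
    obtain ⟨-, h1, h2⟩ := Finset.mem_filter.1 hi
    set lam := (1 - ((P χ).ρ i).re) * l with hlam
    have hlamc : c ≤ lam := by
      by_contra hh
      push Not at hh
      apply hbad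
      refine ⟨inferInstance, χ.1, χ.2, (P χ).ρ i, (P χ).zero i, ?_, ?_⟩
      · have e : ((P χ).ρ i).im = (((P χ).ρ i).im - t0) + t0 := by ring
        rw [e]
        refine (abs_add_le _ _).trans ?_
        have : (p:ℝ)^3 * 2 ≤ p^4 := by rw [pow_succ (p:ℝ) 3]; gcongr
        nlinarith [pow_le_pow_left₀ (by norm_num) hp2 3]
      · have : (1 - ((P χ).ρ i).re) < c / l := by rw [lt_div_iff₀ hl0]; exact hh
        linarith
    have hlam0 : 0 < lam := by linarith
    obtain ⟨j, hj⟩ : ∃ j, ⌈lam⌉₊ = j + 1 := ⟨⌈lam⌉₊ - 1, by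
      have := Nat.ceil_pos.2 hlam0; omega⟩
    have hj1 : (j:ℝ) < lam := by
      have := Nat.ceil_lt_add_one hlam0.le
      rw [hj] at this; push_cast at this; linarith
    have hj2 : lam ≤ (j:ℝ)+1 := by
      have := Nat.le_ceil lam
      rw [hj] at this; push_cast at this; linarith
    have hlamU : lam ≤ l / 40000 := by
      rw [hlam]
      calc _ ≤ (1/40000) * l := by gcongr; linarith
        _ = _ := by ring
    have hjJ : j < J := by
      have : ((j+1:ℕ):ℝ) ≤ l/20000 := by push_cast; linarith
      have := Nat.le_floor this
      omega
    have hsingle := Finset.single_le_sum (f := fun j : ℕ => Real.exp (-(M/4) * j) *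
          (if 1 - ((j:ℝ)+1)/l ≤ ((P χ).ρ i).re ∧ |((P χ).ρ i).im - t0| ≤ 1/8 then (1:ℝ) else 0))
      (s := Finset.range J) (fun j _ => by
        exact mul_nonneg (Real.exp_pos _).le (by split_ifs <;> norm_num)) (Finset.mem_range.2 hjJ)
    have hcond : 1 - ((j:ℝ)+1)/l ≤ ((P χ).ρ i).re ∧ |((P χ).ρ i).im - t0| ≤ 1/8 := by
      refine ⟨?_, h2⟩
      have : 1 - ((P χ).ρ i).re ≤ ((j:ℝ)+1)/l := by rw [le_div_iff₀ hl0]; exact hj2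
      linarith
    simp only [if_pos hcond, mul_one] at hsingle
    refine le_trans ?_ (mul_le_mul_of_nonneg_left hsingle (Real.exp_pos _).le)
    rw [← Real.exp_add, Real.exp_le_exp]
    have hM0 : 0 < M := by linarith
    nlinarith
  have hcount : ∀ j ∈ Finset.range J, ∑ χ : {χ : DirichletCharacter ℂ p // χ ≠ 1},
      ∑ i, (if 1 - ((j:ℝ)+1)/l ≤ ((P χ).ρ i).re ∧ |((P χ).ρ i).im - t0| ≤ 1/8 then (1:ℝ) else 0)
      ≤ C7 * Real.exp (C7 * ((j:ℝ)+1)) := by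
    intro j hj
    have hj' : j + 1 ≤ J := Finset.mem_range.1 hj
    have h3 : ((j:ℝ)+1)/l ≤ 1/20000 := by
      rw [div_le_iff₀ hl0]
      have h4 : ((j+1:ℕ):ℝ) ≤ J := by exact_mod_cast hj'
      have h5 := Nat.floor_le (show 0 ≤ l/20000 by positivity)
      push_cast at h4
      linarith
    have h6 := hden p hp ((j:ℝ)+1) (by linarith [(Nat.cast_nonneg j : (0:ℝ) ≤ j)]) h3 t0 ht0 P
    refine le_trans (le_of_eq ?_) h6
    refine Finset.sum_congr rfl fun χ _ => ?_
    rw [← Finset.sum_filter]; simp [hld]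
  calc _ ≤ ∑ χ : {χ : DirichletCharacter ℂ p // χ ≠ 1},
      ∑ i, Real.exp (-(c*M/4)) * ∑ j ∈ Finset.range J, Real.exp (-(M/4) * j) *
          (if 1 - ((j:ℝ)+1)/l ≤ ((P χ).ρ i).re ∧ |((P χ).ρ i).im - t0| ≤ 1/8 then (1:ℝ) else 0) := by
        refine Finset.sum_le_sum fun χ _ => ?_
        refine (Finset.sum_le_sum (hpt χ)).trans ?_
        refine Finset.sum_le_univ_sum_of_nonneg fun i => ?_
        refine mul_nonneg (Real.exp_pos _).le (Finset.sum_nonneg fun j _ => ?_)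
        exact mul_nonneg (Real.exp_pos _).le (by split_ifs <;> norm_num)
    _ = Real.exp (-(c*M/4)) * ∑ j ∈ Finset.range J, Real.exp (-(M/4) * j) *
        ∑ χ : {χ : DirichletCharacter ℂ p // χ ≠ 1}, ∑ i,
          (if 1 - ((j:ℝ)+1)/l ≤ ((P χ).ρ i).re ∧ |((P χ).ρ i).im - t0| ≤ 1/8 then (1:ℝ) else 0) := by
        simp_rw [← Finset.mul_sum]
        congr 1
        simp_rw [Finset.mul_sum]
        rw [Finset.sum_comm]
        refine Finset.sum_congr rfl fun χ _ => ?_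
        rw [Finset.sum_comm]
    _ ≤ Real.exp (-(c*M/4)) * ∑ j ∈ Finset.range J, Real.exp (-(M/4) * j) *
        (C7 * Real.exp (C7 * ((j:ℝ)+1))) := by
        gcongr with j hj
        exact hcount j hj
    _ = Real.exp (-(c*M/4)) * (C7 * Real.exp C7 * ∑ j ∈ Finset.range J, Real.exp ((C7 - M/4) * j)) := by
        congr 1
        rw [Finset.mul_sum]
        refine Finset.sum_congr rfl fun j _ => ?_
        rw [show (C7 - M/4) * j = -(M/4)*j + C7 * j by ring, Real.exp_add, mul_add, Real.exp_add]
        ring_nf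
    _ ≤ Real.exp (-(c*M/4)) * (C7 * Real.exp C7 * 2) := by
        gcongr
        exact geom_exp J (by linarith)
    _ ≤ _ := by
        rw [mul_comm]
        gcongr
        refine le_trans (le_of_eq ?_) (le_max_right _ _)
        ring

end PAP


/-! Part 12 -/

namespace PAP
open Complex Metric ArithmeticFunction

lemma card_chi_le (p : ℕ) [NeZero p] :
    (Fintype.card {χ : DirichletCharacter ℂ p // χ ≠ 1} : ℝ) ≤ p := by
  have h1 : Fintype.card {χ : DirichletCharacter ℂ p // χ ≠ 1} ≤ Fintype.card (DirichletCharacter ℂ p) :=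
    Fintype.card_subtype_le _
  have h2 : Fintype.card (DirichletCharacter ℂ p) = p.totient := by
    rw [← Nat.card_eq_fintype_card]
    exact DirichletCharacter.card_eq_totient_of_hasEnoughRootsOfUnity ℂ p
  have h3 := Nat.totient_le p
  exact_mod_cast (h1.trans (h2.le.trans h3))

lemma far_zero {β γ t t0 r : ℝ} (hr0 : 1/40 ≤ r) (hr1 : r ≤ 1/20) (hβ : β < 1)
    (ht : |t - t0| ≤ 1/16) (h : ¬ (1 - 1/40000 ≤ β ∧ |γ - t0| ≤ 1/8)) :
    r^2 / ((r+1-β)^2 + (t-γ)^2) ≤ (2000/2001)^2 := by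
  have hA : r ≤ r + 1 - β := by linarith
  rw [div_le_iff₀ (by nlinarith [sq_nonneg (t-γ)])]
  by_cases h1 : 1 - 1/40000 ≤ β
  · have h2 : 1/8 < |γ - t0| := by
      by_contra h3
      exact h ⟨h1, not_lt.1 h3⟩
    have h4 : 1/16 ≤ |t - γ| := by
      have : |γ - t0| ≤ |t - γ| + |t - t0| := by
        rw [abs_sub_comm t γ]; exact abs_sub_le _ _ _
      linarith
    have h5 : 1/256 ≤ (t-γ)^2 := by
      rw [← sq_abs]; nlinarith
    nlinarith
  · have h6 : r + 1/40000 ≤ r + 1 - β := by linarith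
    have h7 : r * 2001 / 2000 ≤ r + 1 - β := by nlinarith
    have h8 : (r * 2001 / 2000)^2 ≤ (r+1-β)^2 := pow_le_pow_left₀ (by positivity) h7 2
    nlinarith [sq_nonneg (t-γ)]

lemma norm_zero_term {ρ : ℂ} {r t : ℝ} (κ : ℕ) (hr : 0 < r) :
    r^(2*κ) * ‖((1+r+t*I - ρ)⁻¹)^(2*κ)‖ = (r^2/((r+1-ρ.re)^2 + (t-ρ.im)^2))^κ := by
  rw [norm_pow, norm_inv, pow_mul, pow_mul, ← mul_pow]
  congr 1
  have : ‖(1+r+t*I - ρ : ℂ)‖^2 = (r+1-ρ.re)^2 + (t-ρ.im)^2 := by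
    rw [Complex.sq_norm, Complex.normSq_apply]; simp; ring
  rw [inv_pow, this]; rfl

lemma piece_pt {p : ℕ} [NeZero p] {χ : DirichletCharacter ℂ p} (hχ : χ ≠ 1) {t0 : ℝ}
    (P : PFData χ t0) (κ k : ℕ) (hk : k + 1 = 2*κ) {r t : ℝ} (hr0 : 1/40 ≤ r) (hr1 : r ≤ 1/20)
    (ht : |t-t0| ≤ 1/16) :
    r^(2*κ) * ‖DD χ k (1+r+t*I)‖ ≤
      (∑ i ∈ (Finset.univ.filter (fun i => 1 - 1/40000 ≤ (P.ρ i).re ∧ |(P.ρ i).im - t0| ≤ 1/8)),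
        (r^2/((r+1-(P.ρ i).re)^2 + (t-(P.ρ i).im)^2))^κ)
      + 2228 * ell p t0 * ((2000/2001)^2)^κ := by
  have hr : 0 < r := by linarith
  have hA := lemmaA hχ P k (η := r) (t := t) hr (by linarith) (by linarith)
  rw [hk] at hA
  have hell : 0 ≤ ell p t0 := by
    have := P.n_le
    have h2 : (0:ℝ) ≤ P.n := by positivity
    linarith
  have h1 : ‖DD χ k (1+r+t*I)‖ ≤ ∑ i, ‖((1+r+t*I - P.ρ i)⁻¹)^(2*κ)‖ + 2200 * ell p t0 * 8^k := by
    have e : DD χ k (1+r+t*I) = (DD χ k (1+r+t*I) + ∑ i, ((1+r+t*I - P.ρ i)⁻¹)^(2*κ))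
      - ∑ i, ((1+r+t*I - P.ρ i)⁻¹)^(2*κ) := by ring
    rw [e]
    refine (norm_sub_le _ _).trans ?_
    have := norm_sum_le Finset.univ (fun i => ((1+r+t*I - P.ρ i)⁻¹)^(2*κ))
    linarith
  have h2 : r^(2*κ) * 8^k ≤ ((2000/2001)^2:ℝ)^κ := by
    have h8 : (8:ℝ)^k ≤ 8^(2*κ) := pow_le_pow_right₀ (by norm_num) (by omega)
    calc r^(2*κ) * 8^k ≤ r^(2*κ) * 8^(2*κ) := by gcongr
      _ = (r*8)^(2*κ) := by rw [mul_pow]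
      _ ≤ (2000/2001)^(2*κ) := by
        refine pow_le_pow_left₀ (by positivity) (by linarith) _
      _ = _ := by rw [pow_mul]
  have h3 : ∑ i, (r^2/((r+1-(P.ρ i).re)^2 + (t-(P.ρ i).im)^2))^κ ≤
      (∑ i ∈ (Finset.univ.filter (fun i => 1 - 1/40000 ≤ (P.ρ i).re ∧ |(P.ρ i).im - t0| ≤ 1/8)),
        (r^2/((r+1-(P.ρ i).re)^2 + (t-(P.ρ i).im)^2))^κ) + (P.n:ℝ) * (((2000/2001)^2:ℝ))^κ := by
    rw [← Finset.sum_filter_add_sum_filter_not Finset.univ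
      (fun i => 1 - 1/40000 ≤ (P.ρ i).re ∧ |(P.ρ i).im - t0| ≤ 1/8)]
    gcongr
    refine (Finset.sum_le_card_nsmul _ _ ((((2000/2001)^2:ℝ))^κ) ?_).trans ?_
    · intro i hi
      have hi2 := (Finset.mem_filter.1 hi).2
      refine pow_le_pow_left₀ (by positivity) (far_zero hr0 hr1 (PFData.re_lt hχ P i) ht hi2) _
    · rw [nsmul_eq_mul]
      gcongr
      refine (Finset.card_le_univ _).trans (by simp)
  calc _ ≤ r^(2*κ) * (∑ i, ‖((1+r+t*I - P.ρ i)⁻¹)^(2*κ)‖ + 2200 * ell p t0 * 8^k) := by gcongr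
    _ = ∑ i, (r^2/((r+1-(P.ρ i).re)^2 + (t-(P.ρ i).im)^2))^κ + 2200 * ell p t0 * (r^(2*κ) * 8^k) := by
      rw [mul_add, Finset.mul_sum]
      congr 1
      · exact Finset.sum_congr rfl fun i _ => norm_zero_term κ hr
      · ring
    _ ≤ _ := by
      have hn := P.n_le
      have hq : (0:ℝ) ≤ ((2000/2001)^2:ℝ)^κ := by positivity
      have h5 : 2200 * ell p t0 * (r^(2*κ) * 8^k) ≤ 2200 * ell p t0 * ((2000/2001)^2:ℝ)^κ := by gcongr
      have h6 : (P.n:ℝ) * ((2000/2001)^2:ℝ)^κ ≤ 28 * ell p t0 * ((2000/2001)^2:ℝ)^κ := by gcongr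
      linarith

lemma q0_exp (κ : ℕ) {U : ℝ} (hU : U ≤ 80 * κ) :
    (((2000/2001)^2:ℝ))^κ ≤ Real.exp (-(U/100000)) := by
  have h : (2000/2001:ℝ) ≤ Real.exp (-(1/2001)) := by
    have := Real.add_one_le_exp (-(1/2001:ℝ)); linarith
  calc (((2000/2001)^2:ℝ))^κ ≤ ((Real.exp (-(1/2001)))^2)^κ := by gcongr
    _ = Real.exp (-(2*κ/2001)) := by
      rw [← Real.exp_nat_mul, ← Real.exp_nat_mul]; congr 1; push_cast; ring
    _ ≤ _ := by
      rw [Real.exp_le_exp]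
      have : (0:ℝ) ≤ κ := by positivity
      linarith

lemma piece_bound : ∃ C8 : ℝ, 1 ≤ C8 ∧ ∀ (p : ℕ) [NeZero p], p.Prime → ∀ c : ℝ, 0 < c → c ≤ 1 →
    ¬ Bad c p → ∀ L U r : ℝ, ∀ κ k : ℕ, C8 ≤ L → 200000 ≤ Real.log p → L * Real.log p ≤ U → U ≤ p →
    1 ≤ κ → (κ:ℝ) ≤ U → U ≤ 80 * κ → k + 1 = 2*κ → 1/40 ≤ r → r ≤ 1/20 → r * U ≤ 2*κ →
    ∀ t0 : ℝ, |t0| ≤ (p:ℝ)^3 →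
    ∫ t in (t0-1/16)..(t0+1/16), ∑ χ : {χ : DirichletCharacter ℂ p // χ ≠ 1},
      r^(2*κ) * ‖DD χ.1 k (1+r+t*I)‖ ≤ C8 * Real.exp (-(c*L/4)) / √κ := by
  obtain ⟨C9, h9, hzs⟩ := zero_sum
  refine ⟨max (4*C9+1) 1000000, le_max_of_le_right (by norm_num), ?_⟩
  intro p _ hp c hc hc1 hbad L U r κ k hL hl hLU hUp hκ1 hκU hUκ hk hr0 hr1 hrU t0 ht0
  have hL1 : 4*C9+1 ≤ L := (le_max_left _ _).trans hL
  have hL2 : 1000000 ≤ L := (le_max_right _ _).trans hL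
  have hr : 0 < r := by linarith
  have hp2 : 2 ≤ p := hp.two_le
  have P : ∀ χ : {χ : DirichletCharacter ℂ p // χ ≠ 1}, PFData χ.1 t0 :=
    fun χ => (exists_PFData χ.2 t0 hp2).some
  set l := Real.log p with hld
  have hl0 : 0 < l := by linarith
  have hU0 : 0 < U := by nlinarith
  have hz := hzs p hp c hc hbad (U/l) (by rw [le_div_iff₀ hl0]; nlinarith) (by linarith) t0 ht0 P
  have hκ0 : (0:ℝ) < κ := by exact_mod_cast hκ1
  have hell := ell_le hp ht0
  set S : {χ : DirichletCharacter ℂ p // χ ≠ 1} → ℝ → ℝ := fun χ t =>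
    ∑ i ∈ (Finset.univ.filter (fun i => 1 - 1/40000 ≤ ((P χ).ρ i).re ∧ |((P χ).ρ i).im - t0| ≤ 1/8)),
        (r^2/((r+1-((P χ).ρ i).re)^2 + (t-((P χ).ρ i).im)^2))^κ with hS
  have hden : ∀ χ i (t:ℝ), (0:ℝ) < (r+1-((P χ).ρ i).re)^2 + (t-((P χ).ρ i).im)^2 := by
    intro χ i t
    have := PFData.re_lt χ.2 (P χ) i
    have : 0 < r+1-((P χ).ρ i).re := by linarith
    positivity
  have hcont : ∀ χ i, Continuous (fun t : ℝ => (r^2/((r+1-((P χ).ρ i).re)^2 + (t-((P χ).ρ i).im)^2))^κ) := by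
    intro χ i
    refine Continuous.pow (Continuous.div continuous_const (by fun_prop) (fun t => (hden χ i t).ne')) _
  have hScont : ∀ χ, Continuous (S χ) := fun χ => continuous_finsetSum _ fun i _ => hcont χ i
  set J : ℝ := (p:ℝ) * (2228 * (5*l) * Real.exp (-(U/100000))) with hJ
  have hmono : ∫ t in (t0-1/16)..(t0+1/16), ∑ χ : {χ : DirichletCharacter ℂ p // χ ≠ 1},
      r^(2*κ) * ‖DD χ.1 k (1+r+t*I)‖ ≤ ∫ t in (t0-1/16)..(t0+1/16), (∑ χ, S χ t + J) := by
    refine intervalIntegral.integral_mono_on (by linarith) ?_ ?_ ?_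
    · refine Continuous.intervalIntegrable ?_ _ _
      refine continuous_finsetSum _ fun χ _ => ?_
      exact continuous_const.mul (DD_cont χ.1 k hr).norm
    · refine Continuous.intervalIntegrable ?_ _ _
      exact (continuous_finsetSum _ fun χ _ => hScont χ).add continuous_const
    · intro t ht
      have ht' : |t - t0| ≤ 1/16 := by rw [abs_le]; constructor <;> linarith [ht.1, ht.2]
      have hb : ∀ χ : {χ : DirichletCharacter ℂ p // χ ≠ 1}, r^(2*κ) * ‖DD χ.1 k (1+r+t*I)‖ ≤
          S χ t + 2228 * (5*l) * Real.exp (-(U/100000)) := by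
        intro χ
        refine (piece_pt χ.2 (P χ) κ k hk hr0 hr1 ht').trans ?_
        have hq := q0_exp κ hUκ
        have hell0 : 0 ≤ 5 * l := by positivity
        simp only [hS]
        refine add_le_add le_rfl ?_
        refine mul_le_mul ?_ hq (by positivity) (by positivity)
        linarith
      refine (Finset.sum_le_sum fun χ _ => hb χ).trans ?_
      rw [Finset.sum_add_distrib, Finset.sum_const, nsmul_eq_mul, hJ]
      refine add_le_add le_rfl (mul_le_mul_of_nonneg_right ?_ (by positivity))
      rw [Finset.card_univ]; exact card_chi_le p
  refine hmono.trans ?_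
  rw [intervalIntegral.integral_add (((continuous_finsetSum _ fun χ _ => hScont χ)).intervalIntegrable _ _)
    (continuous_const.intervalIntegrable _ _), intervalIntegral.integral_const,
    intervalIntegral.integral_finsetSum fun χ _ => (hScont χ).intervalIntegrable _ _]
  have hinteg : ∀ χ, ∫ t in (t0-1/16)..(t0+1/16), S χ t ≤
      (∑ i ∈ (Finset.univ.filter (fun i => 1 - 1/40000 ≤ ((P χ).ρ i).re ∧ |((P χ).ρ i).im - t0| ≤ 1/8)),
        Real.exp (-(U/l * ((1 - ((P χ).ρ i).re) * l)/2))) * (4/√κ) := by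
    intro χ
    simp only [hS]
    rw [intervalIntegral.integral_finsetSum fun i _ => (hcont χ i).intervalIntegrable _ _, Finset.sum_mul]
    refine Finset.sum_le_sum fun i hi => ?_
    obtain ⟨hi1, hi2⟩ := (Finset.mem_filter.1 hi).2
    have hlt := PFData.re_lt χ.2 (P χ) i
    refine (int_zero κ hκ1 (by linarith) hr (by linarith)).trans ?_
    have hw := zero_weight (κ := κ) (r := r) (U := U) (d := 1 - ((P χ).ρ i).re) hU0 hr hrU
      (by linarith) (by linarith)
    have e : U/l * ((1 - ((P χ).ρ i).re) * l)/2 = U * (1 - ((P χ).ρ i).re)/2 := by field_simp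
    rw [e]
    have e2 : r + (1 - ((P χ).ρ i).re) = r + 1 - ((P χ).ρ i).re := by ring
    rw [e2] at hw
    refine mul_le_mul hw ?_ (by have : 0 < r + 1 - ((P χ).ρ i).re := by linarith
                                positivity) (Real.exp_pos _).le
    gcongr
    have := Real.pi_lt_four
    have := Real.pi_pos
    nlinarith
  have h1 : ∑ χ, ∫ t in (t0-1/16)..(t0+1/16), S χ t ≤ C9 * Real.exp (-(c*L/4)) * (4/√κ) := by
    refine (Finset.sum_le_sum fun χ _ => hinteg χ).trans ?_
    rw [← Finset.sum_mul]
    gcongr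
    refine hz.trans ?_
    gcongr
    rw [le_div_iff₀ hl0]; exact hLU
  have h2 : J ≤ Real.exp (-(c*L/4)) / √κ := by
    have hsq : √(κ:ℝ) ≤ p := by
      have h3 : (1:ℝ) ≤ κ := by exact_mod_cast hκ1
      have : √(κ:ℝ) ≤ κ := by
        rw [Real.sqrt_le_left (by positivity)]; nlinarith
      linarith
    have hpe : (p:ℝ) = Real.exp l := by rw [hld, Real.exp_log]; positivity
    have hlp : l ≤ p := by rw [hpe]; linarith [Real.add_one_le_exp l]
    have hcp : 11140 ≤ (p:ℝ) := by linarith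
    rw [le_div_iff₀ (by positivity)]
    have hpos := Real.exp_pos (-(U/100000))
    calc J * √κ = 11140 * l * p * √κ * Real.exp (-(U/100000)) := by rw [hJ]; ring
      _ ≤ p * p * p * p * Real.exp (-(U/100000)) := by gcongr
      _ = Real.exp (4 * l - U/100000) := by
        rw [hpe, ← Real.exp_add, ← Real.exp_add, ← Real.exp_add, ← Real.exp_add]; congr 1; ring
      _ ≤ _ := by
        rw [Real.exp_le_exp]
        have : c * L ≤ L := by nlinarith
        have h5 : L * 200000 ≤ L * l := by gcongr
        have h6 : 1000000 * l ≤ L * l := by gcongr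
        linarith
  have hexp := Real.exp_pos (-(c*L/4))
  have hsk : 0 < √(κ:ℝ) := by positivity
  have e9 : (t0+1/16 - (t0-1/16)) = 1/8 := by ring
  rw [e9, smul_eq_mul]
  have hJ0 : 0 ≤ J := by positivity
  have e3 : C9 * Real.exp (-(c*L/4)) * (4/√κ) = 4 * C9 * (Real.exp (-(c*L/4))/√κ) := by ring
  calc _ ≤ (4*C9+1) * (Real.exp (-(c*L/4))/√κ) := by rw [e3] at h1; linarith
    _ ≤ max (4*C9+1) 1000000 * (Real.exp (-(c*L/4))/√κ) := by
      gcongr; exact le_max_left _ _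
    _ = _ := by ring
end PAP


/-! Part 13 -/

namespace PAP
open Complex MeasureTheory

/-- The Gaussian kernel. -/
noncomputable def Gk (b x : ℝ) : ℝ := (1/(2*π)) * √(π/b) * Real.exp (-(1/(4*b)) * x^2)

lemma Gk_nonneg (b x : ℝ) : 0 ≤ Gk b x := by unfold Gk; positivity

lemma Gk_cont (b : ℝ) : Continuous (Gk b) := by unfold Gk; fun_prop

lemma Gk_integrable {b : ℝ} (hb : 0 < b) : Integrable (Gk b) := by
  unfold Gk
  exact (integrable_exp_neg_mul_sq (by positivity : 0 < 1/(4*b))).const_mul _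

lemma Gk_integral {b : ℝ} (hb : 0 < b) : ∫ x, Gk b x = 1 := by
  unfold Gk
  rw [integral_const_mul, integral_gaussian]
  have e : π / (1/(4*b)) = (2*π)^2 * (b/π) := by field_simp; norm_num
  rw [e, Real.sqrt_mul (by positivity), Real.sqrt_sq (by positivity)]
  have h2 : √(π/b) * √(b/π) = 1 := by
    rw [← Real.sqrt_mul (by positivity)]
    have : π/b*(b/π) = 1 := by field_simp
    rw [this, Real.sqrt_one]
  have hp := Real.pi_pos
  field_simp
  linear_combination h2

lemma Gk_tail {b δ x : ℝ} (hb : 0 < b) (hδ : 0 ≤ δ) (hx : δ ≤ |x|) :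
    Gk b x ≤ 2 * Real.exp (-(δ^2/(8*b))) * Gk (2*b) x := by
  unfold Gk
  have h1 : Real.exp (-(1/(4*b)) * x^2) ≤ Real.exp (-(δ^2/(8*b))) * Real.exp (-(1/(4*(2*b)))*x^2) := by
    rw [← Real.exp_add, Real.exp_le_exp]
    have h2 : δ^2 ≤ x^2 := by rw [← sq_abs x]; gcongr
    have e : -(δ^2/(8*b)) + -(1/(4*(2*b)))*x^2 - -(1/(4*b)) * x^2 = (x^2 - δ^2)/(8*b) := by
      field_simp; ring
    have : 0 ≤ (x^2 - δ^2)/(8*b) := div_nonneg (by linarith) (by positivity)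
    linarith
  have h3 : √(π/b) ≤ 2 * √(π/(2*b)) := by
    rw [show (2:ℝ) = √4 by rw [show (4:ℝ) = 2^2 by norm_num]; simp, ← Real.sqrt_mul (by norm_num)]
    apply Real.sqrt_le_sqrt
    rw [show √4 = (2:ℝ) by rw [show (4:ℝ) = 2^2 by norm_num]; simp]
    have e : 4 * (π/(2*b)) = 2 * (π/b) := by field_simp; norm_num
    have : 0 ≤ π/b := by positivity
    linarith
  calc _ ≤ (1/(2*π)) * (2 * √(π/(2*b))) * (Real.exp (-(δ^2/(8*b))) * Real.exp (-(1/(4*(2*b)))*x^2)) := by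
        gcongr
    _ = _ := by ring

/-- The smoothed indicator of `(x,y]`. -/
noncomputable def hh (b x y v : ℝ) : ℝ := ∫ u in x..y, Gk b (u - v)

lemma Gk_sub_integrable {b : ℝ} (hb : 0 < b) (v : ℝ) : Integrable (fun u => Gk b (u - v)) :=
  (Gk_integrable hb).comp_sub_right v

lemma Gk_sub_integral {b : ℝ} (hb : 0 < b) (v : ℝ) : ∫ u, Gk b (u - v) = 1 := by
  rw [integral_sub_right_eq_self (Gk b) v, Gk_integral hb]

lemma hh_nonneg {b x y v : ℝ} (hxy : x ≤ y) : 0 ≤ hh b x y v :=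
  intervalIntegral.integral_nonneg hxy fun _ _ => Gk_nonneg _ _

lemma hh_le_one {b x y v : ℝ} (hb : 0 < b) (hxy : x ≤ y) : hh b x y v ≤ 1 := by
  unfold hh
  rw [intervalIntegral.integral_of_le hxy, ← Gk_sub_integral hb v]
  exact setIntegral_le_integral (Gk_sub_integrable hb v) (Eventually.of_forall fun _ => Gk_nonneg _ _)

lemma set_small {b δ v : ℝ} (hb : 0 < b) (hδ : 0 ≤ δ) {S : Set ℝ} (hS : MeasurableSet S)
    (h : ∀ u ∈ S, δ ≤ |u - v|) :
    ∫ u in S, Gk b (u - v) ≤ 2 * Real.exp (-(δ^2/(8*b))) := by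
  have hb2 : 0 < 2 * b := by linarith
  calc _ ≤ ∫ u in S, 2 * Real.exp (-(δ^2/(8*b))) * Gk (2*b) (u - v) := by
        refine setIntegral_mono_on (Gk_sub_integrable hb v).integrableOn
          ((Gk_sub_integrable hb2 v).const_mul _).integrableOn hS fun u hu => Gk_tail hb hδ (h u hu)
    _ ≤ ∫ u, 2 * Real.exp (-(δ^2/(8*b))) * Gk (2*b) (u - v) :=
        setIntegral_le_integral ((Gk_sub_integrable hb2 v).const_mul _)
          (Eventually.of_forall fun _ => mul_nonneg (by positivity) (Gk_nonneg _ _))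
    _ = _ := by rw [integral_const_mul, Gk_sub_integral hb2, mul_one]

lemma hh_approx {b δ x y v : ℝ} (hb : 0 < b) (hδ : 0 ≤ δ) (hxy : x ≤ y)
    (h1 : δ ≤ |v - x|) (h2 : δ ≤ |v - y|) :
    |hh b x y v - (if x < v ∧ v ≤ y then 1 else 0)| ≤ 2 * Real.exp (-(δ^2/(8*b))) := by
  split_ifs with h
  · obtain ⟨h3, h4⟩ := h
    rw [abs_of_pos (by linarith)] at h1
    rw [abs_of_nonpos (by linarith)] at h2
    have hle := hh_le_one (v := v) hb hxy
    rw [abs_of_nonpos (by linarith)]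
    have e : (∫ u in Set.Ioc x y, Gk b (u-v)) + ∫ u in (Set.Ioc x y)ᶜ, Gk b (u - v) = 1 := by
      rw [integral_add_compl measurableSet_Ioc (Gk_sub_integrable hb v), Gk_sub_integral hb]
    have e2 : hh b x y v = ∫ u in Set.Ioc x y, Gk b (u-v) := by
      unfold hh; rw [intervalIntegral.integral_of_le hxy]
    have h5 := set_small (v := v) hb hδ (S := (Set.Ioc x y)ᶜ) measurableSet_Ioc.compl (by
      intro u hu
      simp only [Set.mem_compl_iff, Set.mem_Ioc, not_and_or, not_lt, not_le] at hu
      rcases hu with hu | hu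
      · rw [abs_of_nonpos (by linarith)]; linarith
      · rw [abs_of_nonneg (by linarith)]; linarith)
    linarith
  · rw [sub_zero, abs_of_nonneg (hh_nonneg hxy)]
    unfold hh
    rw [intervalIntegral.integral_of_le hxy]
    refine set_small hb hδ measurableSet_Ioc ?_
    rintro u ⟨hu1, hu2⟩
    rw [not_and_or, not_lt, not_le] at h
    rcases h with h | h
    · rw [abs_of_nonpos (by linarith)] at h1
      rw [abs_of_nonneg (by linarith)]; linarith
    · rw [abs_of_pos (by linarith)] at h2
      rw [abs_of_nonpos (by linarith)]; linarith

/-- Fourier weight of the smoothed indicator. -/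
noncomputable def HH (b x y t : ℝ) : ℂ :=
  (1/(2*π) : ℝ) * (Real.exp (-b*t^2) : ℝ) * ∫ u in x..y, cexp (I*t*u)

lemma HH_four {b : ℝ} (hb : 0 < b) (x y v : ℝ) :
    ∫ t : ℝ, HH b x y t * cexp (-(I*t*v)) = (hh b x y v : ℂ) := by
  have e1 : ∀ t : ℝ, HH b x y t * cexp (-(I*t*v)) =
      ∫ u in x..y, (1/(2*π) : ℝ) * (cexp (I*(u-v : ℝ)*t) * cexp (-(b:ℂ)*t^2)) := by
    intro t
    unfold HH
    rw [← intervalIntegral.integral_const_mul, ← intervalIntegral.integral_mul_const]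
    refine intervalIntegral.integral_congr fun u _ => ?_
    have e : cexp (I*(u-v : ℝ)*t) = cexp (I*t*u) * cexp (-(I*t*v)) := by
      rw [← Complex.exp_add]; congr 1; push_cast; ring
    simp only [e]
    push_cast
    ring
  simp_rw [e1]
  rw [← intervalIntegral_integral_swap]
  · have e2 : ∀ u : ℝ, ∫ t : ℝ, (1/(2*π) : ℝ) * (cexp (I*(u-v : ℝ)*t) * cexp (-(b:ℂ)*t^2))
        = (Gk b (u - v) : ℂ) := by
      intro u
      have h1 := fourierIntegral_gaussian (b := (b:ℂ)) (by simpa using hb) ((u-v : ℝ) : ℂ)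
      have e3 : ((π:ℂ)/b)^(1/2:ℂ) = ((√(π/b) : ℝ) : ℂ) := by
        rw [Real.sqrt_eq_rpow, Complex.ofReal_cpow (by positivity)]
        push_cast; rfl
      rw [integral_const_mul, h1, e3]
      unfold Gk
      push_cast
      rw [mul_assoc]
      congr 3
      field_simp
    simp_rw [e2]
    unfold hh
    exact intervalIntegral.integral_ofReal
  · have : IsFiniteMeasure (volume.restrict (Set.uIoc x y)) :=
      inferInstanceAs (IsFiniteMeasure (volume.restrict (Set.Ioc (min x y) (max x y))))
    have hI : Integrable (fun z : ℝ × ℝ => (1:ℝ) * Real.exp (-b*z.2^2))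
        ((volume.restrict (Set.uIoc x y)).prod volume) :=
      Integrable.mul_prod (f := fun _ : ℝ => (1:ℝ)) (g := fun t : ℝ => Real.exp (-b*t^2)) (integrable_const _)
        (integrable_exp_neg_mul_sq hb)
    refine (hI.const_mul (1/(2*π))).mono' ?_ (Eventually.of_forall ?_)
    · refine Continuous.aestronglyMeasurable ?_
      simp only [Function.uncurry_def]
      fun_prop
    · rintro ⟨u, t⟩
      simp only [Function.uncurry_apply_pair]
      rw [norm_mul, norm_mul, Complex.norm_exp, Complex.norm_exp, Complex.norm_real,
        Real.norm_of_nonneg (by positivity)]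
      refine le_of_eq ?_
      congr 2
      · simp
      · congr 1
        rw [← Complex.ofReal_neg, ← Complex.ofReal_pow, ← Complex.ofReal_mul, Complex.ofReal_re]

lemma HH_norm {b x y t : ℝ} (hxy : x ≤ y) :
    ‖HH b x y t‖ ≤ (y - x + 1) * (2/(1+|t|)) * Real.exp (-b*t^2) := by
  unfold HH
  rw [norm_mul, norm_mul, Complex.norm_real, Complex.norm_real, Real.norm_of_nonneg (by positivity),
    Real.norm_of_nonneg (by positivity)]
  have hpi : 1/(2*π) ≤ 1/2 := by
    have := Real.pi_gt_three
    apply one_div_le_one_div_of_le <;> linarith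
  have hN : ‖∫ u in x..y, cexp (I*t*u)‖ ≤ (y-x+1) * (4/(1+|t|)) := by
    have h1 : ‖∫ u in x..y, cexp (I*t*u)‖ ≤ y - x := by
      have := intervalIntegral.norm_integral_le_of_norm_le_const (a := x) (b := y) (C := 1)
        (f := fun u : ℝ => cexp (I*t*u)) (fun u _ => by rw [Complex.norm_exp]; simp)
      rwa [one_mul, abs_of_nonneg (by linarith)] at this
    by_cases ht : |t| ≤ 1
    · refine h1.trans ?_
      have : (1:ℝ) ≤ 4/(1+|t|) := by
        rw [le_div_iff₀ (by positivity)]; linarith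
      nlinarith
    · rw [not_le] at ht
      have ht0 : t ≠ 0 := by rintro rfl; simp at ht; linarith
      have hc : (I*t:ℂ) ≠ 0 := mul_ne_zero I_ne_zero (by exact_mod_cast ht0)
      rw [integral_exp_mul_complex hc, norm_div]
      have h3 : ‖(I*t:ℂ)‖ = |t| := by simp
      rw [h3]
      have h4 : ‖cexp (I*t*y) - cexp (I*t*x)‖ ≤ 2 := by
        refine (norm_sub_le _ _).trans ?_
        rw [Complex.norm_exp, Complex.norm_exp]; simp; norm_num
      calc _ ≤ 2/|t| := by gcongr
        _ ≤ 4/(1+|t|) := by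
          rw [div_le_div_iff₀ (by linarith) (by positivity)]; linarith
        _ ≤ _ := by
          have : (0:ℝ) ≤ 4/(1+|t|) := by positivity
          nlinarith
  calc _ ≤ 1/2 * Real.exp (-b*t^2) * ((y-x+1) * (4/(1+|t|))) := by gcongr
    _ = _ := by ring

lemma HH_cont (b x y : ℝ) : Continuous (HH b x y) := by
  unfold HH
  refine Continuous.mul (by fun_prop) ?_
  refine intervalIntegral.continuous_parametric_intervalIntegral_of_continuous' (by fun_prop) _ _
end PAP


/-! Part 14 -/

namespace PAP
open Complex MeasureTheory

lemma HH_integrable {b x y : ℝ} (hb : 0 < b) (hxy : x ≤ y) : Integrable (HH b x y) := by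
  refine ((integrable_exp_neg_mul_sq hb).const_mul ((y-x+1)*2)).mono'
    (HH_cont b x y).aestronglyMeasurable (Eventually.of_forall fun t => ?_)
  refine (HH_norm hxy).trans ?_
  have h1 : 2/(1+|t|) ≤ 2 := by
    rw [div_le_iff₀ (by positivity)]; linarith [abs_nonneg t]
  have : 0 ≤ y - x + 1 := by linarith
  gcongr

lemma four_sum {b x y : ℝ} (hb : 0 < b) (hxy : x ≤ y) {w : ℕ → ℂ} {lam : ℕ → ℝ} {F : ℝ → ℂ}
    (hw : Summable (fun n => ‖w n‖)) (hF : ∀ t : ℝ, HasSum (fun n => w n * cexp (-(I*t*lam n))) (F t)) :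
    HasSum (fun n => w n * (hh b x y (lam n) : ℂ)) (∫ t, HH b x y t * F t) := by
  have hnorm : ∀ n (t:ℝ), ‖HH b x y t * (w n * cexp (-(I*t*lam n)))‖ = ‖w n‖ * ‖HH b x y t‖ := by
    intro n t
    rw [norm_mul, norm_mul, Complex.norm_exp]
    simp [mul_comm]
  have hHI := HH_integrable hb hxy
  have h := hasSum_integral_of_summable_integral_norm (μ := volume)
    (F := fun (n:ℕ) (t:ℝ) => HH b x y t * (w n * cexp (-(I*t*lam n)))) ?_ ?_
  · have e1 : (fun n => w n * (hh b x y (lam n) : ℂ)) =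
        fun n => ∫ t : ℝ, HH b x y t * (w n * cexp (-(I*t*lam n))) := by
      funext n
      rw [← HH_four hb, ← integral_const_mul]
      congr 1
      funext t
      ring
    have e2 : (∫ t, HH b x y t * F t) = ∫ t : ℝ, ∑' n, HH b x y t * (w n * cexp (-(I*t*lam n))) := by
      congr 1
      funext t
      rw [tsum_mul_left, (hF t).tsum_eq]
    rw [e1, e2]
    exact h
  · intro n
    refine (hHI.norm.const_mul ‖w n‖).mono' ?_ (Eventually.of_forall fun t => (hnorm n t).le)
    refine Continuous.aestronglyMeasurable ?_
    exact (HH_cont b x y).mul (by fun_prop)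
  · simp_rw [hnorm, integral_const_mul]
    exact hw.mul_right _

lemma grid_half {f : ℝ → ℝ} (hf : Continuous f) (hf0 : ∀ t, 0 ≤ f t) {B T σ : ℝ} (hσ : 0 < σ)
    (hB : ∀ t0 : ℝ, |t0| ≤ T → ∫ t in (t0-1/16)..(t0+1/16), f t ≤ B) :
    ∀ J : ℕ, (J:ℝ)/8 ≤ T → ∫ t in (0:ℝ)..(J:ℝ)/8, (1+|t|)^(-(1+σ)) * f t ≤
      ∑ j ∈ Finset.range J, B * (1+(j:ℝ)/8)^(-(1+σ)) := by
  have hcont : Continuous (fun t : ℝ => (1+|t|)^(-(1+σ)) * f t) := by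
    refine Continuous.mul ?_ hf
    refine Continuous.rpow_const (by fun_prop) (fun t => Or.inl (by positivity))
  intro J
  induction J with
  | zero => intro _; simp
  | succ J ih =>
    intro hJ
    push_cast at hJ ⊢
    have hJ0 : (0:ℝ) ≤ J := by positivity
    rw [Finset.sum_range_succ, ← intervalIntegral.integral_add_adjacent_intervals
      (hcont.intervalIntegrable 0 ((J:ℝ)/8)) (hcont.intervalIntegrable ((J:ℝ)/8) (((J:ℝ)+1)/8))]
    refine add_le_add (ih (by linarith)) ?_
    have h1 := hB ((J:ℝ)/8+1/16) (by rw [abs_of_nonneg (by positivity)]; linarith)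
    have e1 : (J:ℝ)/8+1/16-1/16 = (J:ℝ)/8 := by ring
    have e2 : (J:ℝ)/8+1/16+1/16 = ((J:ℝ)+1)/8 := by ring
    rw [e1, e2] at h1
    calc _ ≤ ∫ t in (J:ℝ)/8..((J:ℝ)+1)/8, (1+(J:ℝ)/8)^(-(1+σ)) * f t := by
          refine intervalIntegral.integral_mono_on (by linarith) (hcont.intervalIntegrable _ _)
            ((continuous_const.mul hf).intervalIntegrable _ _) fun t ht => ?_
          refine mul_le_mul_of_nonneg_right ?_ (hf0 t)
          refine Real.rpow_le_rpow_of_nonpos (by positivity) ?_ (by linarith)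
          linarith [le_abs_self t, ht.1]
      _ = (1+(J:ℝ)/8)^(-(1+σ)) * ∫ t in (J:ℝ)/8..((J:ℝ)+1)/8, f t := intervalIntegral.integral_const_mul _ _
      _ ≤ (1+(J:ℝ)/8)^(-(1+σ)) * B := by gcongr
      _ = _ := mul_comm _ _

lemma grid_summable {σ : ℝ} (hσ : 0 < σ) : Summable (fun j : ℕ => (1+(j:ℝ)/8)^(-(1+σ))) := by
  have h1 : Summable (fun j : ℕ => (((j+1:ℕ):ℝ))^(-(1+σ))) :=
    (summable_nat_add_iff 1).2 (Real.summable_nat_rpow.2 (by linarith))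
  refine Summable.of_nonneg_of_le (fun j => by positivity) (fun j => ?_) (h1.mul_left ((8:ℝ)^(1+σ)))
  have h2 : ((j+1:ℕ):ℝ)/8 ≤ 1 + (j:ℝ)/8 := by push_cast; linarith
  refine (Real.rpow_le_rpow_of_nonpos (by positivity) h2 (by linarith)).trans (le_of_eq ?_)
  rw [Real.div_rpow (by positivity) (by norm_num), Real.rpow_neg (by norm_num : (0:ℝ) ≤ 8), div_inv_eq_mul]
  ring

lemma grid_bound {σ : ℝ} (hσ : 0 < σ) : ∃ K : ℝ, 1 ≤ K ∧ ∀ f : ℝ → ℝ, Continuous f → (∀ t, 0 ≤ f t) →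
    ∀ (B : ℝ) (J : ℕ), (∀ t0 : ℝ, |t0| ≤ (J:ℝ)/8 → ∫ t in (t0-1/16)..(t0+1/16), f t ≤ B) →
    ∫ t in (-((J:ℝ)/8))..(J:ℝ)/8, (1+|t|)^(-(1+σ)) * f t ≤ K * B := by
  set S := ∑' j : ℕ, (1+(j:ℝ)/8)^(-(1+σ)) with hS
  have hS0 : 0 ≤ S := tsum_nonneg fun j => by positivity
  refine ⟨2*S+1, by linarith, fun f hf hf0 B J hB => ?_⟩
  have hB0 : 0 ≤ B := by
    refine le_trans ?_ (hB 0 (by simp; positivity))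
    exact intervalIntegral.integral_nonneg (by norm_num) fun t _ => hf0 t
  have hcont : Continuous (fun t : ℝ => (1+|t|)^(-(1+σ)) * f t) := by
    refine Continuous.mul ?_ hf
    refine Continuous.rpow_const (by fun_prop) (fun t => Or.inl (by positivity))
  have hsum : ∑ j ∈ Finset.range J, B * (1+(j:ℝ)/8)^(-(1+σ)) ≤ B * S := by
    rw [← Finset.mul_sum]
    gcongr
    exact (grid_summable hσ).sum_le_tsum _ fun j _ => by positivity
  have h1 := (grid_half hf hf0 hσ hB J le_rfl).trans hsum
  have h2 := (grid_half (f := fun t => f (-t)) (by fun_prop) (fun t => hf0 _) (B := B) (T := (J:ℝ)/8) hσ (by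
    intro t0 ht0
    have := hB (-t0) (by rwa [abs_neg])
    rw [intervalIntegral.integral_comp_neg (fun t => f t)]
    convert this using 2 <;> ring) J le_rfl).trans hsum
  have h3 : ∫ t in (-((J:ℝ)/8))..0, (1+|t|)^(-(1+σ)) * f t = ∫ t in (0:ℝ)..(J:ℝ)/8, (1+|t|)^(-(1+σ)) * f (-t) := by
    have := intervalIntegral.integral_comp_neg (a := 0) (b := (J:ℝ)/8) (fun t : ℝ => (1+|t|)^(-(1+σ)) * f t)
    rw [neg_zero] at this
    rw [← this]
    simp only [abs_neg]
  rw [← intervalIntegral.integral_add_adjacent_intervals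
      (hcont.intervalIntegrable (-((J:ℝ)/8)) 0) (hcont.intervalIntegrable 0 ((J:ℝ)/8)), h3]
  linarith

lemma gauss_rpow {b σ t : ℝ} (hb : 0 < b) (hb1 : b ≤ 1) (hσ : 0 < σ) (hσ1 : σ ≤ 1) :
    Real.exp (-b*t^2) ≤ 2 * b^(-σ) * (1+|t|)^(-(2*σ)) := by
  have h1 : b * (1+|t|)^2 ≤ 2 + 2*(b*t^2) := by
    have : (1+|t|)^2 ≤ 2 + 2*t^2 := by
      rw [← sq_abs t]; nlinarith [sq_nonneg (1 - |t|)]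
    nlinarith
  have h0 : 0 ≤ b*t^2 := by positivity
  have h2 : (b * (1+|t|)^2)^σ ≤ 2 * Real.exp (b*t^2) := by
    calc _ ≤ (2 + 2*(b*t^2))^σ := Real.rpow_le_rpow (by positivity) h1 hσ.le
      _ ≤ (2 + 2*(b*t^2))^(1:ℝ) := Real.rpow_le_rpow_of_exponent_le (by linarith) hσ1
      _ = 2 * (b*t^2 + 1) := by rw [Real.rpow_one]; ring
      _ ≤ _ := by gcongr; exact Real.add_one_le_exp _
  rw [Real.mul_rpow hb.le (by positivity), ← Real.rpow_natCast, ← Real.rpow_mul (by positivity)] at h2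
  push_cast at h2
  have h3 : 0 < b^σ := by positivity
  have h4 : 0 < (1+|t|)^(2*σ) := by positivity
  rw [Real.rpow_neg hb.le, Real.rpow_neg (by positivity), neg_mul, Real.exp_neg]
  have h5 := Real.exp_pos (b*t^2)
  rw [inv_le_iff_one_le_mul₀ h5]
  have e : 2 * (b^σ)⁻¹ * ((1+|t|)^(2*σ))⁻¹ * Real.exp (b*t^2) = (2 * Real.exp (b*t^2)) / (b^σ * (1+|t|)^(2*σ)) := by
    field_simp
  rw [e, le_div_iff₀ (by positivity)]
  linarith

lemma fourier_bound {σ : ℝ} (hσ : 0 < σ) (hσ1 : σ ≤ 1) : ∃ K : ℝ, 1 ≤ K ∧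
    ∀ (b x y : ℝ), 0 < b → b ≤ 1 → x ≤ y → ∀ (w : ℕ → ℂ) (lam : ℕ → ℝ) (F : ℝ → ℂ) (f : ℝ → ℝ),
    Summable (fun n => ‖w n‖) → (∀ t : ℝ, HasSum (fun n => w n * cexp (-(I*t*lam n))) (F t)) →
    Continuous f → (∀ t, ‖F t‖ ≤ f t) → ∀ (B Fm : ℝ) (J : ℕ), (∀ t, f t ≤ Fm) →
    (∀ t0 : ℝ, |t0| ≤ (J:ℝ)/8 → ∫ t in (t0-1/16)..(t0+1/16), f t ≤ B) →
    ‖∑' n, w n * (hh b x y (lam n) : ℂ)‖ ≤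
      K * (y - x + 1) * (b^(-σ) * B + Fm * Real.exp (-(b*((J:ℝ)/8)^2/2)) / √b) := by
  obtain ⟨K, hK, hgrid⟩ := grid_bound (σ := 2*σ) (by linarith)
  refine ⟨4*K+6, by linarith, ?_⟩
  intro b x y hb hb1 hxy w lam F f hw hF hf hFf B Fm J hFm hB
  have hf0 : ∀ t, 0 ≤ f t := fun t => (norm_nonneg _).trans (hFf t)
  have hg := hgrid f hf hf0 B J hB
  set T : ℝ := (J:ℝ)/8 with hT
  have hT0 : 0 ≤ T := by positivity
  have hD : 0 ≤ y - x + 1 := by linarith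
  have hFm0 : 0 ≤ Fm := (hf0 0).trans (hFm 0)
  have hB0 : 0 ≤ B := by
    refine le_trans ?_ (hB 0 (by simpa using hT0))
    exact intervalIntegral.integral_nonneg (by norm_num) fun t _ => hf0 t
  rw [(four_sum hb hxy hw hF).tsum_eq]
  have hcont : Continuous (fun t : ℝ => (1+|t|)^(-(1+2*σ)) * f t) := by
    refine Continuous.mul ?_ hf
    refine Continuous.rpow_const (by fun_prop) (fun t => Or.inl (by positivity))
  set g1 : ℝ → ℝ := (Set.Ioc (-T) T).indicator (fun t : ℝ => (1+|t|)^(-(1+2*σ)) * f t) with hg1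
  have hg1I : Integrable g1 := by
    rw [hg1, integrable_indicator_iff measurableSet_Ioc]
    exact (hcont.integrableOn_Icc (a := -T) (b := T)).mono_set Set.Ioc_subset_Icc_self
  have hg1i : ∫ t, g1 t ≤ K * B := by
    rw [hg1, integral_indicator measurableSet_Ioc, ← intervalIntegral.integral_of_le (by linarith)]
    exact hg
  set c1 : ℝ := (y-x+1) * 4 * b^(-σ) with hc1
  set c2 : ℝ := (y-x+1) * 2 * Fm * Real.exp (-(b*T^2/2)) with hc2
  have hgI2 : Integrable (fun t : ℝ => Real.exp (-(b/2)*t^2)) := integrable_exp_neg_mul_sq (by linarith)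
  have hpt : ∀ t : ℝ, ‖HH b x y t * F t‖ ≤ c1 * g1 t + c2 * Real.exp (-(b/2)*t^2) := by
    intro t
    rw [norm_mul]
    have h1 : ‖HH b x y t‖ * ‖F t‖ ≤ (y - x + 1) * (2/(1+|t|)) * Real.exp (-b*t^2) * f t :=
      mul_le_mul (HH_norm hxy) (hFf t) (norm_nonneg _) (by positivity)
    refine h1.trans ?_
    by_cases ht : t ∈ Set.Ioc (-T) T
    · have e : g1 t = (1+|t|)^(-(1+2*σ)) * f t := by rw [hg1, Set.indicator_of_mem ht]
      have h2 := gauss_rpow (t := t) hb hb1 hσ hσ1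
      have e2 : (1+|t|)^(-(1+2*σ)) = (1+|t|)⁻¹ * (1+|t|)^(-(2*σ)) := by
        rw [← Real.rpow_neg_one, ← Real.rpow_add (by positivity)]; congr 1; ring
      have h3 : 0 ≤ c2 * Real.exp (-(b/2)*t^2) := by positivity
      have h4 : (y - x + 1) * (2/(1+|t|)) * Real.exp (-b*t^2) * f t ≤ c1 * g1 t := by
        rw [e, e2, hc1]
        have hft := hf0 t
        calc _ ≤ (y - x + 1) * (2/(1+|t|)) * (2 * b^(-σ) * (1+|t|)^(-(2*σ))) * f t := by gcongr
          _ = _ := by rw [div_eq_mul_inv]; ring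
      linarith
    · have e : g1 t = 0 := by rw [hg1, Set.indicator_of_notMem ht]
      have hTt : T ≤ |t| := by
        rw [Set.mem_Ioc, not_and_or, not_lt, not_le] at ht
        rcases ht with h | h
        · have := neg_le_abs t; linarith
        · exact h.le.trans (le_abs_self t)
      have h5 : T^2 ≤ t^2 := by rw [← sq_abs t]; gcongr
      have h6 : Real.exp (-b*t^2) ≤ Real.exp (-(b*T^2/2)) * Real.exp (-(b/2)*t^2) := by
        rw [← Real.exp_add, Real.exp_le_exp]
        nlinarith
      have h7 : 2/(1+|t|) ≤ 2 := by
        rw [div_le_iff₀ (by positivity)]; linarith [abs_nonneg t]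
      have hft := hf0 t
      rw [e, mul_zero, zero_add, hc2]
      calc _ ≤ (y - x + 1) * 2 * (Real.exp (-(b*T^2/2)) * Real.exp (-(b/2)*t^2)) * Fm := by
            gcongr; exact hFm t
        _ = _ := by ring
  have h8 := norm_integral_le_of_norm_le ((hg1I.const_mul c1).add (hgI2.const_mul c2))
    (Eventually.of_forall hpt)
  refine h8.trans ?_
  have e9' : ∫ t, ((fun t => c1 * g1 t) + (fun t => c2 * Real.exp (-(b/2)*t^2))) t =
    c1 * (∫ t, g1 t) + c2 * √(π/(b/2)) := by
    simp only [Pi.add_apply]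
    rw [integral_add (hg1I.const_mul c1) (hgI2.const_mul c2), integral_const_mul, integral_const_mul,
      integral_gaussian]
  have hc1' : 0 ≤ c1 := by positivity
  have hc2' : 0 ≤ c2 := by positivity
  have h10 : √(π/(b/2)) ≤ 3/√b := by
    rw [show π/(b/2) = (2*π)/b by field_simp, Real.sqrt_div (by positivity)]
    gcongr
    rw [Real.sqrt_le_left (by norm_num)]
    have := Real.pi_lt_four
    linarith
  refine le_trans (le_of_eq e9') ?_
  have h11 : c1 * (∫ t, g1 t) ≤ c1 * (K*B) := by gcongr
  have h12 : c2 * √(π/(b/2)) ≤ c2 * (3/√b) := by gcongr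
  have hb0 : 0 ≤ b^(-σ) * B := by positivity
  have hb2 : 0 ≤ Fm * Real.exp (-(b*T^2/2)) / √b := by positivity
  have e13 : c1 * (K*B) = 4 * K * (y-x+1) * (b^(-σ) * B) := by rw [hc1]; ring
  have e14 : c2 * (3/√b) = 6 * (y-x+1) * (Fm * Real.exp (-(b*T^2/2)) / √b) := by rw [hc2]; ring
  have h15 : 0 ≤ (y-x+1) * (b^(-σ) * B) := by positivity
  have h16 : 0 ≤ (y-x+1) * (Fm * Real.exp (-(b*T^2/2)) / √b) := by positivity
  have h17 : 0 ≤ K * ((y-x+1) * (Fm * Real.exp (-(b*T^2/2)) / √b)) := by positivity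
  nlinarith
end PAP


/-! Part 15 -/

namespace PAP
open Complex MeasureTheory ArithmeticFunction

/-- coefficient detecting the residue class, minus its principal part -/
noncomputable def cc (p a n : ℕ) : ℝ := (if n % p = a then (p:ℝ) - 1 else 0) - (if p ∣ n then 0 else 1)

/-- smooth weight -/
noncomputable def WW (r : ℝ) (k n : ℕ) : ℝ :=
  r^(k+1) * ((Real.log n)^k / k.factorial * (Λ n / (n:ℝ)^(1+r)))

lemma cc_abs {p : ℕ} (hp : p.Prime) (a n : ℕ) :
    |cc p a n| ≤ p * (if n % p = a then 1 else 0) + 1 := by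
  have : (2:ℝ) ≤ p := by exact_mod_cast hp.two_le
  unfold cc
  split_ifs <;> rw [abs_le] <;> constructor <;> linarith

lemma cc_abs' {p : ℕ} (hp : p.Prime) (a n : ℕ) : |cc p a n| ≤ p := by
  have : (2:ℝ) ≤ p := by exact_mod_cast hp.two_le
  unfold cc
  split_ifs <;> rw [abs_le] <;> constructor <;> linarith

lemma cc_char {p : ℕ} [NeZero p] (hp : p.Prime) {a : ℕ} (ha : 1 ≤ a) (ha2 : a < p) (n : ℕ) :
    ∑ χ : {χ : DirichletCharacter ℂ p // χ ≠ 1}, (starRingEnd ℂ) (χ.1 a) * χ.1 n = (cc p a n : ℂ) := by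
  have hcop : Nat.Coprime a p := (Nat.coprime_of_lt_prime (by omega) ha2 hp).symm
  have h := char_orth p n a hcop
  rw [Nat.mod_eq_of_lt ha2, Nat.totient_prime hp] at h
  have h2 : ∑ χ : DirichletCharacter ℂ p, χ n * (starRingEnd ℂ) (χ a) =
      (1 : DirichletCharacter ℂ p) n * (starRingEnd ℂ) ((1 : DirichletCharacter ℂ p) a) +
      ∑ χ : {χ : DirichletCharacter ℂ p // χ ≠ 1}, (starRingEnd ℂ) (χ.1 a) * χ.1 n := by
    classical
    rw [← Finset.add_sum_erase Finset.univ _ (Finset.mem_univ (1 : DirichletCharacter ℂ p))]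
    congr 1
    rw [← Finset.sum_subtype (s := Finset.univ.erase 1) (p := fun χ => χ ≠ 1)
      (f := fun χ : DirichletCharacter ℂ p => (starRingEnd ℂ) (χ a) * χ n) (by simp)]
    exact Finset.sum_congr rfl fun χ _ => mul_comm _ _
  have h3 : (1 : DirichletCharacter ℂ p) (a : ZMod p) = 1 :=
    MulChar.one_apply ((ZMod.isUnit_iff_coprime a p).2 hcop)
  have h4 : (1 : DirichletCharacter ℂ p) (n : ZMod p) = if p ∣ n then 0 else 1 := by
    split_ifs with hd
    · refine MulChar.map_nonunit _ ?_
      rw [ZMod.isUnit_iff_coprime, Nat.coprime_comm, hp.coprime_iff_not_dvd]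
      exact fun h => h hd
    · refine MulChar.one_apply ?_
      rw [ZMod.isUnit_iff_coprime, Nat.coprime_comm, hp.coprime_iff_not_dvd]
      exact hd
  rw [h, h3, h4, map_one, mul_one] at h2
  unfold cc
  have h5 := eq_sub_of_add_eq' h2.symm
  rw [h5]
  have h1p : 1 ≤ p := hp.one_le
  split_ifs <;> push_cast [h1p] <;> ring

lemma WW_nonneg {r : ℝ} (hr : 0 < r) (k n : ℕ) : 0 ≤ WW r k n :=
  mul_nonneg (by positivity) (logLam_nonneg k n r)

lemma WW_summable {r : ℝ} (hr : 0 < r) (k : ℕ) : Summable (WW r k) :=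
  (logLam_summable k hr).mul_left _

lemma WW_total : ∃ C0 : ℝ, 1 ≤ C0 ∧ ∀ (r : ℝ) (k : ℕ), 0 < r → r ≤ 1 → ∑' n, WW r k n ≤ 2^k * C0 := by
  obtain ⟨C0, hC0, hL⟩ := Lam_sum
  refine ⟨2 + C0, by linarith, fun r k hr hr1 => ?_⟩
  unfold WW
  rw [tsum_mul_left]
  have h1 : ∑' n : ℕ, (Real.log n)^k / k.factorial * (Λ n / (n:ℝ)^(1+r)) ≤ (2/r)^k * (1/(r/2) + C0) := by
    calc _ ≤ ∑' n : ℕ, (2/r)^k * (Λ n / (n:ℝ)^(1+r/2)) :=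
          Summable.tsum_le_tsum (fun n => logLam_le k n hr) (logLam_summable k hr)
            ((Lam_summable (by linarith)).mul_left _)
      _ = (2/r)^k * ∑' n : ℕ, (Λ n / (n:ℝ)^(1+r/2)) := tsum_mul_left
      _ ≤ _ := by gcongr; exact hL (r/2) (by linarith) (by linarith)
  calc _ ≤ r^(k+1) * ((2/r)^k * (1/(r/2) + C0)) := by gcongr
    _ = 2^k * (2 + r * C0) := by rw [div_pow, pow_succ]; field_simp
    _ ≤ _ := by gcongr; nlinarith

lemma WW_le {r : ℝ} (hr : 0 < r) (hr1 : r ≤ 1) (k n : ℕ) : WW r k n ≤ Λ n / n := by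
  rcases Nat.eq_zero_or_pos n with rfl | hn
  · simp [WW]
  have hn0 : (0:ℝ) < n := by exact_mod_cast hn
  have hl : 0 ≤ Real.log n := Real.log_natCast_nonneg n
  have h1 := Real.pow_div_factorial_le_exp (x := r * Real.log n) (by positivity) k
  have e1 : Real.exp (r * Real.log n) = (n:ℝ)^r := by rw [Real.rpow_def_of_pos hn0, mul_comm]
  rw [e1] at h1
  unfold WW
  have hL : 0 ≤ Λ n := vonMangoldt_nonneg
  have hnr : 0 < (n:ℝ)^r := by positivity
  calc _ = r * ((r * Real.log n)^k / k.factorial) * (Λ n / (n * (n:ℝ)^r)) := by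
        rw [Real.rpow_add hn0, Real.rpow_one, mul_pow, pow_succ]; ring
    _ ≤ 1 * (n:ℝ)^r * (Λ n / (n * (n:ℝ)^r)) := by gcongr
    _ = _ := by field_simp

lemma term_eq2 {p : ℕ} (χ : DirichletCharacter ℂ p) (r t : ℝ) (k n : ℕ) :
    (r^(k+1) : ℝ) * (χ n * Λ n * ((Real.log n)^k / (k.factorial) : ℝ) / (n:ℂ)^(1+r+t*I : ℂ)) =
      (WW r k n : ℂ) * χ n * cexp (-(I * t * Real.log n)) := by
  rcases Nat.eq_zero_or_pos n with rfl | hn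
  · simp [WW]
  have hn0 : (n:ℂ) ≠ 0 := by exact_mod_cast hn.ne'
  have e1 : (n:ℂ)^(1+r:ℂ) = (((n:ℝ)^(1+r) : ℝ):ℂ) := by
    rw [Complex.ofReal_cpow (by positivity)]; push_cast; rfl
  have e2 : ((n:ℂ)^(t*I:ℂ))⁻¹ = cexp (-(I * t * Real.log n)) := by
    rw [Complex.cpow_def_of_ne_zero hn0, ← Complex.exp_neg, ← Complex.natCast_log]
    congr 1; ring
  rw [Complex.cpow_add _ _ hn0, e1, ← e2, WW]
  push_cast
  have h3 : (((n:ℝ)^(1+r) : ℝ):ℂ) ≠ 0 := by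
    have : (0:ℝ) < (n:ℝ)^(1+r) := by positivity
    exact_mod_cast this.ne'
  field_simp

noncomputable def FF (p a : ℕ) [NeZero p] (r : ℝ) (k : ℕ) (t : ℝ) : ℂ :=
  ∑ χ : {χ : DirichletCharacter ℂ p // χ ≠ 1}, (starRingEnd ℂ) (χ.1 a) * ((r^(k+1) : ℝ) * DD χ.1 k (1+r+t*I))

lemma FF_hasSum {p : ℕ} [NeZero p] (hp : p.Prime) {a : ℕ} (ha : 1 ≤ a) (ha2 : a < p) {r : ℝ}
    (hr : 0 < r) (k : ℕ) (t : ℝ) :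
    HasSum (fun n : ℕ => ((cc p a n * WW r k n : ℝ) : ℂ) * cexp (-(I * t * Real.log n))) (FF p a r k t) := by
  have h : ∀ χ : {χ : DirichletCharacter ℂ p // χ ≠ 1}, HasSum (fun n : ℕ => (starRingEnd ℂ) (χ.1 a) *
      ((r^(k+1) : ℝ) * (χ.1 n * Λ n * ((Real.log n)^k / (k.factorial) : ℝ) / (n:ℂ)^(1+r+t*I : ℂ))))
      ((starRingEnd ℂ) (χ.1 a) * ((r^(k+1) : ℝ) * DD χ.1 k (1+r+t*I))) := fun χ =>
    ((DD_hasSum χ.1 k (s := 1+r+t*I) (by simp [hr])).mul_left _).mul_left _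
  have h2 := hasSum_sum (s := Finset.univ) (fun χ _ => h χ)
  have e : (fun n : ℕ => ((cc p a n * WW r k n : ℝ) : ℂ) * cexp (-(I * t * Real.log n))) =
      fun n : ℕ => ∑ χ : {χ : DirichletCharacter ℂ p // χ ≠ 1}, (starRingEnd ℂ) (χ.1 a) *
      ((r^(k+1) : ℝ) * (χ.1 n * Λ n * ((Real.log n)^k / (k.factorial) : ℝ) / (n:ℂ)^(1+r+t*I : ℂ))) := by
    funext n
    simp_rw [term_eq2]
    have : ∀ χ : {χ : DirichletCharacter ℂ p // χ ≠ 1}, (starRingEnd ℂ) (χ.1 a) *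
        ((WW r k n : ℂ) * χ.1 n * cexp (-(I * t * Real.log n))) =
        ((starRingEnd ℂ) (χ.1 a) * χ.1 n) * ((WW r k n : ℂ) * cexp (-(I * t * Real.log n))) :=
      fun χ => by ring
    simp_rw [this]
    rw [← Finset.sum_mul, cc_char hp ha ha2]
    push_cast
    ring
  rw [e]
  exact h2

noncomputable def ff (p : ℕ) [NeZero p] (r : ℝ) (k : ℕ) (t : ℝ) : ℝ :=
  ∑ χ : {χ : DirichletCharacter ℂ p // χ ≠ 1}, r^(k+1) * ‖DD χ.1 k (1+r+t*I)‖

lemma FF_le {p : ℕ} [NeZero p] (a : ℕ) {r : ℝ} (hr : 0 < r) (k : ℕ) (t : ℝ) :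
    ‖FF p a r k t‖ ≤ ff p r k t := by
  unfold FF ff
  refine (norm_sum_le _ _).trans (Finset.sum_le_sum fun χ _ => ?_)
  rw [norm_mul, norm_mul, RCLike.norm_conj, Complex.norm_real, Real.norm_of_nonneg (by positivity)]
  have := DirichletCharacter.norm_le_one χ.1 (a : ZMod p)
  exact mul_le_of_le_one_left (by positivity) this

lemma ff_cont (p : ℕ) [NeZero p] {r : ℝ} (hr : 0 < r) (k : ℕ) : Continuous (ff p r k) := by
  unfold ff
  refine continuous_finsetSum _ fun χ _ => ?_
  exact continuous_const.mul (DD_cont χ.1 k hr).norm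

lemma ff_le (p : ℕ) [NeZero p] {r : ℝ} (hr : 0 < r) (k : ℕ) (t : ℝ) :
    ff p r k t ≤ p * ∑' n, WW r k n := by
  unfold ff
  have h : ∀ χ : {χ : DirichletCharacter ℂ p // χ ≠ 1}, r^(k+1) * ‖DD χ.1 k (1+r+t*I)‖ ≤ ∑' n, WW r k n := by
    intro χ
    unfold WW
    rw [tsum_mul_left]
    gcongr
    exact tsum_of_norm_bounded (logLam_summable k hr).hasSum (fun n => term_norm χ.1 r t k n)
  refine (Finset.sum_le_sum fun χ _ => h χ).trans ?_
  rw [Finset.sum_const, nsmul_eq_mul, Finset.card_univ]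
  exact mul_le_mul_of_nonneg_right (card_chi_le p) (tsum_nonneg fun n => WW_nonneg hr k n)

structure Par (p : ℕ) (c L U r : ℝ) (κ k : ℕ) : Prop where
  hp : p.Prime
  hc0 : 0 < c
  hc1 : c ≤ 1
  bad : ¬ Bad c p
  hl : 200000 ≤ Real.log p
  hL1 : 1000 ≤ L
  hlL : 100 * L ≤ Real.log p
  hLU : L * Real.log p ≤ U
  hUL : U ≤ Real.exp L
  hκ1 : 1 ≤ κ
  hκU : (κ:ℝ) ≤ U
  hUκ : U ≤ 80 * κ
  hk : k + 1 = 2 * κ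
  hkU : (k:ℝ) ≤ U
  hr0 : 1/40 ≤ r
  hr1 : r ≤ 1/20
  hrU : r * U ≤ 2 * κ

section
variable {p κ k : ℕ} {c L U r : ℝ}
lemma Par.p_eq (h : Par p c L U r κ k) : (p:ℝ) = Real.exp (Real.log p) := by
  rw [Real.exp_log]; exact_mod_cast h.hp.pos
lemma Par.exp_le_p (h : Par p c L U r κ k) : Real.exp (100 * L) ≤ p := by
  rw [h.p_eq, Real.exp_le_exp]; exact h.hlL
lemma Par.Ule (h : Par p c L U r κ k) : U ≤ p := by
  refine h.hUL.trans (le_trans ?_ h.exp_le_p)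
  rw [Real.exp_le_exp]; linarith [h.hL1]
lemma Par.sqrtκ (h : Par p c L U r κ k) : √(κ:ℝ) ≤ Real.exp (L/2) := by
  rw [Real.sqrt_le_left (Real.exp_pos _).le, ← Real.exp_nat_mul]
  have e : ((2:ℕ):ℝ) * (L/2) = L := by push_cast; ring
  rw [e]; exact h.hκU.trans h.hUL
lemma Par.sκ_pos (h : Par p c L U r κ k) : 0 < √(κ:ℝ) := by
  have : (0:ℝ) < κ := by exact_mod_cast h.hκ1
  positivity
lemma Par.p_ge (h : Par p c L U r κ k) : 200000 ≤ (p:ℝ) := by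
  have h1 := h.p_eq
  have h2 := Real.add_one_le_exp (Real.log p)
  have := h.hl
  linarith
lemma Par.r_pos (h : Par p c L U r κ k) : 0 < r := by linarith [h.hr0]
end

/-- Bound for the smoothed sum. -/
lemma smooth_bound {c : ℝ} (hc : 0 < c) (hc1 : c ≤ 1) : ∃ C : ℝ, 1 ≤ C ∧ ∀ (p κ k : ℕ) (L U r : ℝ),
    Par p c L U r κ k → C ≤ L → ∀ a : ℕ, 1 ≤ a → a < p → ∀ x y : ℝ, x ≤ y → y - x ≤ 5*L →
    ‖∑' n : ℕ, ((cc p a n * WW r k n : ℝ) : ℂ) * (hh (Real.exp (-(8*L))) x y (Real.log n) : ℂ)‖ ≤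
      C * L * (Real.exp (-(c*L/8)) / √κ) := by
  obtain ⟨C8, h8, hpiece⟩ := piece_bound
  obtain ⟨C0, h0, htot⟩ := WW_total
  obtain ⟨K, hK, hfour⟩ := fourier_bound (σ := c/64) (by linarith) (by linarith)
  refine ⟨max (6*K*(C8+1)) (max C8 C0), le_max_of_le_right (le_max_of_le_left h8), ?_⟩
  intro p κ k L U r hP hL a ha ha2 x y hxy hyx
  have hp := hP.hp
  have : NeZero p := ⟨hp.ne_zero⟩
  have hL8 : C8 ≤ L := ((le_max_left _ _).trans (le_max_right _ _)).trans hL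
  have hL0 : C0 ≤ L := ((le_max_right _ _).trans (le_max_right _ _)).trans hL
  have hr := hP.r_pos
  have hr1 := hP.hr1
  have hL1 := hP.hL1
  have hb0 := Real.exp_pos (-(8*L))
  have hb1 : Real.exp (-(8*L)) ≤ 1 := Real.exp_le_one_iff.2 (by linarith)
  have hsum : Summable (fun n : ℕ => ‖((cc p a n * WW r k n : ℝ) : ℂ)‖) := by
    refine Summable.of_nonneg_of_le (fun n => norm_nonneg _) (fun n => ?_) ((WW_summable hr k).mul_left (p:ℝ))
    rw [Complex.norm_real, norm_mul, Real.norm_eq_abs, Real.norm_of_nonneg (WW_nonneg hr k n)]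
    exact mul_le_mul_of_nonneg_right (cc_abs' hp a n) (WW_nonneg hr k n)
  have hmain := hfour (Real.exp (-(8*L))) x y hb0 hb1 hxy (fun n => ((cc p a n * WW r k n : ℝ) : ℂ))
    (fun n => Real.log n) (FF p a r k) (ff p r k) hsum (FF_hasSum hp ha ha2 hr k) (ff_cont p hr k)
    (FF_le a hr k) (C8 * Real.exp (-(c*L/4)) / √κ) (p * (2^k * C0)) (8*p^3)
    (fun t => (ff_le p hr k t).trans (by gcongr; exact htot r k hr (by linarith)))
    (fun t0 ht0 => by
      have := hpiece p hp c hc hc1 hP.bad L U r κ k hL8 hP.hl hP.hLU hP.Ule hP.hκ1 hP.hκU hP.hUκ hP.hk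
        hP.hr0 hP.hr1 hP.hrU t0 (by push_cast at ht0; linarith)
      rw [← hP.hk] at this
      exact this)
  refine hmain.trans ?_
  have hsκ := hP.sκ_pos
  have e1 : (Real.exp (-(8*L)))^(-(c/64)) = Real.exp (c*L/8) := by
    rw [← Real.exp_mul]; congr 1; ring
  have e2 : Real.exp (c*L/8) * (C8 * Real.exp (-(c*L/4)) / √κ) = C8 * (Real.exp (-(c*L/8))/√κ) := by
    have : Real.exp (-(c*L/8)) = Real.exp (c*L/8) * Real.exp (-(c*L/4)) := by
      rw [← Real.exp_add]; congr 1; ring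
    rw [this]; ring
  have e3 : √(Real.exp (-(8*L))) = Real.exp (-(4*L)) := by
    rw [Real.sqrt_eq_iff_mul_self_eq (Real.exp_pos _).le (Real.exp_pos _).le, ← Real.exp_add]; congr 1; ring
  have e4 : (((8*p^3:ℕ):ℝ)/8) = (p:ℝ)^3 := by push_cast; ring
  rw [e1, e2, e3, e4]
  have hp2 : (200000:ℝ) ≤ p := hP.p_ge
  have hLp : L ≤ p := by
    have h1 := hP.exp_le_p
    have h2 := Real.add_one_le_exp (100*L)
    linarith
  have hlp : Real.log p ≤ p := by
    have h2 := Real.add_one_le_exp (Real.log p)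
    rw [← hP.p_eq] at h2; linarith
  have htiny : (p:ℝ) * (2^k * C0) * Real.exp (-(Real.exp (-(8*L)) * ((p:ℝ)^3)^2/2)) / Real.exp (-(4*L)) ≤
      Real.exp (-(c*L/8)) / √κ := by
    rw [div_le_div_iff₀ (Real.exp_pos _) hsκ]
    have g1 : (p:ℝ)^5 ≤ Real.exp (-(8*L)) * ((p:ℝ)^3)^2 := by
      have g2 : 1 ≤ Real.exp (-(8*L)) * p := by
        have g3 : Real.exp (8*L) ≤ p := le_trans (Real.exp_le_exp.2 (by linarith)) hP.exp_le_p
        calc 1 = Real.exp (-(8*L)) * Real.exp (8*L) := by rw [← Real.exp_add]; simp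
          _ ≤ _ := by gcongr
      calc (p:ℝ)^5 = 1 * (p:ℝ)^5 := by ring
        _ ≤ (Real.exp (-(8*L)) * p) * (p:ℝ)^5 := by gcongr
        _ = _ := by ring
    have g4 : 20 * (p:ℝ) ≤ (p:ℝ)^5 := by
      have : (20:ℝ) ≤ (p:ℝ)^4 := by
        calc (20:ℝ) ≤ 2^5 := by norm_num
          _ ≤ 200000^4 := by norm_num
          _ ≤ _ := by gcongr
      calc 20 * (p:ℝ) ≤ (p:ℝ)^4 * p := by gcongr
        _ = _ := by ring
    have g5 : (2:ℝ)^k ≤ Real.exp p := by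
      have : (2:ℝ) ≤ Real.exp 1 := by linarith [Real.exp_one_gt_d9]
      calc (2:ℝ)^k ≤ (Real.exp 1)^k := by gcongr
        _ = Real.exp k := by rw [← Real.exp_nat_mul]; simp
        _ ≤ _ := Real.exp_le_exp.2 (hP.hkU.trans hP.Ule)
    have g6 : C0 ≤ Real.exp p := by linarith [Real.add_one_le_exp (p:ℝ)]
    have g7 : √(κ:ℝ) ≤ Real.exp p := hP.sqrtκ.trans (Real.exp_le_exp.2 (by linarith))
    have g8 : (p:ℝ) ≤ Real.exp p := by linarith [Real.add_one_le_exp (p:ℝ)]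
    calc _ ≤ Real.exp p * (Real.exp p * Real.exp p) * Real.exp (-(10*(p:ℝ))) * Real.exp p := by
          gcongr; linarith
      _ = Real.exp (-(6*(p:ℝ))) := by
          rw [← Real.exp_add, ← Real.exp_add, ← Real.exp_add, ← Real.exp_add]; congr 1; ring
      _ ≤ _ := by
          rw [← Real.exp_add, Real.exp_le_exp]
          have : c * L ≤ L := by nlinarith
          linarith
  set Q := Real.exp (-(c*L/8)) / √κ with hQ
  have hQ0 : 0 < Q := by positivity
  calc _ ≤ K * (6 * L) * (C8 * Q + Q) := by
        have : y - x + 1 ≤ 6 * L := by linarith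
        gcongr
    _ = 6*K*(C8+1) * L * Q := by ring
    _ ≤ _ := by
        gcongr; exact le_max_left _ _
end PAP


/-! Part 16 -/

namespace PAP
open Complex MeasureTheory ArithmeticFunction

lemma window_count (p a Y1 Y2 : ℕ) (hp : 0 < p) (ha : a < p) (h12 : Y1 ≤ Y2) :
    (((Finset.Ioc Y1 Y2).filter (fun n => n % p = a)).card : ℝ) ≤ ((Y2:ℝ) - Y1)/p + 2 := by
  have h1 := count_ap p 1 a Y1 hp one_pos (Nat.coprime_one_right p)
  have h2 := count_ap p 1 a Y2 hp one_pos (Nat.coprime_one_right p)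
  simp only [one_dvd, and_true, Nat.mod_eq_of_lt ha, Nat.cast_one, mul_one] at h1 h2
  have e : ((Finset.Ioc 0 Y2).filter (fun n => n % p = a)).card =
      ((Finset.Ioc 0 Y1).filter (fun n => n % p = a)).card + ((Finset.Ioc Y1 Y2).filter (fun n => n % p = a)).card := by
    rw [← Finset.card_union_of_disjoint, ← Finset.filter_union, Finset.Ioc_union_Ioc_eq_Ioc (Nat.zero_le _) h12]
    refine Finset.disjoint_filter_filter ?_
    exact Finset.Ioc_disjoint_Ioc_of_le le_rfl
  rw [e] at h2
  push_cast at h2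
  rw [abs_le] at h1 h2
  have : ((Y2:ℝ)-Y1)/p = Y2/p - Y1/p := by ring
  linarith [h1.1, h1.2, h2.1, h2.2]

lemma edge_bound {p κ k : ℕ} {c L U r : ℝ} (hP : Par p c L U r κ k) {a : ℕ} (ha2 : a < p) {v0 : ℝ}
    (h1 : U - 5*L ≤ v0) (h2 : v0 ≤ U) (W : Finset ℕ)
    (hW : ∀ n ∈ W, 1 ≤ n ∧ |Real.log n - v0| < Real.exp (-(3*L))) :
    ∑ n ∈ W, |cc p a n * WW r k n| ≤ 36 * Real.exp (-L) / √κ := by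
  have hp := hP.hp
  have hp0 : (0:ℝ) < p := by exact_mod_cast hp.pos
  have hL1 := hP.hL1
  have hr := hP.r_pos
  set δ := Real.exp (-(3*L)) with hδ
  have hδ0 : 0 < δ := Real.exp_pos _
  have hδ1 : δ ≤ 1/2 := by
    have h3 : Real.exp (-(3*L)) ≤ Real.exp (-1) := Real.exp_le_exp.2 (by linarith)
    have h4 : Real.exp (-1) ≤ 1/2 := by
      rw [Real.exp_neg, ← one_div]
      exact one_div_le_one_div_of_le (by norm_num) (by linarith [Real.exp_one_gt_d9])
    exact h3.trans h4
  have hl1 : (1000:ℝ) * Real.log p ≤ U := by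
    refine le_trans ?_ hP.hLU
    have := hP.hl
    gcongr
  have hl2 := hP.hlL
  have hl3 := hP.hl
  have hU1 : 1 ≤ U := by linarith
  have hepos := Real.exp_pos v0
  have hexpδ : Real.exp δ ≤ 1 + 2*δ := by
    have := Real.abs_exp_sub_one_le (x := δ) (by rw [abs_of_pos hδ0]; linarith)
    rw [abs_of_pos hδ0] at this
    have := (abs_le.1 this).2
    linarith
  have hexpδ' : 1 - δ ≤ Real.exp (-δ) := by linarith [Real.add_one_le_exp (-δ)]
  set Y1 := ⌊Real.exp (v0-δ)⌋₊ with hY1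
  set Y2 := ⌊Real.exp (v0+δ)⌋₊ with hY2
  have hY12 : Y1 ≤ Y2 := Nat.floor_mono (Real.exp_le_exp.2 (by linarith))
  have hlog : ∀ n ∈ W, Real.exp (v0-δ) < n ∧ (n:ℝ) < Real.exp (v0+δ) := by
    intro n hn
    obtain ⟨hn1, hn2⟩ := hW n hn
    have hn0 : (0:ℝ) < n := by exact_mod_cast hn1
    rw [abs_lt] at hn2
    constructor
    · rw [← Real.lt_log_iff_exp_lt hn0]; linarith
    · rw [← Real.log_lt_iff_lt_exp hn0]; linarith
  have hsub : W ⊆ Finset.Ioc Y1 Y2 := by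
    intro n hn
    obtain ⟨g1, g2⟩ := hlog n hn
    rw [Finset.mem_Ioc]
    exact ⟨(Nat.floor_lt (Real.exp_pos _).le).2 g1, Nat.le_floor g2.le⟩
  have hdiff : (Y2:ℝ) - Y1 ≤ 3*δ*Real.exp v0 + 1 := by
    have g1 := Nat.floor_le (Real.exp_pos (v0+δ)).le
    have g2 := Nat.lt_floor_add_one (Real.exp (v0-δ))
    rw [← hY2] at g1
    rw [← hY1] at g2
    have e1 : Real.exp (v0+δ) = Real.exp v0 * Real.exp δ := Real.exp_add _ _
    have e2 : Real.exp (v0-δ) = Real.exp v0 * Real.exp (-δ) := by rw [← Real.exp_add]; congr 1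
    nlinarith
  have hc1 : ((W.filter (fun n => n % p = a)).card : ℝ) ≤ (3*δ*Real.exp v0 + 1)/p + 2 := by
    have g1 := window_count p a Y1 Y2 hp.pos ha2 hY12
    have g2 : ((W.filter (fun n => n % p = a)).card : ℝ) ≤ ((Finset.Ioc Y1 Y2).filter (fun n => n % p = a)).card := by
      exact_mod_cast Finset.card_le_card (Finset.filter_subset_filter _ hsub)
    have g3 : ((Y2:ℝ)-Y1)/p ≤ (3*δ*Real.exp v0 + 1)/p := by gcongr
    linarith
  have hc2 : (W.card : ℝ) ≤ 3*δ*Real.exp v0 + 1 := by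
    have g1 : W.card ≤ Y2 - Y1 := by simpa using Finset.card_le_card hsub
    have g2 : (W.card:ℝ) ≤ ((Y2 - Y1 : ℕ):ℝ) := by exact_mod_cast g1
    rw [Nat.cast_sub hY12] at g2
    linarith
  have hterm : ∀ n ∈ W, |cc p a n * WW r k n| ≤
      (p * (if n % p = a then 1 else 0) + 1) * ((U+1) * Real.exp (-(v0-δ))) := by
    intro n hn
    obtain ⟨g1, g2⟩ := hlog n hn
    have hn0 : (0:ℝ) < n := lt_trans (Real.exp_pos _) g1
    rw [abs_mul, abs_of_nonneg (WW_nonneg hr k n)]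
    have hWWn := WW_nonneg hr k n
    refine mul_le_mul (cc_abs hp a n) ?_ hWWn (by positivity)
    refine (WW_le hr (by linarith [hP.hr1]) k n).trans ?_
    have g3 : Λ n ≤ U + 1 := by
      refine vonMangoldt_le_log.trans ?_
      have := (abs_lt.1 (hW n hn).2).2
      linarith
    rw [div_eq_mul_inv]
    refine mul_le_mul g3 ?_ (by positivity) (by linarith)
    rw [Real.exp_neg]
    exact inv_anti₀ (Real.exp_pos _) g1.le
  have hUp : U * p * Real.exp (-v0) ≤ Real.exp (-(2*L)) := by
    calc U * p * Real.exp (-v0) ≤ Real.exp L * Real.exp (Real.log p) * Real.exp (-(U-5*L)) := by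
          rw [← hP.p_eq]
          have := hP.hUL
          gcongr
      _ = Real.exp (L + Real.log p - (U - 5*L)) := by
          rw [← Real.exp_add, ← Real.exp_add]; congr 1
      _ ≤ _ := by rw [Real.exp_le_exp]; linarith
  have hUδ : U * δ ≤ Real.exp (-(2*L)) := by
    calc U * δ ≤ Real.exp L * Real.exp (-(3*L)) := by
          have := hP.hUL
          gcongr
      _ = _ := by rw [← Real.exp_add]; congr 1; ring
  have hpge := hP.p_ge
  have hsκ := hP.sκ_pos
  calc _ ≤ ∑ n ∈ W, (p * (if n % p = a then 1 else 0) + 1) * ((U+1) * Real.exp (-(v0-δ))) :=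
        Finset.sum_le_sum hterm
    _ = (p * ((W.filter (fun n => n % p = a)).card : ℝ) + W.card) * ((U+1) * Real.exp (-(v0-δ))) := by
        rw [← Finset.sum_mul, Finset.sum_add_distrib, ← Finset.mul_sum]
        simp
    _ ≤ (p * ((3*δ*Real.exp v0 + 1)/p + 2) + (3*δ*Real.exp v0 + 1)) * ((2*U) * (2 * Real.exp (-v0))) := by
        have g5 : Real.exp (-(v0-δ)) ≤ 2 * Real.exp (-v0) := by
          have : Real.exp (-(v0-δ)) = Real.exp δ * Real.exp (-v0) := by
            rw [← Real.exp_add]; congr 1; ring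
          rw [this]
          gcongr
          linarith
        gcongr
        linarith
    _ = (6*δ*Real.exp v0 + 2 + 2*p) * (4 * U * Real.exp (-v0)) := by
        field_simp
        ring
    _ ≤ (6*δ*Real.exp v0 + 3*p) * (4 * U * Real.exp (-v0)) := by
        gcongr ?_ * _
        linarith
    _ = 24 * (U * δ) * (Real.exp v0 * Real.exp (-v0)) + 12 * (U * p * Real.exp (-v0)) := by ring
    _ = 24 * (U * δ) + 12 * (U * p * Real.exp (-v0)) := by
        rw [← Real.exp_add]; simp
    _ ≤ 36 * Real.exp (-(2*L)) := by linarith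
    _ ≤ _ := by
        rw [le_div_iff₀ hsκ]
        calc 36 * Real.exp (-(2*L)) * √κ ≤ 36 * Real.exp (-(2*L)) * Real.exp (L/2) := by
              gcongr; exact hP.sqrtκ
          _ ≤ 36 * Real.exp (-L) := by
              rw [mul_assoc, ← Real.exp_add]
              gcongr; linarith

lemma hasSum_ite_finset (s : Finset ℕ) (f : ℕ → ℝ) :
    HasSum (fun n => if n ∈ s then f n else 0) (∑ n ∈ s, f n) := by
  have h1 : HasSum (fun n => if n ∈ s then f n else 0) (∑ n ∈ s, if n ∈ s then f n else 0) :=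
    hasSum_sum_of_ne_finset_zero (fun n hn => if_neg hn)
  rwa [Finset.sum_congr rfl (fun n hn => if_pos hn)] at h1

lemma tiny_bound {p κ k : ℕ} {c L U r : ℝ} (hP : Par p c L U r κ k) {C0 : ℝ} (h0 : 1 ≤ C0) (hLC0 : C0 ≤ L) :
    2 * Real.exp (-(Real.exp (-(3*L))^2/(8*Real.exp (-(8*L))))) * (p * (2^k * C0)) ≤ Real.exp (-L) / √κ := by
  have hL1 := hP.hL1
  have hsκ := hP.sκ_pos
  set b := Real.exp (-(8*L)) with hb
  have hb0 : 0 < b := Real.exp_pos _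
  set Z := Real.exp L with hZ
  have hZ1 : L + 1 ≤ Z := Real.add_one_le_exp L
  have e1 : Real.exp (-(3*L))^2/(8*b) = Z^2/8 := by
    have : Real.exp (-(3*L))^2 = Z^2 * b := by
      rw [hZ, hb, ← Real.exp_nat_mul, ← Real.exp_nat_mul, ← Real.exp_add]; congr 1; push_cast; ring
    rw [this]; field_simp
  have hZe : Z ≤ Real.exp Z := by linarith [Real.add_one_le_exp Z]
  have g1 : (p:ℝ) ≤ Real.exp Z := by
    rw [hP.p_eq, Real.exp_le_exp]
    refine le_trans ?_ hP.hUL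
    have := hP.hLU
    have := hP.hl
    nlinarith
  have g5 : (2:ℝ)^k ≤ Real.exp Z := by
    have : (2:ℝ) ≤ Real.exp 1 := by linarith [Real.exp_one_gt_d9]
    calc (2:ℝ)^k ≤ (Real.exp 1)^k := pow_le_pow_left₀ (by norm_num) this k
      _ = Real.exp k := by rw [← Real.exp_nat_mul]; simp
      _ ≤ _ := Real.exp_le_exp.2 (hP.hkU.trans hP.hUL)
  have g6 : C0 ≤ Real.exp Z := by linarith
  have g7 : √(κ:ℝ) ≤ Real.exp Z := hP.sqrtκ.trans (Real.exp_le_exp.2 (by linarith))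
  have g8 : (2:ℝ) ≤ Real.exp Z := by linarith
  rw [le_div_iff₀ hsκ, e1]
  set B := Real.exp Z with hB
  have hB0 : 0 < B := Real.exp_pos _
  have hC00 : 0 ≤ C0 := by linarith
  have m1 : (2:ℝ)^k * C0 ≤ B * B := mul_le_mul g5 g6 hC00 hB0.le
  have m2 : (p:ℝ) * (2^k * C0) ≤ B * (B * B) := mul_le_mul g1 m1 (by positivity) hB0.le
  have m3 : 2 * Real.exp (-(Z^2/8)) ≤ B * Real.exp (-(Z^2/8)) := mul_le_mul_of_nonneg_right g8 (Real.exp_pos _).le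
  have m4 : 2 * Real.exp (-(Z^2/8)) * (p * (2^k * C0)) ≤ B * Real.exp (-(Z^2/8)) * (B * (B * B)) :=
    mul_le_mul m3 m2 (by positivity) (by positivity)
  calc _ ≤ B * Real.exp (-(Z^2/8)) * (B * (B * B)) * B :=
        mul_le_mul m4 g7 hsκ.le (by positivity)
    _ = Real.exp (5*Z - Z^2/8) := by
        rw [hB, ← Real.exp_add, ← Real.exp_add, ← Real.exp_add, ← Real.exp_add, ← Real.exp_add]; congr 1; ring
    _ ≤ _ := by
        rw [Real.exp_le_exp]
        nlinarith

set_option maxHeartbeats 1000000 in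
lemma sharp_bound {c : ℝ} (hc : 0 < c) (hc1 : c ≤ 1) : ∃ C : ℝ, 1 ≤ C ∧ ∀ (p κ k : ℕ) (L U r : ℝ),
    Par p c L U r κ k → C ≤ L → ∀ a : ℕ, 1 ≤ a → a < p → ∀ N0 N1 : ℕ, 1 ≤ N0 → N0 ≤ N1 →
    U - 5*L ≤ Real.log N0 → Real.log N1 ≤ U →
    |∑ n ∈ Finset.Ioc N0 N1, cc p a n * WW r k n| ≤ C * L * (Real.exp (-(c*L/8)) / √κ) := by
  obtain ⟨C, hC, hsm⟩ := smooth_bound hc hc1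
  obtain ⟨C0, h0, htot⟩ := WW_total
  refine ⟨max (C + 80) C0, le_max_of_le_right h0, ?_⟩
  intro p κ k L U r hP hL a ha ha2 N0 N1 hN0 hN01 hx hy
  have hL1 := hP.hL1
  have hLC : C ≤ L := by have := (le_max_left _ _).trans hL; linarith
  have hLC0 : C0 ≤ L := (le_max_right _ _).trans hL
  have hp := hP.hp
  have hr := hP.r_pos
  have hsκ := hP.sκ_pos
  set x := Real.log N0 with hxd
  set y := Real.log N1 with hyd
  have hN0' : (0:ℝ) < N0 := by exact_mod_cast hN0
  have hN1' : (0:ℝ) < N1 := by exact_mod_cast (lt_of_lt_of_le hN0 hN01)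
  have hxy : x ≤ y := Real.log_le_log hN0' (by exact_mod_cast hN01)
  set b := Real.exp (-(8*L)) with hb
  have hb0 : 0 < b := Real.exp_pos _
  set δ := Real.exp (-(3*L)) with hδ
  have hδ0 : 0 < δ := Real.exp_pos _
  have hδ1 : δ ≤ 1 := Real.exp_le_one_iff.2 (by linarith)
  have hmain := hsm p κ k L U r hP hLC a ha ha2 x y hxy (by linarith)
  rw [← hb] at hmain
  set α : ℕ → ℝ := fun n => cc p a n * WW r k n with hα
  have hαle : ∀ n, |α n| ≤ p * WW r k n := by
    intro n
    rw [hα, abs_mul, abs_of_nonneg (WW_nonneg hr k n)]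
    exact mul_le_mul_of_nonneg_right (cc_abs' hp a n) (WW_nonneg hr k n)
  have hαs : Summable (fun n => |α n|) :=
    Summable.of_nonneg_of_le (fun n => abs_nonneg _) hαle ((WW_summable hr k).mul_left (p:ℝ))
  have hαt : ∑' n, |α n| ≤ p * (2^k * C0) := by
    refine (Summable.tsum_le_tsum hαle hαs ((WW_summable hr k).mul_left (p:ℝ))).trans ?_
    rw [tsum_mul_left]
    gcongr
    exact htot r k hr (by linarith [hP.hr1])
  have hhs : Summable (fun n : ℕ => α n * hh b x y (Real.log n)) := by
    refine Summable.of_norm_bounded hαs fun n => ?_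
    rw [norm_mul, Real.norm_eq_abs, Real.norm_of_nonneg (hh_nonneg hxy)]
    exact mul_le_of_le_one_right (abs_nonneg _) (hh_le_one hb0 hxy)
  have hmain' : |∑' n : ℕ, α n * hh b x y (Real.log n)| ≤ C * L * (Real.exp (-(c*L/8)) / √κ) := by
    have e : ((∑' n : ℕ, α n * hh b x y (Real.log n) : ℝ) : ℂ) =
        ∑' n : ℕ, ((cc p a n * WW r k n : ℝ) : ℂ) * (hh b x y (Real.log n) : ℂ) := by
      rw [Complex.ofReal_tsum]
      congr 1; funext n; simp only [hα]; push_cast; ring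
    rw [← Real.norm_eq_abs, ← Complex.norm_real, e]
    exact hmain
  have hS : HasSum (fun n => if n ∈ Finset.Ioc N0 N1 then α n else 0) (∑ n ∈ Finset.Ioc N0 N1, α n) :=
    hasSum_ite_finset _ α
  set M := ⌊Real.exp (U+1)⌋₊ with hM
  set W1 := (Finset.Ioc 0 M).filter (fun n : ℕ => |Real.log n - x| < δ) with hW1
  set W2 := (Finset.Ioc 0 M).filter (fun n : ℕ => |Real.log n - y| < δ) with hW2
  have hE1 := edge_bound hP ha2 (v0 := x) hx (by linarith) W1 (by
    intro n hn
    have := Finset.mem_filter.1 hn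
    exact ⟨(Finset.mem_Ioc.1 this.1).1, this.2⟩)
  have hE2 := edge_bound hP ha2 (v0 := y) (by linarith) hy W2 (by
    intro n hn
    have := Finset.mem_filter.1 hn
    exact ⟨(Finset.mem_Ioc.1 this.1).1, this.2⟩)
  have hmem : ∀ n : ℕ, 1 ≤ n → ∀ v, v ≤ U → |Real.log n - v| < δ → n ∈ Finset.Ioc 0 M := by
    intro n hn v hv hlt
    have hn0 : (0:ℝ) < n := by exact_mod_cast hn
    rw [Finset.mem_Ioc]
    refine ⟨hn, Nat.le_floor ?_⟩
    rw [← Real.log_le_iff_le_exp hn0]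
    have := (abs_lt.1 hlt).2
    linarith
  set ε := 2 * Real.exp (-(δ^2/(8*b))) with hε
  have hε0 : 0 < ε := by positivity
  have hg1 : HasSum (fun n => if n ∈ W1 then |α n| else 0) (∑ n ∈ W1, |α n|) :=
    hasSum_ite_finset _ (fun n => |α n|)
  have hg2 : HasSum (fun n => if n ∈ W2 then |α n| else 0) (∑ n ∈ W2, |α n|) :=
    hasSum_ite_finset _ (fun n => |α n|)
  have hD := hS.sub hhs.hasSum
  have hDb := tsum_of_norm_bounded (((hαs.hasSum.mul_left ε).add hg1).add hg2)
    (f := fun n => (if n ∈ Finset.Ioc N0 N1 then α n else 0) - α n * hh b x y (Real.log n)) (by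
    intro n
    rcases Nat.eq_zero_or_pos n with rfl | hn
    · have : α 0 = 0 := by simp [hα, WW]
      simp [this]
    have hn0 : (0:ℝ) < n := by exact_mod_cast hn
    have e1 : (if n ∈ Finset.Ioc N0 N1 then α n else 0) - α n * hh b x y (Real.log n) =
        - (α n * (hh b x y (Real.log n) - (if x < Real.log n ∧ Real.log n ≤ y then 1 else 0))) := by
      have : n ∈ Finset.Ioc N0 N1 ↔ x < Real.log n ∧ Real.log n ≤ y := by
        rw [Finset.mem_Ioc, hxd, hyd, Real.log_lt_log_iff hN0' hn0, Real.log_le_log_iff hn0 hN1']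
        norm_cast
      simp only [this]
      split_ifs <;> ring
    rw [e1, norm_neg, norm_mul, Real.norm_eq_abs, Real.norm_eq_abs]
    have hp1 : 0 ≤ (if n ∈ W1 then |α n| else 0) := by split_ifs <;> positivity
    have hp2 : 0 ≤ (if n ∈ W2 then |α n| else 0) := by split_ifs <;> positivity
    have hp3 : 0 ≤ ε * |α n| := by positivity
    have hone : |hh b x y (Real.log n) - (if x < Real.log n ∧ Real.log n ≤ y then 1 else 0)| ≤ 1 := by
      have g1 := hh_nonneg (b := b) (v := Real.log n) hxy
      have g2 := hh_le_one (v := Real.log n) hb0 hxy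
      split_ifs <;> rw [abs_le] <;> constructor <;> linarith
    have hone' := mul_le_of_le_one_right (abs_nonneg (α n)) hone
    by_cases hc1 : |Real.log n - x| < δ
    · have : n ∈ W1 := Finset.mem_filter.2 ⟨hmem n hn x (by linarith) hc1, hc1⟩
      rw [if_pos this]
      linarith
    · by_cases hc2 : |Real.log n - y| < δ
      · have : n ∈ W2 := Finset.mem_filter.2 ⟨hmem n hn y hy hc2, hc2⟩
        rw [if_pos this]
        linarith
      · have g := hh_approx hb0 hδ0.le hxy (not_lt.1 hc1) (not_lt.1 hc2)
        have : |α n| * |hh b x y (Real.log n) - (if x < Real.log n ∧ Real.log n ≤ y then 1 else 0)| ≤ |α n| * ε := by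
          gcongr
        linarith)
  rw [hD.tsum_eq, Real.norm_eq_abs] at hDb
  have htiny : ε * (p * (2^k * C0)) ≤ Real.exp (-L) / √κ := tiny_bound hP h0 hLC0
  have hexpL : Real.exp (-L) / √κ ≤ L * (Real.exp (-(c*L/8)) / √κ) := by
    have : Real.exp (-L) ≤ Real.exp (-(c*L/8)) := by
      rw [Real.exp_le_exp]; nlinarith
    have h3 : Real.exp (-L) / √κ ≤ Real.exp (-(c*L/8)) / √κ := by gcongr
    have h4 : 0 < Real.exp (-(c*L/8)) / √κ := by positivity
    nlinarith
  set Q := L * (Real.exp (-(c*L/8)) / √κ) with hQ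
  have hQ0 : 0 < Q := by positivity
  have h5 : ε * ∑' n, |α n| ≤ ε * (p * (2^k * C0)) := by gcongr
  have e36 : 36 * Real.exp (-L) / √κ = 36 * (Real.exp (-L) / √κ) := by ring
  rw [e36] at hE1 hE2
  have hfin : |∑ n ∈ Finset.Ioc N0 N1, α n| ≤ C * Q + 80 * Q := by
    have := abs_sub_abs_le_abs_sub (∑ n ∈ Finset.Ioc N0 N1, α n) (∑' n : ℕ, α n * hh b x y (Real.log n))
    have e : C * L * (Real.exp (-(c*L/8)) / √κ) = C * Q := by rw [hQ]; ring
    rw [e] at hmain'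
    linarith
  calc _ ≤ (C + 80) * Q := by linarith
    _ ≤ max (C+80) C0 * Q := by gcongr; exact le_max_left _ _
    _ = _ := by rw [hQ]; ring
end PAP


/-! Part 17 -/

namespace PAP
open Complex MeasureTheory ArithmeticFunction

lemma abel_bound (f w : ℕ → ℝ) (N0 : ℕ) {B : ℝ} (hw0 : 0 ≤ w N0) :
    ∀ N : ℕ, N0 ≤ N → (∀ n, N0 ≤ n → n < N → w n ≤ w (n+1)) →
    (∀ M, N0 ≤ M → M ≤ N → |∑ n ∈ Finset.Ioc N0 M, f n| ≤ B) →
    |∑ n ∈ Finset.Ioc N0 N, f n * w n| ≤ 2 * B * w N := by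
  intro N hN hmono hB
  have hB0 : 0 ≤ B := (abs_nonneg _).trans (hB N0 le_rfl hN)
  have key : ∀ M, N0 ≤ M → M ≤ N → w N0 ≤ w M ∧
      |∑ n ∈ Finset.Ioc N0 M, f n * w n - (∑ n ∈ Finset.Ioc N0 M, f n) * w M| ≤ B * (w M - w N0) := by
    intro M hM
    induction M, hM using Nat.le_induction with
    | base => intro _; simp
    | succ M hM ih =>
      intro hMN
      obtain ⟨h1, h2⟩ := ih (by omega)
      have h3 := hmono M hM (by omega)
      refine ⟨h1.trans h3, ?_⟩
      rw [Finset.sum_Ioc_succ_top (by omega), Finset.sum_Ioc_succ_top (by omega)]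
      have h4 := hB M hM (by omega)
      set S := ∑ n ∈ Finset.Ioc N0 M, f n
      set T := ∑ n ∈ Finset.Ioc N0 M, f n * w n
      have e : T + f (M+1) * w (M+1) - (S + f (M+1)) * w (M+1) = (T - S * w M) - S * (w (M+1) - w M) := by ring
      rw [e]
      refine (abs_sub _ _).trans ?_
      rw [abs_mul, abs_of_nonneg (sub_nonneg.2 h3)]
      have h5 : |S| * (w (M+1) - w M) ≤ B * (w (M+1) - w M) :=
        mul_le_mul_of_nonneg_right h4 (sub_nonneg.2 h3)
      linarith
  obtain ⟨h1, h2⟩ := key N hN le_rfl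
  have h3 := hB N hN le_rfl
  set S := ∑ n ∈ Finset.Ioc N0 N, f n
  set T := ∑ n ∈ Finset.Ioc N0 N, f n * w n
  have h4 : |T| ≤ |T - S * w N| + |S * w N| := by
    have := abs_add_le (T - S * w N) (S * w N)
    simpa using this
  rw [abs_mul, abs_of_nonneg (hw0.trans h1)] at h4
  have h5 := mul_le_mul_of_nonneg_right h3 (hw0.trans h1)
  nlinarith [mul_nonneg hB0 hw0]

/-- inverse weight -/
noncomputable def w1 (r : ℝ) (k : ℕ) (v : ℝ) : ℝ :=
  Real.exp ((1+r)*v) * k.factorial / (r^(k+1) * v^(k+1))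

lemma w1_mono {r : ℝ} (hr : 0 < r) {k : ℕ} {v v' : ℝ} (hv : (k:ℝ)+1 ≤ v) (hvv : v ≤ v') :
    w1 r k v ≤ w1 r k v' := by
  have hv0 : 0 < v := by have : (0:ℝ) ≤ k := Nat.cast_nonneg k; linarith
  have hv0' : 0 < v' := by linarith
  have h1 : (v'/v)^(k+1) ≤ Real.exp ((1+r)*(v'-v)) := by
    have h2 : v'/v ≤ Real.exp ((v'-v)/v) := by
      have := Real.add_one_le_exp ((v'-v)/v)
      have e : v'/v = (v'-v)/v + 1 := by field_simp; ring
      linarith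
    calc (v'/v)^(k+1) ≤ (Real.exp ((v'-v)/v))^(k+1) := pow_le_pow_left₀ (by positivity) h2 _
      _ = Real.exp (((k:ℝ)+1)/v*(v'-v)) := by
          rw [← Real.exp_nat_mul]; congr 1; push_cast; ring
      _ ≤ _ := by
          rw [Real.exp_le_exp]
          have h3 : ((k:ℝ)+1)/v ≤ 1 := (div_le_one hv0).2 hv
          have : 0 ≤ v' - v := by linarith
          gcongr
          linarith
  unfold w1
  rw [div_le_div_iff₀ (by positivity) (by positivity)]
  have e1 : Real.exp ((1+r)*v') = Real.exp ((1+r)*v) * Real.exp ((1+r)*(v'-v)) := by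
    rw [← Real.exp_add]; congr 1; ring
  have e2 : v'^(k+1) = v^(k+1) * (v'/v)^(k+1) := by
    rw [← mul_pow]; congr 1; field_simp
  rw [e1, e2]
  have hA : 0 ≤ Real.exp ((1+r)*v) * k.factorial * (r^(k+1) * v^(k+1)) := by positivity
  calc _ = (Real.exp ((1+r)*v) * k.factorial * (r^(k+1) * v^(k+1))) * (v'/v)^(k+1) := by ring
    _ ≤ (Real.exp ((1+r)*v) * k.factorial * (r^(k+1) * v^(k+1))) * Real.exp ((1+r)*(v'-v)) :=
        mul_le_mul_of_nonneg_left h1 hA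
    _ = _ := by ring

lemma fact_le {k : ℕ} (hk : 1 ≤ k) : (k.factorial:ℝ) ≤ Real.exp 1 * √k * (k / Real.exp 1)^k := by
  obtain ⟨m, rfl⟩ : ∃ m, k = m+1 := ⟨k-1, by omega⟩
  have h := Stirling.stirlingSeq'_antitone (Nat.zero_le m)
  simp only [Function.comp, Nat.succ_eq_add_one, zero_add, Stirling.stirlingSeq_one] at h
  unfold Stirling.stirlingSeq at h
  have hm : (0:ℝ) < ((m+1:ℕ):ℝ) := by positivity
  rw [div_le_div_iff₀ (by positivity) (by positivity), Real.sqrt_mul (by norm_num)] at h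
  have h2 : (0:ℝ) < √2 := by positivity
  nlinarith [mul_pos h2 h2]

lemma w1_top {r U : ℝ} {k : ℕ} (hk : 1 ≤ k) (hrU : r * U = k) :
    w1 r k U ≤ Real.exp 1 * Real.exp U / √k := by
  have hk0 : (0:ℝ) < k := by exact_mod_cast hk
  have hs : 0 < √(k:ℝ) := Real.sqrt_pos.2 hk0
  unfold w1
  rw [← mul_pow, hrU]
  have e : (1+r)*U = U + k := by rw [← hrU]; ring
  rw [e, Real.exp_add, div_le_div_iff₀ (by positivity) hs]
  have h := fact_le hk
  have e2 : Real.exp k * (k / Real.exp 1)^k = (k:ℝ)^k := by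
    rw [div_pow, ← Real.exp_nat_mul, mul_one]; field_simp
  calc Real.exp U * Real.exp k * k.factorial * √k ≤
      Real.exp U * Real.exp k * (Real.exp 1 * √k * (k / Real.exp 1)^k) * √k := by gcongr
    _ = Real.exp 1 * Real.exp U * (Real.exp k * (k / Real.exp 1)^k) * (√k * √k) := by ring
    _ = _ := by rw [e2, Real.mul_self_sqrt hk0.le]; ring

lemma WW_w1 {r : ℝ} (hr : 0 < r) {k n : ℕ} (hn : 2 ≤ n) :
    WW r k n * w1 r k (Real.log n) = Λ n / Real.log n := by
  have hn0 : (0:ℝ) < n := by positivity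
  have hl : 0 < Real.log n := Real.log_pos (by exact_mod_cast hn)
  unfold WW w1
  have e : Real.exp ((1+r) * Real.log n) = (n:ℝ)^(1+r) := by
    rw [Real.rpow_def_of_pos hn0]; congr 1; ring
  rw [e]
  have : 0 < (n:ℝ)^(1+r) := by positivity
  field_simp
  ring

lemma lam_bound {c : ℝ} (hc : 0 < c) (hc1 : c ≤ 1) : ∃ C : ℝ, 1 ≤ C ∧ ∀ (p κ k : ℕ) (L U r : ℝ),
    Par p c L U r κ k → r * U = k → 40 * κ ≤ U → C ≤ L → ∀ a : ℕ, 1 ≤ a → a < p →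
    ∀ N0 N1 : ℕ, 1 ≤ N0 → N0 ≤ N1 →
    U - 5*L ≤ Real.log N0 → Real.log N1 ≤ U →
    |∑ n ∈ Finset.Ioc N0 N1, cc p a n * (Λ n / Real.log n)| ≤
      C * L * Real.exp (-(c*L/8)) * (Real.exp U / U) := by
  obtain ⟨C, hC, h⟩ := sharp_bound hc hc1
  refine ⟨480 * C, by linarith, ?_⟩
  intro p κ k L U r hP hrU hκ40 hL a ha ha2 N0 N1 hN0 hN01 hx hy
  have hL1 := hP.hL1
  have hl1 : (1000:ℝ) * Real.log p ≤ U := by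
    refine le_trans ?_ hP.hLU
    have := hP.hl
    gcongr
  have hl2 := hP.hlL
  have hl3 := hP.hl
  have hU0 : 0 < U := by linarith
  have hr := hP.r_pos
  have hκ1 := hP.hκ1
  have hkk := hP.hk
  have hkR : (k:ℝ) + 1 = 2 * κ := by exact_mod_cast hkk
  have hk1 : 1 ≤ k := by omega
  have hk0 : (0:ℝ) < k := by exact_mod_cast hk1
  have hκR : (1:ℝ) ≤ κ := by exact_mod_cast hκ1
  have hkκ : (κ:ℝ) ≤ k := by linarith
  have hN0' : (0:ℝ) < N0 := by exact_mod_cast hN0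
  have hlow : (k:ℝ)+1 ≤ Real.log N0 := by linarith
  set B := C * L * (Real.exp (-(c*L/8)) / √κ) with hB
  have hlogmono : ∀ m n : ℕ, N0 ≤ m → m ≤ n → Real.log m ≤ Real.log n := by
    intro m n h1 h2
    exact Real.log_le_log (by exact_mod_cast (lt_of_lt_of_le hN0 h1)) (by exact_mod_cast h2)
  have hmain := abel_bound (fun n => cc p a n * WW r k n) (fun n => w1 r k (Real.log n)) N0 (B := B)
    (by
      have : 0 < Real.log N0 := by linarith
      unfold w1; positivity) N1 hN01 (by
      intro n hn _
      exact w1_mono hr (hlow.trans (hlogmono _ _ le_rfl hn)) (hlogmono _ _ hn (Nat.le_succ n))) (by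
      intro M hM hMN
      exact h p κ k L U r hP (by linarith) a ha ha2 N0 M hN0 hM hx ((hlogmono _ _ hM hMN).trans hy))
  have e : ∑ n ∈ Finset.Ioc N0 N1, cc p a n * WW r k n * w1 r k (Real.log n) =
      ∑ n ∈ Finset.Ioc N0 N1, cc p a n * (Λ n / Real.log n) := by
    refine Finset.sum_congr rfl fun n hn => ?_
    have := Finset.mem_Ioc.1 hn
    rw [mul_assoc, WW_w1 hr (by omega)]
  rw [e] at hmain
  refine hmain.trans ?_
  have hB0 : 0 ≤ B := by positivity
  have ht : w1 r k (Real.log N1) ≤ Real.exp 1 * Real.exp U / √k :=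
    (w1_mono hr (hlow.trans (hlogmono _ _ le_rfl hN01)) hy).trans (w1_top hk1 hrU)
  have hs : 0 < √(κ:ℝ) := hP.sκ_pos
  have hs2 : √(κ:ℝ) ≤ √(k:ℝ) := Real.sqrt_le_sqrt hkκ
  have ht2 : w1 r k (Real.log N1) ≤ 3 * Real.exp U / √κ := by
    refine ht.trans ?_
    have : Real.exp 1 ≤ 3 := by linarith [Real.exp_one_lt_d9]
    gcongr
  have hUκ := hP.hUκ
  calc 2 * B * w1 r k (Real.log N1) ≤ 2 * B * (3 * Real.exp U / √κ) := by gcongr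
    _ = 6 * C * L * Real.exp (-(c*L/8)) * Real.exp U / (√κ * √κ) := by rw [hB]; field_simp; ring
    _ = 6 * C * L * Real.exp (-(c*L/8)) * Real.exp U / κ := by rw [Real.mul_self_sqrt (by linarith)]
    _ ≤ 6 * C * L * Real.exp (-(c*L/8)) * Real.exp U / (U/80) := by
        gcongr
        linarith
    _ = _ := by field_simp; ring
end PAP


/-! Part 18 -/

namespace PAP
open Complex MeasureTheory ArithmeticFunction

lemma cc_prime_sum {p : ℕ} (hp : p.Prime) (a N : ℕ) :
    |((p:ℝ)-1) * (((Finset.Ioc 0 N).filter (fun n => n.Prime ∧ n % p = a)).card : ℝ) -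
      (((Finset.Ioc 0 N).filter Nat.Prime).card : ℝ)| ≤
    |∑ n ∈ Finset.Ioc 0 N, cc p a n * (if n.Prime then 1 else 0)| + 1 := by
  have e : ∑ n ∈ Finset.Ioc 0 N, cc p a n * (if n.Prime then 1 else 0) =
      ((p:ℝ)-1) * (((Finset.Ioc 0 N).filter (fun n => n.Prime ∧ n % p = a)).card : ℝ) -
      (((Finset.Ioc 0 N).filter Nat.Prime).card : ℝ) +
      (((Finset.Ioc 0 N).filter (fun n => n.Prime ∧ p ∣ n)).card : ℝ) := by
    rw [Finset.card_filter, Finset.card_filter, Finset.card_filter]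
    push_cast
    rw [Finset.mul_sum, ← Finset.sum_sub_distrib, ← Finset.sum_add_distrib]
    refine Finset.sum_congr rfl fun n _ => ?_
    unfold cc
    by_cases h1 : n.Prime <;> by_cases h2 : n % p = a <;> by_cases h3 : p ∣ n <;>
      simp only [h1, h2, h3, if_true, if_false, and_true, and_false, true_and, false_and] <;> ring
  have hle : (((Finset.Ioc 0 N).filter (fun n => n.Prime ∧ p ∣ n)).card : ℝ) ≤ 1 := by
    have : ((Finset.Ioc 0 N).filter (fun n => n.Prime ∧ p ∣ n)).card ≤ ({p} : Finset ℕ).card := by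
      refine Finset.card_le_card fun n hn => ?_
      have h := (Finset.mem_filter.1 hn).2
      rw [Finset.mem_singleton]
      exact ((Nat.prime_dvd_prime_iff_eq hp h.1).1 h.2).symm
    exact_mod_cast this
  have h0 : (0:ℝ) ≤ (((Finset.Ioc 0 N).filter (fun n => n.Prime ∧ p ∣ n)).card : ℝ) := Nat.cast_nonneg _
  set z := (((Finset.Ioc 0 N).filter (fun n => n.Prime ∧ p ∣ n)).card : ℝ)
  set y := ((p:ℝ)-1) * (((Finset.Ioc 0 N).filter (fun n => n.Prime ∧ n % p = a)).card : ℝ) -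
      (((Finset.Ioc 0 N).filter Nat.Prime).card : ℝ)
  rw [e]
  have := abs_sub (y+z) z
  rw [abs_of_nonneg h0] at this
  have e2 : y + z - z = y := by ring
  rw [e2] at this
  linarith

lemma low_sum {p : ℕ} (hp : p.Prime) {a : ℕ} (ha : a < p) (N0 : ℕ) :
    |∑ n ∈ Finset.Ioc 0 N0, cc p a n * (if n.Prime then 1 else 0)| ≤ 2 * N0 + 2 * p := by
  have hp0 : (0:ℝ) < p := by exact_mod_cast hp.pos
  calc _ ≤ ∑ n ∈ Finset.Ioc 0 N0, |cc p a n * (if n.Prime then 1 else 0)| := Finset.abs_sum_le_sum_abs _ _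
    _ ≤ ∑ n ∈ Finset.Ioc 0 N0, ((p:ℝ) * (if n % p = a then 1 else 0) + 1) := by
        refine Finset.sum_le_sum fun n _ => ?_
        rw [abs_mul]
        have h1 := cc_abs hp a n
        have h2 : |(if n.Prime then (1:ℝ) else 0)| ≤ 1 := by split_ifs <;> simp
        exact (mul_le_of_le_one_right (abs_nonneg _) h2).trans h1
    _ = p * (((Finset.Ioc 0 N0).filter (fun n => n % p = a)).card : ℝ) + N0 := by
        rw [Finset.sum_add_distrib, ← Finset.mul_sum]; simp
    _ ≤ p * (((N0:ℝ) - (0:ℕ))/p + 2) + N0 := by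
        have := window_count p a 0 N0 hp.pos ha (Nat.zero_le _)
        gcongr
    _ = _ := by push_cast; field_simp; ring

lemma pp_sum {p : ℕ} (hp : p.Prime) (a N0 : ℕ) {X : ℝ} (hX : 1 ≤ X) :
    |∑ n ∈ Finset.Ioc N0 ⌊X⌋₊, cc p a n * ((if n.Prime then 1 else 0) - Λ n / Real.log n)| ≤
      4 * p * √X * Real.log X := by
  have hp0 : (0:ℝ) < p := by exact_mod_cast hp.pos
  have hterm : ∀ n ∈ Finset.Ioc 0 ⌊X⌋₊, |cc p a n * ((if n.Prime then 1 else 0) - Λ n / Real.log n)| ≤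
      p * (2 * (if ¬ n.Prime then Λ n else 0)) := by
    intro n hn
    rw [abs_mul]
    refine mul_le_mul (cc_abs' hp a n) ?_ (abs_nonneg _) hp0.le
    by_cases h : n.Prime
    · have hl : 0 < Real.log n := Real.log_pos (by exact_mod_cast h.one_lt)
      rw [vonMangoldt_apply_prime h, div_self hl.ne']
      simp [h]
    · simp only [h, if_false, not_false_eq_true, if_true, zero_sub, abs_neg]
      rcases Nat.lt_or_ge n 2 with h2 | h2
      · have := (Finset.mem_Ioc.1 hn).1
        have : n = 1 := by omega
        subst this
        simp
      · have hl : 1/2 ≤ Real.log n := by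
          have h3 := Real.log_le_log (by norm_num) (show (2:ℝ) ≤ n by exact_mod_cast h2)
          linarith [Real.log_two_gt_d9]
        have h0 : 0 ≤ Λ n := vonMangoldt_nonneg
        rw [abs_of_nonneg (by positivity), div_le_iff₀ (by linarith)]
        nlinarith
  calc _ ≤ ∑ n ∈ Finset.Ioc N0 ⌊X⌋₊, |cc p a n * ((if n.Prime then 1 else 0) - Λ n / Real.log n)| :=
        Finset.abs_sum_le_sum_abs _ _
    _ ≤ ∑ n ∈ Finset.Ioc 0 ⌊X⌋₊, |cc p a n * ((if n.Prime then 1 else 0) - Λ n / Real.log n)| :=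
        Finset.sum_le_sum_of_subset_of_nonneg (Finset.Ioc_subset_Ioc_left (Nat.zero_le _))
          fun _ _ _ => abs_nonneg _
    _ ≤ ∑ n ∈ Finset.Ioc 0 ⌊X⌋₊, p * (2 * (if ¬ n.Prime then Λ n else 0)) := Finset.sum_le_sum hterm
    _ = p * (2 * (Chebyshev.psi X - Chebyshev.theta X)) := by
        rw [Chebyshev.psi_sub_theta_eq_sum_not_prime, ← Finset.mul_sum, ← Finset.mul_sum, Finset.sum_filter]
    _ ≤ p * (2 * (2 * √X * Real.log X)) := by
        have := Chebyshev.psi_sub_theta_le hX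
        gcongr
    _ = _ := by ring

set_option maxHeartbeats 1000000 in
lemma count_bound {c : ℝ} (hc : 0 < c) (hc1 : c ≤ 1) : ∃ C : ℝ, 1 ≤ C ∧ ∀ (p κ k : ℕ) (L U r : ℝ),
    Par p c L U r κ k → r * U = k → 40 * κ ≤ U → C ≤ L → ∀ a : ℕ, 1 ≤ a → a < p →
    |((p:ℝ)-1) * (((Finset.Ioc 0 ⌊Real.exp U⌋₊).filter (fun n => n.Prime ∧ n % p = a)).card : ℝ) -
      (((Finset.Ioc 0 ⌊Real.exp U⌋₊).filter Nat.Prime).card : ℝ)| ≤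
      C * Real.exp (-(c*L/16)) * (Real.exp U / U) := by
  obtain ⟨C, hC, h⟩ := lam_bound hc hc1
  have hCc : C ≤ C * (16/c) := by
    have : 1 ≤ 16/c := by rw [le_div_iff₀ hc]; linarith
    nlinarith
  refine ⟨C * (16/c) + 9, by linarith, ?_⟩
  intro p κ k L U r hP hrU hκ40 hL a ha ha2
  have hL1 := hP.hL1
  have hp := hP.hp
  have hl1 : (1000:ℝ) * Real.log p ≤ U := by
    refine le_trans ?_ hP.hLU
    have := hP.hl
    gcongr
  have hl2 := hP.hlL
  have hl3 := hP.hl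
  have hUL := hP.hUL
  have hU1 : 1 ≤ U := by linarith
  have hU0 : 0 < U := by linarith
  set X := Real.exp U with hX
  have hX1 : 1 ≤ X := Real.one_le_exp hU0.le
  set N := ⌊X⌋₊ with hN
  set N0 := ⌊Real.exp (U - 4*L)⌋₊ with hN0
  have hN01 : N0 ≤ N := Nat.floor_mono (Real.exp_le_exp.2 (by linarith))
  have hN0le : (N0:ℝ) ≤ Real.exp (U-4*L) := Nat.floor_le (Real.exp_pos _).le
  have hN0ge : Real.exp (U-5*L) ≤ N0 := by
    have h1 := Nat.lt_floor_add_one (Real.exp (U-4*L))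
    rw [← hN0] at h1
    have e : Real.exp (U-4*L) = Real.exp (U-5*L) * Real.exp L := by rw [← Real.exp_add]; congr 1; ring
    have h2 := Real.add_one_le_exp L
    have h3 : 1 ≤ Real.exp (U-5*L) := Real.one_le_exp (by linarith)
    nlinarith
  have hN0pos : (0:ℝ) < N0 := lt_of_lt_of_le (Real.exp_pos _) hN0ge
  have hN0one : 1 ≤ N0 := by exact_mod_cast hN0pos
  have hNpos : (0:ℝ) < N := by exact_mod_cast (lt_of_lt_of_le hN0one hN01)
  have hmain := h p κ k L U r hP hrU hκ40 (by linarith) a ha ha2 N0 N hN0one hN01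
    (by rwa [Real.le_log_iff_exp_le hN0pos])
    (by rw [Real.log_le_iff_le_exp hNpos]; exact Nat.floor_le (Real.exp_pos _).le)
  have h1 := cc_prime_sum hp a N
  have h2 := low_sum hp ha2 N0
  have h3 := pp_sum hp a N0 hX1
  rw [← hN, hX, Real.log_exp, ← hX] at h3
  have e1 : ∑ n ∈ Finset.Ioc 0 N, cc p a n * (if n.Prime then 1 else 0) =
      ∑ n ∈ Finset.Ioc 0 N0, cc p a n * (if n.Prime then 1 else 0) +
      (∑ n ∈ Finset.Ioc N0 N, cc p a n * ((if n.Prime then 1 else 0) - Λ n / Real.log n) +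
       ∑ n ∈ Finset.Ioc N0 N, cc p a n * (Λ n / Real.log n)) := by
    rw [← Finset.sum_add_distrib, ← Finset.sum_Ioc_consecutive _ (Nat.zero_le N0) hN01]
    congr 1
    refine Finset.sum_congr rfl fun n _ => ?_
    ring
  have h4 := abs_add_le (∑ n ∈ Finset.Ioc 0 N0, cc p a n * (if n.Prime then 1 else 0))
      (∑ n ∈ Finset.Ioc N0 N, cc p a n * ((if n.Prime then 1 else 0) - Λ n / Real.log n) +
       ∑ n ∈ Finset.Ioc N0 N, cc p a n * (Λ n / Real.log n))
  have h5 := abs_add_le (∑ n ∈ Finset.Ioc N0 N, cc p a n * ((if n.Prime then 1 else 0) - Λ n / Real.log n))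
       (∑ n ∈ Finset.Ioc N0 N, cc p a n * (Λ n / Real.log n))
  rw [← e1] at h4
  set G := Real.exp (-(c*L/16)) * (X/U) with hG
  have hXU : 0 < X/U := by positivity
  have hexp : Real.exp (-L) ≤ Real.exp (-(c*L/16)) := by rw [Real.exp_le_exp]; nlinarith
  have hexpG : Real.exp (-L) * (X/U) ≤ G := mul_le_mul_of_nonneg_right hexp hXU.le
  have hmain2 : C * L * Real.exp (-(c*L/8)) * (X/U) ≤ C * (16/c) * G := by
    have g1 : L ≤ 16/c * Real.exp (c*L/16) := by
      have := Real.add_one_le_exp (c*L/16)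
      calc L = 16/c * (c*L/16) := by field_simp
        _ ≤ _ := by gcongr; linarith
    have g2 : Real.exp (-(c*L/8)) * Real.exp (c*L/16) = Real.exp (-(c*L/16)) := by
      rw [← Real.exp_add]; congr 1; ring
    calc C * L * Real.exp (-(c*L/8)) * (X/U) ≤
        C * (16/c * Real.exp (c*L/16)) * Real.exp (-(c*L/8)) * (X/U) := by gcongr
      _ = C * (16/c) * ((Real.exp (-(c*L/8)) * Real.exp (c*L/16)) * (X/U)) := by ring
      _ = _ := by rw [g2]
  have hA : (N0:ℝ) ≤ Real.exp (-L) * (X/U) := by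
    rw [← mul_div_assoc, le_div_iff₀ hU0]
    calc (N0:ℝ) * U ≤ Real.exp (U-4*L) * Real.exp L := by gcongr
      _ = Real.exp (U - 3*L) := by rw [← Real.exp_add]; congr 1; ring
      _ ≤ Real.exp (-L + U) := Real.exp_le_exp.2 (by linarith)
      _ = _ := by rw [Real.exp_add]
  have hsX : √X = Real.exp (U/2) := by
    rw [hX, ← Real.exp_half]
  have hBd : p * √X * U ≤ Real.exp (-L) * (X/U) := by
    rw [← mul_div_assoc, le_div_iff₀ hU0, hsX, hP.p_eq]
    calc Real.exp (Real.log p) * Real.exp (U/2) * U * U ≤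
        Real.exp (Real.log p) * Real.exp (U/2) * Real.exp L * Real.exp L := by gcongr
      _ = Real.exp (Real.log p + U/2 + L + L) := by rw [← Real.exp_add, ← Real.exp_add, ← Real.exp_add]
      _ ≤ Real.exp (-L + U) := Real.exp_le_exp.2 (by linarith)
      _ = _ := by rw [Real.exp_add]
  have hpge := hP.p_ge
  have hpB : (p:ℝ) ≤ p * √X * U := by
    have g1 : 1 ≤ √X := by rw [Real.one_le_sqrt]; exact hX1
    have g2 : 1 ≤ √X * U := by nlinarith
    rw [mul_assoc]
    nlinarith
  have e4 : 4 * (p:ℝ) * √X * U = 4 * (p * √X * U) := by ring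
  have e5 : (C * (16/c) + 9) * Real.exp (-(c*L/16)) * (X/U) = C*(16/c)*G + 9*G := by rw [hG]; ring
  rw [e5]
  linarith

end PAP


/-! Part 19 -/

namespace PAP

lemma par_exists {p : ℕ} {c L U : ℝ} (hp : p.Prime) (hc0 : 0 < c) (hc1 : c ≤ 1) (hb : ¬ Bad c p)
    (hl : 200000 ≤ Real.log p) (hL1 : 1000 ≤ L) (hlL : 100 * L ≤ Real.log p)
    (hLU : L * Real.log p ≤ U) (hUL : U ≤ Real.exp L) :
    ∃ (κ k : ℕ) (r : ℝ), Par p c L U r κ k ∧ r * U = k ∧ 40 * κ ≤ U := by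
  have hU1 : 1000 ≤ U := by nlinarith
  have hU0 : 0 < U := by linarith
  set κ := ⌊U/40⌋₊ with hκ
  have h1 : (κ:ℝ) ≤ U/40 := Nat.floor_le (by positivity)
  have h2 : U/40 < κ + 1 := Nat.lt_floor_add_one _
  have hκ1 : 1 ≤ κ := Nat.le_floor (by push_cast; linarith)
  have hκR : (1:ℝ) ≤ κ := by exact_mod_cast hκ1
  have hk : (2*κ-1) + 1 = 2*κ := by omega
  have hkR : ((2*κ-1:ℕ):ℝ) + 1 = 2*κ := by exact_mod_cast hk
  refine ⟨κ, 2*κ-1, ((2*κ-1:ℕ):ℝ)/U, ?_, by field_simp, by linarith⟩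
  exact {
    hp := hp, hc0 := hc0, hc1 := hc1, bad := hb, hl := hl, hL1 := hL1, hlL := hlL, hLU := hLU, hUL := hUL
    hκ1 := hκ1
    hκU := by linarith
    hUκ := by linarith
    hk := hk
    hkU := by linarith
    hr0 := by rw [le_div_iff₀ hU0]; linarith
    hr1 := by rw [div_le_iff₀ hU0]; linarith
    hrU := by rw [div_mul_cancel₀ _ hU0.ne']; linarith }

lemma pi_lower {U : ℝ} (hU : 10 ≤ U) :
    Real.exp U / U ≤ 4 * (((Finset.Ioc 0 ⌊Real.exp U⌋₊).filter Nat.Prime).card : ℝ) := by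
  set X := Real.exp U with hX
  have hX1 : 11 ≤ X := by linarith [Real.add_one_le_exp U]
  have h1 := Chebyshev.psi_ge' (x := X) (by linarith)
  have h2 := Chebyshev.psi_le_primeCounting_mul_log' X
  rw [hX, Real.log_exp, ← hX] at h2
  have h3 : Real.log (X+2) ≤ (X+2)/8 - 1 + 3 * Real.log 2 := by
    have e : X + 2 = (X+2)/8 * 2^3 := by ring
    have h4 : Real.log (X+2) = Real.log ((X+2)/8) + 3 * Real.log 2 := by
      conv_lhs => rw [e]
      rw [Real.log_mul (by positivity) (by norm_num), Real.log_pow]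
      norm_num
    have := Real.log_le_sub_one_of_pos (show 0 < (X+2)/8 by positivity)
    linarith
  have h5 := Real.log_two_gt_d9
  have h6 := Real.log_two_lt_d9
  have e : Nat.primeCounting ⌊X⌋₊ = ((Finset.Ioc 0 ⌊X⌋₊).filter Nat.Prime).card := by
    rw [← Nat.primesLE_card_eq_primeCounting]
    congr 1
    ext n
    simp only [Nat.mem_primesLE, Finset.mem_filter, Finset.mem_Ioc]
    exact ⟨fun h => ⟨⟨h.2.pos, h.1⟩, h.2⟩, fun h => ⟨h.1.2, h.2⟩⟩
  rw [e] at h2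
  rw [div_le_iff₀ (by linarith)]
  nlinarith

lemma z1_large {L : ℝ} (hL : 25000000 ≤ L) : 100 * L ≤ Real.exp (L / Real.log L) := by
  set s := √L with hs
  have hs2 : s * s = L := Real.mul_self_sqrt (by linarith)
  have hs0 : 5000 ≤ s := by
    rw [hs]; apply Real.le_sqrt_of_sq_le; linarith
  have h1 : Real.log L ≤ 2 * s := by
    rw [← hs2, Real.log_mul (by linarith) (by linarith)]
    have := Real.log_le_sub_one_of_pos (show 0 < s by linarith)
    linarith
  have hl0 : 0 < Real.log L := Real.log_pos (by linarith)
  have h2 : s/2 ≤ L / Real.log L := by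
    rw [le_div_iff₀ hl0]
    nlinarith
  have h3 := Real.pow_div_factorial_le_exp (s/2) (by linarith) 3
  have h4 := Real.exp_le_exp.2 h2
  have h5 : 100 * L ≤ (s/2)^3 / (Nat.factorial 3 : ℝ) := by
    rw [← hs2]
    norm_num [Nat.factorial]
    nlinarith [mul_nonneg (show 0 ≤ s - 5000 by linarith) (mul_self_nonneg s)]
  linarith

lemma core {c : ℝ} (hc : 0 < c) (hc1 : c ≤ 1) : ∃ C : ℝ, 1 ≤ C ∧ ∀ (p : ℕ) (L U : ℝ), p.Prime → ¬ Bad c p →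
    C ≤ L → 1000 ≤ L → 200000 ≤ Real.log p → 100 * L ≤ Real.log p → L * Real.log p ≤ U → U ≤ Real.exp L →
    ∀ a : ℕ, 1 ≤ a → a < p →
    |(((Finset.Ioc 0 ⌊Real.exp U⌋₊).filter (fun n => n.Prime ∧ n % p = a)).card : ℝ) -
      (((Finset.Ioc 0 ⌊Real.exp U⌋₊).filter Nat.Prime).card : ℝ) / ((p:ℝ) - 1)| ≤
      C * (((Finset.Ioc 0 ⌊Real.exp U⌋₊).filter Nat.Prime).card : ℝ) / (((p:ℝ)-1) * U^(c/16)) := by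
  obtain ⟨C, hC, h⟩ := count_bound hc hc1
  refine ⟨4*C, by linarith, ?_⟩
  intro p L U hp hb hCL hL1 hl hlL hLU hUL a ha ha2
  obtain ⟨κ, k, r, hP, hrU, hκ⟩ := par_exists hp hc hc1 hb hl hL1 hlL hLU hUL
  have hm := h p κ k L U r hP hrU hκ (by linarith) a ha ha2
  have hU : 10 ≤ U := by nlinarith
  have hpi := pi_lower hU
  set PA := (((Finset.Ioc 0 ⌊Real.exp U⌋₊).filter (fun n => n.Prime ∧ n % p = a)).card : ℝ)
  set PX := (((Finset.Ioc 0 ⌊Real.exp U⌋₊).filter Nat.Prime).card : ℝ) with hPX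
  have hPX0 : 0 ≤ PX := Nat.cast_nonneg _
  have hp1 : 0 < (p:ℝ) - 1 := by
    have : (2:ℝ) ≤ p := by exact_mod_cast hp.two_le
    linarith
  have hUA : 0 < U^(c/16) := Real.rpow_pos_of_pos (by linarith) _
  have hexp : Real.exp (-(c*L/16)) ≤ 1 / U^(c/16) := by
    rw [Real.exp_neg, ← one_div]
    refine one_div_le_one_div_of_le hUA ?_
    calc U^(c/16) ≤ (Real.exp L)^(c/16) := Real.rpow_le_rpow (by linarith) hUL (by positivity)
      _ = _ := by rw [← Real.exp_mul]; congr 1; ring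
  have e : PA - PX/((p:ℝ)-1) = (((p:ℝ)-1)*PA - PX)/((p:ℝ)-1) := by field_simp
  rw [e, abs_div, abs_of_pos hp1, div_le_iff₀ hp1]
  calc _ ≤ _ := hm
    _ ≤ C * (1 / U^(c/16)) * (4 * PX) := by gcongr
    _ = _ := by field_simp

end PAP


namespace PAP
lemma primePi_eq {t : ℝ} (ht : 0 ≤ t) : primePi t = ((Finset.Ioc 0 ⌊t⌋₊).filter Nat.Prime).card := by
  unfold primePi
  rw [← Set.ncard_coe_finset]
  congr 1
  ext q
  simp only [Set.mem_setOf_eq, Finset.coe_filter, Finset.mem_Ioc, Nat.le_floor_iff ht]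
  exact ⟨fun h => ⟨⟨h.1.pos, h.2⟩, h.1⟩, fun h => ⟨h.2, h.1.2⟩⟩

lemma primePiAP_eq {t : ℝ} (ht : 0 ≤ t) (p a : ℕ) :
    primePiAP t p a = ((Finset.Ioc 0 ⌊t⌋₊).filter (fun n => n.Prime ∧ n % p = a)).card := by
  unfold primePiAP
  rw [← Set.ncard_coe_finset]
  congr 1
  ext q
  simp only [Set.mem_setOf_eq, Finset.coe_filter, Finset.mem_Ioc, Nat.le_floor_iff ht]
  exact ⟨fun h => ⟨⟨h.1.pos, h.2.1⟩, h.1, h.2.2⟩, fun h => ⟨h.2.1, h.1.2, h.2.2⟩⟩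
end PAP

theorem primes_in_progressions_uniform :
    ∃ A > (0 : ℝ), ∃ C > (0 : ℝ), ∃ x₀ : ℝ, ∀ x ≥ x₀,
      ∃ E : Finset ℕ,
        (∀ p ∈ E, Nat.Prime p) ∧
        ((E.card : ℝ) ≤ 2 * llog x) ∧
        (∀ p ∈ E, llog x < (p : ℝ)) ∧
        ∀ p : ℕ, p.Prime → p ∉ E →
          Real.exp ((Real.log x) ^ (1 / lllog x)) < (p : ℝ) →
          ∀ t : ℝ, (p : ℝ) ^ (llog x) < t →
            t ≤ Real.exp (Real.log x / llog x) →
            ∀ a : ℕ, 1 ≤ a → a ≤ p - 1 →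
              |(primePiAP t p a : ℝ) - (primePi t : ℝ) / ((p : ℝ) - 1)| ≤
                C * (primePi t : ℝ) / (((p : ℝ) - 1) * (Real.log t) ^ A) := by
  classical
  obtain ⟨c, hc, hc1, hbad⟩ := PAP.bad_unique
  obtain ⟨C, hC, hcore⟩ := PAP.core hc (by linarith)
  refine ⟨c/16, by positivity, C, by linarith, Real.exp (Real.exp (C + 25000000)), ?_⟩
  intro x hx
  have hx0 : 0 < x := lt_of_lt_of_le (Real.exp_pos _) hx
  have hlx : Real.exp (C + 25000000) ≤ Real.log x := by rwa [Real.le_log_iff_exp_le hx0]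
  have hlx0 : 0 < Real.log x := lt_of_lt_of_le (Real.exp_pos _) hlx
  have hllx : C + 25000000 ≤ Real.log (Real.log x) := by rwa [Real.le_log_iff_exp_le hlx0]
  have hLe : llog x = Real.log (Real.log x) := max_eq_right (by linarith)
  rw [hLe]
  have hl3 : 1 ≤ Real.log (Real.log (Real.log x)) := by
    rw [Real.le_log_iff_exp_le (by linarith)]
    linarith [Real.exp_one_lt_d9]
  have hLLe : lllog x = Real.log (Real.log (Real.log x)) := max_eq_right hl3
  rw [hLLe]
  set L := Real.log (Real.log x) with hL
  have hexpL : Real.exp L = Real.log x := Real.exp_log hlx0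
  have hz : (Real.log x) ^ (1 / Real.log L) = Real.exp (L / Real.log L) := by
    rw [← hexpL, ← Real.exp_mul]; congr 1; ring
  have hzL := PAP.z1_large (L := L) (by linarith)
  rw [hz]
  have hpbig : ∀ p : ℕ, Real.exp (Real.exp (L / Real.log L)) < p → 100 * L ≤ Real.log p := by
    intro p hp
    have hp0 : (0:ℝ) < p := lt_trans (Real.exp_pos _) hp
    refine hzL.trans ?_
    rw [Real.le_log_iff_exp_le hp0]
    exact hp.le
  have hpL : ∀ p : ℕ, Real.exp (Real.exp (L / Real.log L)) < p → L < p := by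
    intro p hp
    have h1 := hpbig p hp
    have hp0 : (0:ℝ) < p := lt_trans (Real.exp_pos _) hp
    have := Real.log_le_sub_one_of_pos hp0
    linarith
  set E := (Finset.Ioc 0 ⌊Real.exp (Real.log x / L)⌋₊).filter
    (fun p : ℕ => p.Prime ∧ PAP.Bad c p ∧ Real.exp (Real.exp (L / Real.log L)) < p) with hE
  refine ⟨E, ?_, ?_, ?_, ?_⟩
  · intro p hp
    exact (Finset.mem_filter.1 hp).2.1
  · have hmaps : ∀ p ∈ E, ⌊Real.log (Real.log p)⌋₊ ∈ Finset.range (⌊L⌋₊ + 1) := by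
      intro p hp
      obtain ⟨h1, h2, h3, h4⟩ := Finset.mem_filter.1 hp
      rw [Finset.mem_range, Nat.lt_succ_iff]
      apply Nat.floor_mono
      have h5 : (p:ℝ) ≤ Real.exp (Real.log x / L) := by
        have := (Finset.mem_Ioc.1 h1).2
        rwa [Nat.le_floor_iff (Real.exp_pos _).le] at this
      have hp0 : (0:ℝ) < p := lt_trans (Real.exp_pos _) h4
      have h6 : Real.log p ≤ Real.log x := by
        rw [← Real.log_le_iff_le_exp hp0] at h5
        refine h5.trans (div_le_self hlx0.le (by linarith))
      exact Real.log_le_log (by linarith [hpbig p h4]) h6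
    have hinj : Set.InjOn (fun p : ℕ => ⌊Real.log (Real.log p)⌋₊) (E : Set ℕ) := by
      intro p hp q hq hpq
      obtain ⟨_, h2, h3, h4⟩ := Finset.mem_filter.1 (Finset.mem_coe.1 hp)
      obtain ⟨_, k2, k3, k4⟩ := Finset.mem_filter.1 (Finset.mem_coe.1 hq)
      have g1 : (3:ℝ) ≤ p := by linarith [hpL p h4]
      have g2 : (3:ℝ) ≤ q := by linarith [hpL q k4]
      exact hbad p q h2 k2 (by exact_mod_cast g1) (by exact_mod_cast g2) hpq h3 k3
    have hcard := Finset.card_le_card_of_injOn _ hmaps hinj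
    rw [Finset.card_range] at hcard
    have h1 : (E.card:ℝ) ≤ ⌊L⌋₊ + 1 := by exact_mod_cast hcard
    have h2 : (⌊L⌋₊:ℝ) ≤ L := Nat.floor_le (by linarith)
    linarith
  · intro p hp
    exact hpL p (Finset.mem_filter.1 hp).2.2.2
  · intro p hp hpE hzp t hpt ht a ha1 ha2
    have hp0 : (0:ℝ) < p := by exact_mod_cast hp.pos
    have hp1 : (1:ℝ) ≤ p := by exact_mod_cast hp.one_lt.le
    have ht0 : 0 < t := lt_trans (Real.rpow_pos_of_pos hp0 _) hpt
    have hptle : (p:ℝ) ≤ t := by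
      have : (p:ℝ)^(1:ℝ) ≤ (p:ℝ)^L := Real.rpow_le_rpow_of_exponent_le hp1 (by linarith)
      rw [Real.rpow_one] at this
      linarith
    have hnb : ¬ PAP.Bad c p := by
      intro hb
      apply hpE
      rw [hE, Finset.mem_filter, Finset.mem_Ioc, Nat.le_floor_iff (Real.exp_pos _).le]
      exact ⟨⟨hp.pos, hptle.trans ht⟩, hp, hb, hzp⟩
    have hU1 : L * Real.log p ≤ Real.log t := by
      rw [← Real.log_rpow hp0]
      exact Real.log_le_log (Real.rpow_pos_of_pos hp0 _) hpt.le
    have hU2 : Real.log t ≤ Real.exp L := by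
      rw [hexpL]
      refine le_trans ((Real.log_le_iff_le_exp ht0).2 ht) (div_le_self hlx0.le (by linarith))
    have hlp := hpbig p hzp
    have := hp.two_le
    have hfin := hcore p L (Real.log t) hp hnb (by linarith) (by linarith) (by linarith) hlp hU1 hU2 a ha1 (by omega)
    rw [Real.exp_log ht0] at hfin
    rw [PAP.primePi_eq ht0.le, PAP.primePiAP_eq ht0.le]
    exact hfin
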